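/- Let G be an acylindrically hyperbolic group. Then for every finite generating set S of G, the proportion of Morse elements in the word-metric ball of radius n tends to 1, i.e. lim_{n→∞} #{g ∈ B_S(n) : g is a Morse element of G} / #B_S(n) = 1. -/

import Mathlib

namespace AcylCount

/-! ### Geodesic segments and Gromov hyperbolicity -/

/-- A finite geodesic segment in a metric space, parametrized by arclength on `[0, len]`,
oriented from `initial := toFun 0` to `terminal := toFun len`. -/
structure GeodesicSegment (X : Type*) [MetricSpace X] where
  len : ℝ
  len_nonneg : 0 ≤ len
  toFun : ℝ → X
  isom : ∀ s ∈ Set.Icc (0:ℝ) len, ∀ t ∈ Set.Icc (0:ℝ) len,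
    dist (toFun s) (toFun t) = |s - t|

namespace GeodesicSegment

variable {X : Type*} [MetricSpace X]

/-- The initial point of a geodesic segment. -/
def initial (γ : GeodesicSegment X) : X := γ.toFun 0

/-- The terminal point of a geodesic segment. -/
def terminal (γ : GeodesicSegment X) : X := γ.toFun γ.len

/-- The image (underlying set) of a geodesic segment. -/
def seg (γ : GeodesicSegment X) : Set X := γ.toFun '' Set.Icc 0 γ.len

/-- The translate of a geodesic segment by an isometry. -/
def translate (γ : GeodesicSegment X) (f : X → X) (hf : Isometry f) :
    GeodesicSegment X where
  len := γ.len
  len_nonneg := γ.len_nonneg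
  toFun := f ∘ γ.toFun
  isom := fun s hs t ht => by
    simp only [Function.comp_apply, hf.dist_eq]
    exact γ.isom s hs t ht

/-- The degenerate geodesic segment consisting of a single point. -/
def point (p : X) : GeodesicSegment X where
  len := 0
  len_nonneg := le_refl 0
  toFun := fun _ => p
  isom := fun s hs t ht => by
    have hs0 : s = 0 := le_antisymm hs.2 hs.1
    have ht0 : t = 0 := le_antisymm ht.2 ht.1
    simp [hs0, ht0]

/-- `η` is a subsegment of `γ`. -/
def IsSubsegment (η γ : GeodesicSegment X) : Prop :=
  ∃ a b : ℝ, 0 ≤ a ∧ a ≤ b ∧ b ≤ γ.len ∧ η.len = b - a ∧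
    ∀ t ∈ Set.Icc (0:ℝ) η.len, η.toFun t = γ.toFun (a + t)

/-- `p` occurs (weakly) before `q` along the oriented geodesic segment `γ`. -/
def Before (γ : GeodesicSegment X) (p q : X) : Prop :=
  ∃ s t : ℝ, s ∈ Set.Icc (0:ℝ) γ.len ∧ t ∈ Set.Icc (0:ℝ) γ.len ∧ s ≤ t ∧
    γ.toFun s = p ∧ γ.toFun t = q

end GeodesicSegment

/-- A geodesic metric space: every two points are joined by a geodesic segment. -/
def IsGeodesicSpace (X : Type*) [MetricSpace X] : Prop :=
  ∀ x y : X, ∃ γ : GeodesicSegment X, γ.initial = x ∧ γ.terminal = y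

/-- δ-hyperbolicity via slim triangles: each side of a geodesic triangle lies in the
closed δ-neighborhood of the union of the other two sides. -/
def IsDeltaHyperbolic (X : Type*) [MetricSpace X] (δ : ℝ) : Prop :=
  ∀ γ₁ γ₂ γ₃ : GeodesicSegment X,
    γ₁.initial = γ₃.initial → γ₁.terminal = γ₂.initial → γ₂.terminal = γ₃.terminal →
    γ₃.seg ⊆ Metric.cthickening δ (γ₁.seg ∪ γ₂.seg)

variable {X : Type*} [MetricSpace X]

/-- The closest point projection of `x` to (the image of) the geodesic `γ`. -/
def proj (γ : GeodesicSegment X) (x : X) : Set X :=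
  {p | p ∈ γ.seg ∧ dist x p = Metric.infDist x γ.seg}

/-- The closest point projection of a set `A` to the geodesic `γ`. -/
def projSet (γ : GeodesicSegment X) (A : Set X) : Set X :=
  ⋃ a ∈ A, proj γ a

/-- The ordered pair of oriented geodesic segments `(γ, η)` is `K`-aligned. -/
def AlignedPair (K : ℝ) (γ η : GeodesicSegment X) : Prop :=
  Metric.diam (projSet γ η.seg ∪ {γ.terminal}) < K ∧
  Metric.diam (projSet η γ.seg ∪ {η.initial}) < K

/-- A sequence of oriented geodesic segments is `K`-aligned if each consecutive
pair is `K`-aligned. -/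
def AlignedSeq (K : ℝ) (l : List (GeodesicSegment X)) : Prop :=
  l.Chain' (AlignedPair K)

/-- The Gromov product `(y, z)_x`. -/
noncomputable def gromovProd (x y z : X) : ℝ := (dist y x + dist x z - dist y z) / 2

/-! ### Word metric -/

variable {G : Type*} [Group G]

/-- The word length of `g` with respect to the (symmetrized) generating set `S`. -/
noncomputable def wordLength (S : Finset G) (g : G) : ℕ :=
  sInf {n | ∃ l : List G, l.length = n ∧ (∀ x ∈ l, x ∈ S ∨ x⁻¹ ∈ S) ∧ l.prod = g}

/-- The word metric on `G` with respect to `S`. -/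
noncomputable def wordDist (S : Finset G) (g h : G) : ℕ := wordLength S (g⁻¹ * h)

/-- The ball of radius `r` in the word metric, centered at the identity. -/
def ball (S : Finset G) (r : ℝ) : Set G := {g | (wordLength S g : ℝ) ≤ r}

/-- `G` has no cyclic subgroup of finite index. -/
def NonVirtuallyCyclic (G : Type*) [Group G] : Prop :=
  ¬ ∃ H : Subgroup G, H.FiniteIndex ∧ IsCyclic H

/-! ### Isometric actions, loxodromics, WPD -/

/-- `g` is a loxodromic isometry for the action `ρ` with basepoint `x0`: the asymptotic
translation length `τ_X(g) = lim dist x0 (g^n x0) / n` exists and is positive. -/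
def IsLoxodromic (ρ : G → X → X) (x0 : X) (g : G) : Prop :=
  ∃ τ : ℝ, 0 < τ ∧
    Filter.Tendsto (fun n : ℕ => dist x0 (ρ (g ^ n) x0) / n) Filter.atTop (nhds τ)

/-- The WPD (weak proper discontinuity) property of `g` for the action `ρ` with
basepoint `x0`. -/
def HasWPD (ρ : G → X → X) (x0 : X) (g : G) : Prop :=
  ∀ K : ℝ, 0 < K → ∃ N M : ℕ,
    {h : G | dist x0 (ρ h x0) < K ∧ dist (ρ (g ^ N) x0) (ρ h (ρ (g ^ N) x0)) < K}.Finite ∧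
    {h : G | dist x0 (ρ h x0) < K ∧ dist (ρ (g ^ N) x0) (ρ h (ρ (g ^ N) x0)) < K}.ncard < M

/-- The list of translated geodesics `h 1 • Υ, …, h m • Υ`. -/
def transList (ρ : G → X → X) (hisom : ∀ g : G, Isometry (ρ g))
    (Υ : GeodesicSegment X) (h : ℕ → G) (m : ℕ) : List (GeodesicSegment X) :=
  (List.range m).map fun i => Υ.translate (ρ (h (i + 1))) (hisom _)

/-- The specification of the constant `E₀` from Fact 2.7 (Bestvina–Fujiwara):
(i) Gromov product bounds, (ii) the WPD-type conclusion for large projections. -/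
def E0Spec (S : Finset G) (ρ : G → X → X) (x0 : X) (φ : G) (E0 : ℝ) : Prop :=
  0 < E0 ∧
  (∀ g : G, ∃ s t : G, (s ∈ S ∨ s = 1) ∧ (t ∈ S ∨ t = 1) ∧
    (∀ i : ℤ, 0 < i → gromovProd x0 (ρ (φ ^ i) x0) (ρ (s * g) x0) ≤ E0) ∧
    (∀ j : ℤ, j < 0 → gromovProd x0 (ρ (φ ^ j) x0) (ρ (t * g) x0) ≤ E0)) ∧
  (∀ n : ℕ, 0 < n → ∀ g : G, ∀ γ : GeodesicSegment X,
    γ.initial = x0 → γ.terminal = ρ (φ ^ n) x0 →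
    ∀ p ∈ proj γ (ρ g x0), ∀ q ∈ proj γ (ρ (g * φ ^ n) x0),
      γ.Before p q → E0 < dist p q →
      ∃ i j : ℕ, i ≤ n ∧ j ≤ n ∧ (wordDist S (φ ^ i) (g * φ ^ j) : ℝ) < E0)

/-- The set `V_{L,ε}(n)`. Here `Υ` is the chosen geodesic `Υ_L = [x₀, φ^L x₀]`. -/
def Vset (S : Finset G) (ρ : G → X → X) (hisom : ∀ g : G, Isometry (ρ g)) (x0 : X)
    (δ E0 : ℝ) (Υ : GeodesicSegment X) (ε : ℝ) (n : ℕ) : Set G :=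
  {g | g ∈ ball S (n:ℝ) ∧ ∃ h : ℕ → G,
    AlignedSeq (6 * E0 + 300 * δ)
      ([GeodesicSegment.point x0] ++ transList ρ hisom Υ h ⌈ε * (n:ℝ)⌉₊ ++
        [GeodesicSegment.point (ρ g x0)])}

/-- The set `W_{L,ε}(n)`. Here `Υ` is the chosen geodesic `Υ_L = [x₀, φ^L x₀]`. -/
def Wset (S : Finset G) (ρ : G → X → X) (hisom : ∀ g : G, Isometry (ρ g)) (x0 : X)
    (δ E0 : ℝ) (Υ : GeodesicSegment X) (ε : ℝ) (n : ℕ) : Set G :=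
  {g | g ∈ ball S (n:ℝ) ∧ ∃ h : ℕ → G,
    AlignedSeq (6 * E0 + 360 * δ)
      ([GeodesicSegment.point x0] ++ transList ρ hisom Υ h ⌈ε * (n:ℝ)⌉₊ ++
        [GeodesicSegment.point (ρ g x0)]) ∧
    AlignedPair (6 * E0 + 360 * δ) (GeodesicSegment.point (ρ g⁻¹ x0))
      (Υ.translate (ρ (h 1)) (hisom _)) ∧
    AlignedPair (6 * E0 + 360 * δ) (Υ.translate (ρ (h ⌈ε * (n:ℝ)⌉₊)) (hisom _))
      (GeodesicSegment.point (ρ (g ^ 2) x0))}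

/-- The set `BAD_{L,ε}(n)`. -/
def BADset (S : Finset G) (ρ : G → X → X) (hisom : ∀ g : G, Isometry (ρ g)) (x0 : X)
    (δ E0 : ℝ) (Υ : GeodesicSegment X) (ε : ℝ) (n : ℕ) : Set G :=
  ball S (n:ℝ) \ (ball S ((⌊(0.9:ℝ) * (n:ℝ)⌋₊ : ℕ) : ℝ) ∪ Vset S ρ hisom x0 δ E0 Υ ε n)

/-! ### Paths in the word metric -/

/-- `P` is a `d_S`-path connecting `a` to `b`. -/
noncomputable def IsPathFrom (S : Finset G) (P : List G) (a b : G) : Prop :=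
  P ≠ [] ∧ P.Chain' (fun u v => wordDist S u v = 1) ∧ P.head? = some a ∧ P.getLast? = some b

/-- The distance `d_S(P, g)` from a path `P` to a group element `g`. -/
noncomputable def pathDist (S : Finset G) (P : List G) (g : G) : ℕ :=
  sInf {d | ∃ v ∈ P, d = wordDist S v g}


/-- An element `g` is a Morse element of `(G, d_S)`: its orbit `{g^i}` is unbounded,
and every `(λ, C)`-quasigeodesic with endpoints on `{g^i}` stays in a uniform
neighborhood of `{g^i}`. -/
def IsMorse {G : Type*} [Group G] (S : Finset G) (g : G) : Prop :=
  (∀ R : ℕ, ∃ i : ℤ, R < wordLength S (g ^ i)) ∧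
  ∀ lam C : ℝ, 1 ≤ lam → 0 ≤ C → ∃ N : ℝ, 0 ≤ N ∧
    ∀ (a b : ℤ) (q : ℤ → G), a ≤ b →
      (∀ s ∈ Set.Icc a b, ∀ t ∈ Set.Icc a b,
        ((|s - t| : ℤ) : ℝ) / lam - C ≤ (wordDist S (q s) (q t) : ℝ) ∧
        (wordDist S (q s) (q t) : ℝ) ≤ lam * ((|s - t| : ℤ) : ℝ) + C) →
      (∃ i : ℤ, q a = g ^ i) → (∃ j : ℤ, q b = g ^ j) →
      ∀ s ∈ Set.Icc a b, ∃ i : ℤ, (wordDist S (q s) (g ^ i) : ℝ) ≤ N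

/-- A witness to acylindrical hyperbolicity: a geodesic δ-hyperbolic space with an
isometric `G`-action admitting a WPD loxodromic element. -/
structure AcylHypWitness (G : Type*) [Group G] where
  X : Type
  [inst : MetricSpace X]
  δ : ℝ
  δ_pos : 0 < δ
  geodesic : IsGeodesicSpace X
  hyperbolic : IsDeltaHyperbolic X δ
  ρ : G → X → X
  isom : ∀ g : G, Isometry (ρ g)
  mul : ∀ g h : G, ∀ x : X, ρ (g * h) x = ρ g (ρ h x)
  one : ∀ x : X, ρ 1 x = x
  x0 : X
  φ : G
  lox : IsLoxodromic ρ x0 φ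
  wpd : HasWPD ρ x0 φ

/-- `G` is acylindrically hyperbolic. -/
def AcylindricallyHyperbolic (G : Type*) [Group G] : Prop :=
  NonVirtuallyCyclic G ∧ Nonempty (AcylHypWitness G)

section

/-- A left-invariant pseudo-metric on a group satisfying the four-point condition. -/
structure HypMetric (G : Type*) [Group G] where
  D : G → G → ℝ
  δ : ℝ
  δ_pos : 0 < δ
  self : ∀ x, D x x = 0
  symm : ∀ x y, D x y = D y x
  tri : ∀ x y z, D x z ≤ D x y + D y z
  left : ∀ k x y, D (k * x) (k * y) = D x y
  four : ∀ x y z w, D x z + D y w ≤ D x y + D z w + 2 * δ ∨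
    D x z + D y w ≤ D x w + D y z + 2 * δ

namespace HypMetric

variable {G : Type*} [Group G] (H : HypMetric G)

/-- The Gromov product of `x` and `y` based at `z`. -/
noncomputable def gp (x y z : G) : ℝ := (H.D x z + H.D y z - H.D x y) / 2

lemma nonneg (x y : G) : 0 ≤ H.D x y := by
  have h1 := H.tri x y x
  have h2 := H.self x
  have h3 := H.symm x y
  linarith

lemma gp_comm (x y z : G) : H.gp x y z = H.gp y x z := by
  unfold gp; rw [H.symm x y]; ring

lemma gp_left (k x y z : G) : H.gp (k * x) (k * y) (k * z) = H.gp x y z := by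
  simp only [gp, H.left]

lemma gp_nonneg (x y z : G) : 0 ≤ H.gp x y z := by
  have := H.tri x z y
  have := H.symm y z
  unfold gp; linarith

lemma gp_le_left (x y z : G) : H.gp x y z ≤ H.D x z := by
  have := H.tri y x z
  have := H.symm y x
  unfold gp; linarith

lemma gp_le_right (x y z : G) : H.gp x y z ≤ H.D y z := by
  rw [gp_comm]; exact H.gp_le_left y x z

lemma gp_add (x y z : G) : H.gp x y z + H.gp x z y = H.D y z := by
  have := H.symm y z
  unfold gp; linarith

lemma gp_self_left (x y : G) : H.gp x y x = 0 := by
  have := H.self x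
  have := H.symm x y
  unfold gp; linarith

lemma gp_self_right (x y : G) : H.gp x y y = 0 := by
  have := H.self y
  unfold gp; linarith

lemma gp_lip_base (x y z w : G) : H.gp x y z ≤ H.gp x y w + H.D z w := by
  have := H.tri x w z
  have := H.tri y w z
  have := H.symm z w
  unfold gp; linarith

lemma gp_lip_left (x y z w : G) : H.gp x y z ≤ H.gp w y z + H.D x w := by
  have := H.tri x w z
  have := H.tri w x y
  have := H.symm x w
  unfold gp; linarith

lemma gp_lip_right (x y z w : G) : H.gp x y z ≤ H.gp x w z + H.D y w := by
  rw [H.gp_comm x y, H.gp_comm x w]; exact H.gp_lip_left y x z w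

lemma gp_four (x y z w : G) : H.gp x y w ≤ H.gp x z w + H.δ ∨ H.gp y z w ≤ H.gp x z w + H.δ := by
  have h1 := H.symm y z
  have h2 := H.symm w z
  rcases H.four x y z w with h | h
  · left; unfold gp; linarith [H.symm z w]
  · right; unfold gp; linarith [H.symm z w]

lemma gp_four_le {x y z w : G} {c : ℝ} (hc : H.gp x z w ≤ c) :
    H.gp x y w ≤ c + H.δ ∨ H.gp y z w ≤ c + H.δ := by
  rcases H.gp_four x y z w with h | h
  · left; linarith
  · right; linarith

lemma near {a b p q : G} {c : ℝ} (hp : H.gp a b p ≤ c) (hq : H.gp a b q ≤ c) :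
    H.D p q ≤ |H.D a p - H.D a q| + 2 * c + 2 * H.δ := by
  have h1 := le_abs_self (H.D a p - H.D a q)
  have h2 := neg_abs_le (H.D a p - H.D a q)
  have e1 := H.symm a b
  have e2 := H.symm p q
  have e3 := H.symm a p
  have e4 := H.symm a q
  have e5 := H.symm b p
  have e6 := H.symm b q
  unfold gp at hp hq
  rcases H.four a p b q with h | h
  · linarith
  · linarith

lemma transfer {a u g h : G} {c : ℝ} (hc : H.gp a u h ≤ c)
    (hd : H.D a h + c + H.δ < H.gp g u a) : H.gp a g h ≤ c + H.δ := by
  rcases H.gp_four_le (y := g) hc with h1 | h1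
  · exact h1
  · have := H.gp_lip_base g u a h
    linarith

lemma transfer_far {a u g h : G} {c : ℝ} (hc : H.gp a u h ≤ c)
    (hd : H.gp g u a + c + 2 * H.δ < H.D a h) : H.gp g u h ≤ c + H.δ := by
  rcases H.gp_four_le (y := g) hc with h1 | h1
  · exfalso
    have e1 := H.gp_add g a h
    have e2 := H.gp_add u a h
    rw [H.gp_comm a g h] at h1
    rw [H.gp_comm a u h] at hc
    have hδ := H.δ_pos
    rcases H.gp_four g h u a with h2 | h2
    · linarith
    · rw [H.gp_comm h u a] at h2
      linarith
  · exact h1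

lemma between {a b p y z : G} {c B : ℝ} (hB : c + 4 * H.δ < B) (hp : H.gp a b p ≤ c)
    (hy : H.gp y b a + B ≤ H.D a p) (hz : H.D a p + B ≤ H.gp z b a) :
    H.gp y z p ≤ c + 2 * H.δ := by
  have hδ := H.δ_pos
  have hc := (H.gp_nonneg a b p).trans hp
  have h1 : H.gp a z p ≤ c + H.δ := H.transfer hp (by linarith)
  have h2 : H.gp y z a ≤ H.gp y b a + H.δ := by
    rcases H.gp_four y z b a with h | h
    · exact h
    · linarith
  have := H.transfer_far (g := y) h1 (by linarith)
  linarith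

end HypMetric

section FromWitness

variable {X : Type*} [MetricSpace X]

namespace GeodesicSegment

/-- The reversal of a geodesic segment. -/
def reverse (γ : GeodesicSegment X) : GeodesicSegment X where
  len := γ.len
  len_nonneg := γ.len_nonneg
  toFun := fun t => γ.toFun (γ.len - t)
  isom := fun s hs t ht => by
    rw [γ.isom _ ⟨by linarith [hs.2], by linarith [hs.1]⟩ _ ⟨by linarith [ht.2], by linarith [ht.1]⟩,
      ← abs_neg]
    congr 1; ring

lemma len_eq (γ : GeodesicSegment X) : γ.len = dist γ.initial γ.terminal := by
  unfold initial terminal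
  rw [γ.isom 0 ⟨le_rfl, γ.len_nonneg⟩ γ.len ⟨γ.len_nonneg, le_rfl⟩]
  simp [abs_of_nonneg γ.len_nonneg]

lemma dist_add (γ : GeodesicSegment X) {p : X} (hp : p ∈ γ.seg) :
    dist γ.initial p + dist p γ.terminal = dist γ.initial γ.terminal := by
  obtain ⟨t, ht, rfl⟩ := hp
  rw [← len_eq]
  unfold initial terminal
  rw [γ.isom 0 ⟨le_rfl, γ.len_nonneg⟩ t ht, γ.isom t ht γ.len ⟨γ.len_nonneg, le_rfl⟩]
  have h1 : |0 - t| = t := by rw [zero_sub, abs_neg, abs_of_nonneg ht.1]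
  have h2 : |t - γ.len| = γ.len - t := by
    rw [abs_sub_comm, abs_of_nonneg (by linarith [ht.2])]
  linarith

lemma seg_nonempty (γ : GeodesicSegment X) : γ.seg.Nonempty :=
  ⟨γ.toFun 0, 0, ⟨le_rfl, γ.len_nonneg⟩, rfl⟩

lemma continuousOn (γ : GeodesicSegment X) : ContinuousOn γ.toFun (Set.Icc 0 γ.len) := by
  have : LipschitzOnWith 1 γ.toFun (Set.Icc 0 γ.len) :=
    LipschitzOnWith.of_dist_le_mul fun s hs t ht => by
      rw [γ.isom s hs t ht, Real.dist_eq]; simp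
  exact this.continuousOn

lemma initial_mem (γ : GeodesicSegment X) : γ.initial ∈ γ.seg :=
  ⟨0, ⟨le_rfl, γ.len_nonneg⟩, rfl⟩

lemma terminal_mem (γ : GeodesicSegment X) : γ.terminal ∈ γ.seg :=
  ⟨γ.len, ⟨γ.len_nonneg, le_rfl⟩, rfl⟩

@[simp] lemma reverse_seg (γ : GeodesicSegment X) : γ.reverse.seg = γ.seg := by
  ext p
  constructor
  · rintro ⟨t, ht, rfl⟩
    exact ⟨γ.len - t, ⟨by linarith [ht.2, show γ.reverse.len = γ.len from rfl],
      by linarith [ht.1]⟩, rfl⟩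
  · rintro ⟨t, ht, rfl⟩
    refine ⟨γ.len - t, ⟨by linarith [ht.2], ?_⟩, ?_⟩
    · show γ.len - t ≤ γ.len
      linarith [ht.1]
    · show γ.toFun (γ.len - (γ.len - t)) = _
      congr 1; ring

@[simp] lemma reverse_initial (γ : GeodesicSegment X) : γ.reverse.initial = γ.terminal := by
  show γ.toFun (γ.len - 0) = γ.toFun γ.len
  rw [sub_zero]

@[simp] lemma reverse_terminal (γ : GeodesicSegment X) : γ.reverse.terminal = γ.initial := by
  show γ.toFun (γ.len - γ.len) = γ.toFun 0
  rw [sub_self]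

end GeodesicSegment

lemma infDist_le_of_mem_cthickening {δ : ℝ} (hδ : 0 ≤ δ) {A : Set X} {p : X}
    (hp : p ∈ Metric.cthickening δ A) : Metric.infDist p A ≤ δ := by
  rw [Metric.mem_cthickening_iff] at hp
  unfold Metric.infDist
  exact ENNReal.toReal_le_of_le_ofReal hδ hp

lemma exists_near_point {δ : ℝ} (hδ : 0 < δ) {A : Set X} (hA : A.Nonempty) {p : X}
    (hp : Metric.infDist p A ≤ δ) : ∃ q ∈ A, dist p q ≤ 2 * δ := by
  obtain ⟨q, hq, h⟩ := (Metric.infDist_lt_iff (r := 2 * δ) hA).1 (by linarith : Metric.infDist p A < 2 * δ)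
  exact ⟨q, hq, h.le⟩

/-- A point of `[x, y]` at distance at most `(x | y)_w + 4 δ` from `w`. -/
lemma exists_mem_seg_dist_le {δ : ℝ} (hδ : 0 < δ) (hyp : IsDeltaHyperbolic X δ)
    (hgeo : IsGeodesicSpace X) (γ : GeodesicSegment X) (w : X) :
    ∃ p ∈ γ.seg, dist w p ≤
      (dist γ.initial w + dist γ.terminal w - dist γ.initial γ.terminal) / 2 + 4 * δ := by
  obtain ⟨α, ha1, ha2⟩ := hgeo γ.initial w
  obtain ⟨β, hb1, hb2⟩ := hgeo w γ.terminal
  have hcov := hyp α β γ (by rw [ha1]) (by rw [ha2, hb1]) hb2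
  set I := Set.Icc (0:ℝ) γ.len
  have hcont := γ.continuousOn
  have key : ∃ t ∈ I, Metric.infDist (γ.toFun t) α.seg ≤ δ ∧ Metric.infDist (γ.toFun t) β.seg ≤ δ := by
    have hpre : IsPreconnected I := isPreconnected_Icc
    rw [isPreconnected_iff_subset_of_disjoint_closed] at hpre
    by_contra hno
    push Not at hno
    have hcl : ∀ A : Set X, IsClosed {t ∈ I | Metric.infDist (γ.toFun t) A ≤ δ} := by
      intro A
      have hc : ContinuousOn (fun t => Metric.infDist (γ.toFun t) A) I :=
        (Metric.continuous_infDist_pt A).comp_continuousOn hcont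
      exact hc.preimage_isClosed_of_isClosed isClosed_Icc isClosed_Iic
    have h := hpre _ _ (hcl α.seg) (hcl β.seg) (by
      intro t ht
      have h1 := hcov ⟨t, ht, rfl⟩
      rw [Metric.cthickening_union, Set.mem_union] at h1
      rcases h1 with h1 | h1
      · exact Or.inl ⟨ht, infDist_le_of_mem_cthickening hδ.le h1⟩
      · exact Or.inr ⟨ht, infDist_le_of_mem_cthickening hδ.le h1⟩) (by
      ext t
      simp only [Set.mem_inter_iff, Set.mem_ofPred_eq, Set.mem_empty_iff_false, iff_false]
      rintro ⟨ht, ⟨-, h1⟩, -, h2⟩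
      exact absurd h2 (not_le.2 (hno t ht h1)))
    have h0 : Metric.infDist (γ.toFun 0) α.seg ≤ δ := by
      rw [Metric.infDist_zero_of_mem]
      · exact hδ.le
      · have := α.initial_mem
        rwa [ha1] at this
    have h1 : Metric.infDist (γ.toFun γ.len) β.seg ≤ δ := by
      rw [Metric.infDist_zero_of_mem]
      · exact hδ.le
      · have := β.terminal_mem
        rwa [hb2] at this
    have m0 : (0:ℝ) ∈ I := ⟨le_rfl, γ.len_nonneg⟩
    have m1 : γ.len ∈ I := ⟨γ.len_nonneg, le_rfl⟩
    rcases h with h | h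
    · exact absurd h1 (not_le.2 (hno _ m1 (h m1).2))
    · exact absurd (h m0).2 (not_le.2 (hno _ m0 h0))
  obtain ⟨t, ht, hta, htb⟩ := key
  obtain ⟨q, hq, hq1⟩ := exists_near_point hδ α.seg_nonempty hta
  obtain ⟨s, hs, hs1⟩ := exists_near_point hδ β.seg_nonempty htb
  refine ⟨γ.toFun t, ⟨t, ht, rfl⟩, ?_⟩
  have e1 := α.dist_add hq
  have e2 := β.dist_add hs
  rw [ha1, ha2] at e1
  rw [hb1, hb2] at e2
  have e3 := γ.dist_add (p := γ.toFun t) ⟨t, ht, rfl⟩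
  generalize γ.toFun t = p at *
  have t1 := dist_triangle w q p
  have t2 := dist_triangle w s p
  have t3 := dist_triangle γ.initial q p
  have t4 := dist_triangle p s γ.terminal
  have t5 := dist_comm q w
  have t6 := dist_comm q p
  have t7 := dist_comm s p
  have t8 := dist_comm w γ.terminal
  linarith

lemma gromov_four_point {δ : ℝ} (hδ : 0 < δ) (hyp : IsDeltaHyperbolic X δ)
    (hgeo : IsGeodesicSpace X) (x y z w : X) :
    dist x z + dist y w ≤ dist x y + dist z w + 2 * (6 * δ) ∨
      dist x z + dist y w ≤ dist x w + dist y z + 2 * (6 * δ) := by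
  obtain ⟨α, ha1, ha2⟩ := hgeo x y
  obtain ⟨β, hb1, hb2⟩ := hgeo y z
  obtain ⟨γ, hc1, hc2⟩ := hgeo x z
  obtain ⟨p, hp, hpw⟩ := exists_mem_seg_dist_le hδ hyp hgeo γ w
  have h1 := hyp α β γ (by rw [ha1, hc1]) (by rw [ha2, hb1]) (by rw [hb2, hc2]) hp
  rw [hc1, hc2] at hpw
  rw [Metric.cthickening_union] at h1
  have c1 := dist_comm y x
  have c2 := dist_comm z y
  rcases h1 with h1 | h1
  · obtain ⟨q, hq, hpq⟩ := exists_near_point hδ α.seg_nonempty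
      (infDist_le_of_mem_cthickening hδ.le h1)
    have e := α.dist_add hq
    rw [ha1, ha2] at e
    have t1 := dist_triangle w p q
    have t2 := dist_triangle x q w
    have t3 := dist_triangle y q w
    have t4 := dist_comm q w
    have t5 := dist_comm q y
    left; linarith
  · obtain ⟨q, hq, hpq⟩ := exists_near_point hδ β.seg_nonempty
      (infDist_le_of_mem_cthickening hδ.le h1)
    have e := β.dist_add hq
    rw [hb1, hb2] at e
    have t1 := dist_triangle w p q
    have t2 := dist_triangle y q w
    have t3 := dist_triangle z q w
    have t4 := dist_comm q w
    have t5 := dist_comm q z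
    right; linarith

end FromWitness

/-- The pseudo-metric on `G` pulled back from the orbit of the basepoint. -/
noncomputable def AcylHypWitness.hypMetric {G : Type*} [Group G] (W : AcylHypWitness G) :
    HypMetric G :=
  letI := W.inst
  { D := fun g h => dist (W.ρ g W.x0) (W.ρ h W.x0)
    δ := 6 * W.δ
    δ_pos := by have := W.δ_pos; linarith
    self := fun x => dist_self _
    symm := fun x y => dist_comm _ _
    tri := fun x y z => dist_triangle _ _ _
    left := fun k x y => by rw [W.mul, W.mul, (W.isom k).dist_eq]
    four := fun x y z w => gromov_four_point W.δ_pos W.hyperbolic W.geodesic _ _ _ _ }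

/-- The properties of the loxodromic WPD element expressed through the pulled back metric. -/
lemma AcylHypWitness.exists_hypMetric {G : Type*} [Group G] (W : AcylHypWitness G) :
    ∃ (H : HypMetric G) (φ : G),
      (∃ τ : ℝ, 0 < τ ∧ Filter.Tendsto (fun n : ℕ => H.D 1 (φ ^ n) / n) Filter.atTop (nhds τ)) ∧
      ∀ K : ℝ, ∃ N : ℕ, {h : G | H.D 1 h ≤ K ∧ H.D (φ ^ N) (h * φ ^ N) ≤ K}.Finite := by
  let _ := W.inst
  refine ⟨W.hypMetric, W.φ, ?_, ?_⟩
  · obtain ⟨τ, h1, h2⟩ := W.lox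
    refine ⟨τ, h1, ?_⟩
    simpa [AcylHypWitness.hypMetric, W.one] using h2
  · intro K
    obtain ⟨N, M, h1, -⟩ := W.wpd (max K 0 + 1) (by positivity)
    refine ⟨N, h1.subset ?_⟩
    rintro h ⟨ha, hb⟩
    simp only [AcylHypWitness.hypMetric, W.one, W.mul] at ha hb
    have := le_max_left K 0
    exact ⟨by linarith, by linarith⟩

end

section

section WordMetric

variable {G : Type*} [Group G] {S : Finset G}

lemma exists_word (hS : Subgroup.closure (S : Set G) = ⊤) (g : G) :
    ∃ l : List G, l.length = wordLength S g ∧ (∀ x ∈ l, x ∈ S ∨ x⁻¹ ∈ S) ∧ l.prod = g := by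
  have hne : {n | ∃ l : List G, l.length = n ∧ (∀ x ∈ l, x ∈ S ∨ x⁻¹ ∈ S) ∧ l.prod = g}.Nonempty := by
    have hg : g ∈ Subgroup.closure (S : Set G) := by rw [hS]; trivial
    rw [← Subgroup.mem_toSubmonoid, Subgroup.closure_toSubmonoid] at hg
    obtain ⟨l, h1, h2⟩ := Submonoid.exists_list_of_mem_closure hg
    refine ⟨_, l, rfl, fun x hx => ?_, h2⟩
    simpa using h1 x hx
  exact Nat.sInf_mem hne

lemma wordLength_le_of_list {l : List G} (h : ∀ x ∈ l, x ∈ S ∨ x⁻¹ ∈ S) :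
    wordLength S l.prod ≤ l.length :=
  Nat.sInf_le ⟨l, rfl, h, rfl⟩

@[simp] lemma wordLength_one : wordLength S (1 : G) = 0 := by
  have := wordLength_le_of_list (S := S) (l := []) (by simp)
  simpa using this

variable (hS : Subgroup.closure (S : Set G) = ⊤)
include hS

lemma wordLength_mul_le (g h : G) : wordLength S (g * h) ≤ wordLength S g + wordLength S h := by
  obtain ⟨l, h1, h2, h3⟩ := exists_word hS g
  obtain ⟨l', h1', h2', h3'⟩ := exists_word hS h
  have := wordLength_le_of_list (S := S) (l := l ++ l') (by
    intro x hx
    rcases List.mem_append.1 hx with hx | hx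
    · exact h2 x hx
    · exact h2' x hx)
  rw [List.prod_append, List.length_append, h3, h3', h1, h1'] at this
  exact this

lemma wordLength_inv_le (g : G) : wordLength S g⁻¹ ≤ wordLength S g := by
  obtain ⟨l, h1, h2, h3⟩ := exists_word hS g
  have := wordLength_le_of_list (S := S) (l := (l.map (·⁻¹)).reverse) (by
    intro x hx
    simp only [List.mem_reverse, List.mem_map] at hx
    obtain ⟨y, hy, rfl⟩ := hx
    rw [inv_inv]
    exact (h2 y hy).symm)
  rw [← List.prod_inv_reverse, h3] at this
  simpa [h1] using this

lemma wordLength_inv (g : G) : wordLength S g⁻¹ = wordLength S g := by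
  refine le_antisymm (wordLength_inv_le hS g) ?_
  have := wordLength_inv_le hS g⁻¹
  rwa [inv_inv] at this

lemma wordDist_symm (a b : G) : wordDist S a b = wordDist S b a := by
  unfold wordDist
  rw [← wordLength_inv hS]
  simp

lemma wordDist_tri (a b c : G) : wordDist S a c ≤ wordDist S a b + wordDist S b c := by
  unfold wordDist
  have := wordLength_mul_le hS (a⁻¹ * b) (b⁻¹ * c)
  rwa [show a⁻¹ * b * (b⁻¹ * c) = a⁻¹ * c by group] at this

omit hS in
lemma wordDist_left (k a b : G) : wordDist S (k * a) (k * b) = wordDist S a b := by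
  unfold wordDist
  congr 1; group

omit hS in
@[simp] lemma wordDist_self (a : G) : wordDist S a a = 0 := by
  simp [wordDist]

omit hS in
lemma wordDist_one (a : G) : wordDist S 1 a = wordLength S a := by
  simp [wordDist]

lemma exists_geodesic_word (g : G) : ∃ γ : ℕ → G, γ 0 = 1 ∧ γ (wordLength S g) = g ∧
    ∀ i j, i ≤ j → j ≤ wordLength S g → wordDist S (γ i) (γ j) = j - i := by
  obtain ⟨l, h1, h2, h3⟩ := exists_word hS g
  have hle : ∀ i j, i ≤ j → j ≤ wordLength S g →
      wordDist S (l.take i).prod (l.take j).prod ≤ j - i := by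
    intro i j hij hj
    obtain ⟨k, rfl⟩ := Nat.exists_eq_add_of_le hij
    rw [List.take_add, List.prod_append, wordDist, inv_mul_cancel_left]
    refine (wordLength_le_of_list fun x hx => h2 x ?_).trans ?_
    · exact List.mem_of_mem_drop (List.mem_of_mem_take hx)
    · simp
  refine ⟨fun i => (l.take i).prod, by simp, by simp only [← h1, List.take_length, h3], ?_⟩
  intro i j hij hj
  have e0 : (l.take 0).prod = 1 := by simp
  have e1 : (l.take (wordLength S g)).prod = g := by rw [← h1, List.take_length, h3]
  have a1 := hle 0 i (Nat.zero_le _) (hij.trans hj)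
  have a2 := hle i j hij hj
  have a3 := hle j _ hj le_rfl
  have t1 := wordDist_tri hS (l.take 0).prod (l.take i).prod (l.take (wordLength S g)).prod
  have t2 := wordDist_tri hS (l.take i).prod (l.take j).prod (l.take (wordLength S g)).prod
  have e2 : wordDist S (l.take 0).prod (l.take (wordLength S g)).prod = wordLength S g := by
    rw [e0, e1, wordDist_one]
  show wordDist S (l.take i).prod (l.take j).prod = _
  omega

lemma finite_wordBall (n : ℕ) : {g : G | wordLength S g ≤ n}.Finite := by
  have hfin : ({x : G | x ∈ S ∨ x⁻¹ ∈ S}).Finite := by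
    refine (S.finite_toSet.union (S.finite_toSet.inv)).subset ?_
    rintro x (hx | hx)
    · exact Or.inl hx
    · exact Or.inr (by simpa using hx)
  have : {l : List G | l.length ≤ n ∧ ∀ x ∈ l, x ∈ {x : G | x ∈ S ∨ x⁻¹ ∈ S}}.Finite := by
    have := hfin.to_subtype
    refine ((List.finite_length_le {x : G | x ∈ S ∨ x⁻¹ ∈ S} n).image
      (List.map Subtype.val)).subset ?_
    rintro l ⟨h1, h2⟩
    refine ⟨l.attach.map fun x => ⟨x.1, h2 x.1 x.2⟩, ?_, ?_⟩
    · change (List.map _ _).length ≤ n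
      simpa using h1
    · simp [List.map_map, Function.comp_def]
  refine (this.image List.prod).subset ?_
  intro g hg
  obtain ⟨l, h1, h2, h3⟩ := exists_word hS g
  exact ⟨l, ⟨h1.trans_le hg, h2⟩, h3⟩

omit hS in
variable (S) in
/-- The ball of radius `n` around the identity in the word metric. -/
def wordBall (n : ℕ) : Set G := {g | wordLength S g ≤ n}

omit hS in
variable (S) in
/-- The number of elements of the ball of radius `n` in the word metric. -/
noncomputable def growth (n : ℕ) : ℕ := (wordBall S n).ncard

omit hS in
lemma ball_natCast (n : ℕ) : ball S (n : ℝ) = wordBall S n := by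
  ext g; simp [ball, wordBall]

lemma wordBall_finite (n : ℕ) : (wordBall S n).Finite := finite_wordBall hS n

lemma growth_pos (n : ℕ) : 0 < growth S n :=
  (Set.ncard_pos (wordBall_finite hS n)).2 ⟨1, by simp [wordBall]⟩

lemma growth_mono {m n : ℕ} (h : m ≤ n) : growth S m ≤ growth S n :=
  Set.ncard_le_ncard (fun _ hg => le_trans (show wordLength S _ ≤ m from hg) h)
    (wordBall_finite hS n)

lemma growth_add_le (m n : ℕ) : growth S (m + n) ≤ growth S m * growth S n := by
  unfold growth
  rw [← Set.ncard_prod]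
  have hfin := (wordBall_finite hS m).prod (wordBall_finite hS n)
  refine (Set.ncard_le_ncard ?_ (hfin.image fun p : G × G => p.1 * p.2)).trans
    (Set.ncard_image_le hfin)
  intro g hg
  obtain ⟨γ, h0, h1, h2⟩ := exists_geodesic_word hS g
  have hg' : wordLength S g ≤ m + n := hg
  refine ⟨(γ (min m (wordLength S g)), (γ (min m (wordLength S g)))⁻¹ * g), ⟨?_, ?_⟩, by simp⟩
  · have := h2 0 (min m (wordLength S g)) (Nat.zero_le _) (min_le_right _ _)
    rw [h0, wordDist_one] at this
    change wordLength S (γ (min m (wordLength S g))) ≤ m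
    omega
  · have := h2 (min m (wordLength S g)) _ (min_le_right _ _) le_rfl
    rw [h1, wordDist] at this
    change wordLength S ((γ (min m (wordLength S g)))⁻¹ * g) ≤ n
    omega

lemma HypMetric.exists_D_le (H : HypMetric G) :
    ∃ C : ℝ, 1 ≤ C ∧ ∀ a b, H.D a b ≤ C * wordDist S a b := by
  obtain ⟨C, hC⟩ : ∃ C : ℝ, ∀ s ∈ S, H.D 1 s ≤ C := by
    obtain ⟨C, hC⟩ := (S.finite_toSet.image fun s => H.D 1 s).bddAbove
    exact ⟨C, fun s hs => hC ⟨s, hs, rfl⟩⟩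
  have key : ∀ l : List G, (∀ x ∈ l, x ∈ S ∨ x⁻¹ ∈ S) → H.D 1 l.prod ≤ max C 1 * l.length := by
    intro l
    induction l with
    | nil => intro _; simp [H.self]
    | cons x l ih =>
      intro h
      have h1 := ih fun y hy => h y (List.mem_cons_of_mem _ hy)
      have h2 : H.D 1 x ≤ max C 1 := by
        rcases h x List.mem_cons_self with hx | hx
        · exact (hC x hx).trans (le_max_left _ _)
        · have := H.left x x⁻¹ 1
          rw [mul_inv_cancel, mul_one] at this
          rw [this, H.symm]
          exact (hC _ hx).trans (le_max_left _ _)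
      have h3 := H.tri 1 x (x * l.prod)
      have h4 := H.left x 1 l.prod
      rw [mul_one] at h4
      rw [List.prod_cons, List.length_cons]
      push_cast
      linarith
  refine ⟨max C 1, le_max_right _ _, fun a b => ?_⟩
  obtain ⟨l, h1, h2, h3⟩ := exists_word hS (a⁻¹ * b)
  have := key l h2
  rw [h1, h3] at this
  have h4 := H.left a 1 (a⁻¹ * b)
  rw [mul_one, mul_inv_cancel_left] at h4
  rw [h4]; exact this

end WordMetric

end

section

namespace HypMetric

variable {G : Type*} [Group G] (H : HypMetric G)

lemma D_mul_right (x y : G) : H.D x (x * y) = H.D 1 y := by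
  have := H.left x 1 y
  rwa [mul_one] at this

lemma D_eq_one (x y : G) : H.D x y = H.D 1 (x⁻¹ * y) := by
  have := H.D_mul_right x (x⁻¹ * y)
  rwa [mul_inv_cancel_left] at this

lemma D_one_inv (x : G) : H.D 1 x⁻¹ = H.D 1 x := by
  have := H.D_mul_right x x⁻¹
  rw [mul_inv_cancel] at this
  rw [← this, H.symm]

lemma D_one_mul_le (x y : G) : H.D 1 (x * y) ≤ H.D 1 x + H.D 1 y := by
  have := H.tri 1 x (x * y)
  rwa [H.D_mul_right] at this

lemma D_one_pow_le (x : G) (n : ℕ) : H.D 1 (x ^ n) ≤ n * H.D 1 x := by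
  induction n with
  | zero => simp [H.self]
  | succ n ih =>
    have := H.D_one_mul_le (x ^ n) x
    rw [pow_succ]; push_cast; linarith

lemma gp_eq_one (x y z : G) : H.gp x y z = H.gp (z⁻¹ * x) (z⁻¹ * y) 1 := by
  have := H.gp_left z⁻¹ x y z
  rw [inv_mul_cancel] at this
  exact this.symm

lemma gp_inv_left (p x : G) : H.gp p⁻¹ x 1 = H.gp 1 (p * x) p := by
  rw [H.gp_eq_one 1]; simp

/-- The Gromov product at `1` of `p` and `p * x` is large when that of `p⁻¹` and `x` is small. -/
lemma gp_mul_eq (p x : G) : H.gp p (p * x) 1 = H.D 1 p - H.gp p⁻¹ x 1 := by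
  have := H.gp_add (p * x) 1 p
  rw [H.gp_inv_left, H.gp_comm p, H.gp_comm 1]
  linarith

lemma gp_step {y p x : G} {c : ℝ} (h : H.gp y p 1 ≤ c) (hx : H.gp p⁻¹ x 1 ≤ c + H.δ)
    (hl : 2 * c + 2 * H.δ < H.D 1 p) : H.gp y (p * x) 1 ≤ c + H.δ := by
  rcases H.gp_four_le (y := p * x) h with h1 | h1
  · exact h1
  · have := H.gp_mul_eq p x
    rw [H.gp_comm] at this
    linarith

lemma gp_inv_pow_le {g : G} {r : ℝ} (h : H.gp g⁻¹ g 1 ≤ r) (hl : 2 * r + 2 * H.δ < H.D 1 g)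
    (n : ℕ) : H.gp g⁻¹ (g ^ n) 1 ≤ r + H.δ := by
  have hr := (H.gp_nonneg _ _ _).trans h
  have hδ := H.δ_pos
  induction n with
  | zero => rw [pow_zero, H.gp_self_right]; linarith
  | succ n ih =>
    rw [pow_succ']
    exact H.gp_step h ih hl

lemma gp_pow_pow_le {g : G} {r : ℝ} (h : H.gp g⁻¹ g 1 ≤ r) (hl : 2 * r + 3 * H.δ < H.D 1 g)
    (a b : ℕ) : H.gp (g ^ a)⁻¹ (g ^ b) 1 ≤ r + 2 * H.δ := by
  have hr := (H.gp_nonneg _ _ _).trans h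
  have hδ := H.δ_pos
  cases a with
  | zero => rw [pow_zero, inv_one, H.gp_self_left]; linarith
  | succ a =>
    have h1 := H.gp_inv_pow_le h (by linarith) b
    rcases H.gp_four_le (y := (g ^ (a + 1))⁻¹) h1 with h2 | h2
    · have h3 := H.gp_inv_pow_le (g := g⁻¹) (r := r) (by rwa [inv_inv, H.gp_comm])
        (by rw [H.D_one_inv]; linarith) a
      have h4 := H.gp_mul_eq g⁻¹ (g⁻¹ ^ a)
      rw [← pow_succ', H.D_one_inv, inv_pow, H.gp_comm g⁻¹] at h4
      rw [H.gp_comm g⁻¹] at h2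
      rw [inv_pow] at h3
      rw [inv_inv] at h3 h4
      rw [inv_pow] at h4
      linarith [H.gp_comm g⁻¹ (g ^ (a + 1))⁻¹ 1]
    · linarith

/-- A loxodromic element with a strengthened form of the WPD property. -/
structure LoxWPD (φ : G) : Prop where
  quasi : ∃ C, ∀ a b : ℕ, H.gp (φ ^ a)⁻¹ (φ ^ b) 1 ≤ C
  tends : Filter.Tendsto (fun n : ℕ => H.D 1 (φ ^ n)) Filter.atTop Filter.atTop
  wpd : ∀ K, ∃ N0, ∀ N ≥ N0, {h | H.D 1 h ≤ K ∧ H.D (φ ^ N) (h * φ ^ N) ≤ K}.Finite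

variable {H}

lemma exists_quasi {φ : G} {τ : ℝ} (hτ : 0 < τ)
    (hlim : Filter.Tendsto (fun n : ℕ => H.D 1 (φ ^ n) / n) Filter.atTop (nhds τ)) :
    ∃ C, ∀ a b : ℕ, H.gp (φ ^ a)⁻¹ (φ ^ b) 1 ≤ C := by
  have hδ := H.δ_pos
  obtain ⟨m, hm0, hm⟩ : ∃ m : ℕ, 0 < m ∧ H.D 1 (φ ^ m) + 4 * H.δ ≤ H.D 1 (φ ^ (2 * m)) := by
    by_contra hno
    push Not at hno
    have h1 : ∀ k : ℕ, H.D 1 (φ ^ (2 ^ k)) ≤ H.D 1 φ + k * (4 * H.δ) := by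
      intro k
      induction k with
      | zero => simp
      | succ k ih =>
        have := hno (2 ^ k) (by positivity)
        rw [← pow_succ'] at this
        push_cast; linarith
    have h2 : Filter.Tendsto (fun k : ℕ => H.D 1 (φ ^ (2 ^ k)) / ((2 ^ k : ℕ) : ℝ))
        Filter.atTop (nhds τ) :=
      hlim.comp (tendsto_pow_atTop_atTop_of_one_lt (by norm_num))
    have h3 : Filter.Tendsto (fun k : ℕ => H.D 1 φ * (1 / 2 : ℝ) ^ k +
        (k * (1 / 2 : ℝ) ^ k) * (4 * H.δ)) Filter.atTop
        (nhds (H.D 1 φ * 0 + 0 * (4 * H.δ))) :=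
      ((tendsto_pow_atTop_nhds_zero_of_lt_one (by norm_num) (by norm_num)).const_mul _).add
        ((tendsto_self_mul_const_pow_of_lt_one (by norm_num) (by norm_num)).mul_const _)
    have h4 := le_of_tendsto_of_tendsto' h2 h3 (fun k => by
      have := h1 k
      rw [div_le_iff₀ (by positivity)]
      have e : (1 / 2 : ℝ) ^ k * ((2 ^ k : ℕ) : ℝ) = 1 := by
        push_cast; rw [← mul_pow]; norm_num
      calc H.D 1 (φ ^ 2 ^ k) ≤ H.D 1 φ + k * (4 * H.δ) := this
        _ = H.D 1 φ * ((1 / 2 : ℝ) ^ k * ((2 ^ k : ℕ) : ℝ)) +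
            (k * ((1 / 2 : ℝ) ^ k * ((2 ^ k : ℕ) : ℝ))) * (4 * H.δ) := by rw [e]; ring
        _ = _ := by ring)
    linarith
  have h0 : H.gp (φ ^ m)⁻¹ (φ ^ m) 1 ≤ (H.D 1 (φ ^ m) - 4 * H.δ) / 2 := by
    have e : H.gp (φ ^ m)⁻¹ (φ ^ m) 1 = (2 * H.D 1 (φ ^ m) - H.D 1 (φ ^ (2 * m))) / 2 := by
      unfold gp
      rw [H.symm _ 1, H.symm _ 1, H.D_one_inv, H.D_eq_one (φ ^ m)⁻¹, inv_inv, ← pow_add, two_mul m]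
      ring
    rw [e]; linarith
  have h1 := H.gp_pow_pow_le h0 (by linarith)
  have hE : ∀ a : ℕ, H.D 1 (φ ^ (a % m)) ≤ m * H.D 1 φ := fun a =>
    (H.D_one_pow_le φ _).trans (mul_le_mul_of_nonneg_right
      (by exact_mod_cast (Nat.mod_lt a hm0).le) (H.nonneg _ _))
  refine ⟨(H.D 1 (φ ^ m) - 4 * H.δ) / 2 + 2 * H.δ + m * H.D 1 φ + m * H.D 1 φ, fun a b => ?_⟩
  have ha : φ ^ a = (φ ^ m) ^ (a / m) * φ ^ (a % m) := by
    rw [← pow_mul, ← pow_add, Nat.div_add_mod]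
  have hb : φ ^ b = (φ ^ m) ^ (b / m) * φ ^ (b % m) := by
    rw [← pow_mul, ← pow_add, Nat.div_add_mod]
  have ha' : (φ ^ a)⁻¹ = ((φ ^ m) ^ (a / m))⁻¹ * (φ ^ (a % m))⁻¹ := by
    rw [← mul_inv_rev, ← pow_mul, ← pow_add, Nat.mod_add_div]
  have t1 := H.gp_lip_left (φ ^ a)⁻¹ (φ ^ b) 1 ((φ ^ m) ^ (a / m))⁻¹
  have t2 := H.gp_lip_right ((φ ^ m) ^ (a / m))⁻¹ (φ ^ b) 1 ((φ ^ m) ^ (b / m))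
  have t3 : H.D (φ ^ a)⁻¹ ((φ ^ m) ^ (a / m))⁻¹ ≤ m * H.D 1 φ := by
    rw [ha', H.symm, H.D_mul_right, H.D_one_inv]; exact hE a
  have t4 : H.D (φ ^ b) ((φ ^ m) ^ (b / m)) ≤ m * H.D 1 φ := by
    rw [hb, H.symm, H.D_mul_right]; exact hE b
  linarith [h1 (a / m) (b / m)]

lemma loxWPD_of_tendsto {φ : G} {τ : ℝ} (hτ : 0 < τ)
    (hlim : Filter.Tendsto (fun n : ℕ => H.D 1 (φ ^ n) / n) Filter.atTop (nhds τ))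
    (hwpd : ∀ K : ℝ, ∃ N : ℕ, {h : G | H.D 1 h ≤ K ∧ H.D (φ ^ N) (h * φ ^ N) ≤ K}.Finite) :
    H.LoxWPD φ := by
  have hδ := H.δ_pos
  obtain ⟨C, hC⟩ := exists_quasi hτ hlim
  refine ⟨⟨C, hC⟩, ?_, ?_⟩
  · have h1 := hlim.pos_mul_atTop hτ tendsto_natCast_atTop_atTop
    refine h1.congr' ?_
    filter_upwards [Filter.eventually_gt_atTop 0] with n hn
    field_simp
  · intro K
    obtain ⟨N0, h0⟩ := hwpd (K + 2 * (C + K + K) + 2 * H.δ)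
    have hC0 : 0 ≤ C := (H.gp_nonneg _ _ _).trans (hC 0 0)
    refine ⟨N0, fun N hN => h0.subset ?_⟩
    rintro h ⟨h1, h2⟩
    have hK : 0 ≤ K := (H.nonneg _ _).trans h1
    refine ⟨show H.D 1 h ≤ _ by linarith, ?_⟩
    have q1 : H.gp 1 (φ ^ N) (φ ^ N0) ≤ C := by
      obtain ⟨d, rfl⟩ := Nat.exists_eq_add_of_le hN
      rw [H.gp_eq_one, mul_one, pow_add, inv_mul_cancel_left]
      exact hC _ _
    have q2 : H.gp 1 (φ ^ N) (h * φ ^ N0) ≤ C + K + K := by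
      have e := H.gp_left h 1 (φ ^ N) (φ ^ N0)
      rw [mul_one] at e
      have t1 := H.gp_lip_left 1 (φ ^ N) (h * φ ^ N0) h
      have t2 := H.gp_lip_right h (φ ^ N) (h * φ ^ N0) (h * φ ^ N)
      linarith
    have q3 := H.near (q1.trans (by linarith)) q2
    have q4 : |H.D 1 (φ ^ N0) - H.D 1 (h * φ ^ N0)| ≤ K := by
      have t1 := H.tri 1 h (h * φ ^ N0)
      have t2 := H.tri h 1 (h * φ ^ N0)
      rw [H.D_mul_right] at t1 t2
      rw [H.symm h 1] at t2
      rw [abs_le]; constructor <;> linarith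
    linarith

lemma LoxWPD.inv {φ : G} (h : H.LoxWPD φ) : H.LoxWPD φ⁻¹ := by
  obtain ⟨⟨C, hC⟩, h2, h3⟩ := h
  refine ⟨⟨C, fun a b => ?_⟩, ?_, fun K => ?_⟩
  · rw [inv_pow, inv_inv, inv_pow, H.gp_comm]; exact hC b a
  · simpa only [inv_pow, H.D_one_inv] using h2
  · obtain ⟨N0, h0⟩ := h3 K
    refine ⟨N0, fun N hN => ?_⟩
    have := (h0 N hN).preimage (f := fun h => φ ^ N * h * (φ ^ N)⁻¹)
      (fun x _ y _ hxy => by simpa using hxy)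
    refine this.subset ?_
    rintro k ⟨h4, h5⟩
    constructor
    · change H.D 1 (φ ^ N * k * (φ ^ N)⁻¹) ≤ K
      rw [inv_pow, H.D_eq_one, inv_inv, ← mul_assoc] at h5
      exact h5
    · change H.D (φ ^ N) (φ ^ N * k * (φ ^ N)⁻¹ * φ ^ N) ≤ K
      rw [inv_mul_cancel_right, H.D_mul_right]
      exact h4

end HypMetric

end

section

namespace HypMetric

variable {G : Type*} [Group G] {H : HypMetric G}

/-- A discrete intermediate value theorem with steps of size at most `s`. -/
lemma exists_nat_near (f : ℕ → ℝ) {s x : ℝ} (hs : ∀ i, f (i + 1) ≤ f i + s) (h0 : f 0 ≤ x)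
    {n : ℕ} (hn : x ≤ f n) : ∃ j ≤ n, |f j - x| ≤ |s| := by
  induction n with
  | zero =>
    refine ⟨0, le_rfl, ?_⟩
    rw [le_antisymm h0 hn, sub_self, abs_zero]; exact abs_nonneg _
  | succ n ih =>
    by_cases h : x ≤ f n
    · obtain ⟨j, hj, h'⟩ := ih h
      exact ⟨j, hj.trans n.le_succ, h'⟩
    · push Not at h
      refine ⟨n + 1, le_rfl, ?_⟩
      have := hs n
      rw [abs_of_nonneg (by linarith)]
      linarith [le_abs_self s]

lemma exists_pow_near (φ p : G) (n : ℕ) (hn : H.D 1 p ≤ H.D 1 (φ ^ n)) :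
    ∃ j ≤ n, |H.D 1 (φ ^ j) - H.D 1 p| ≤ H.D 1 φ := by
  obtain ⟨j, h1, h2⟩ := exists_nat_near (fun i => H.D 1 (φ ^ i)) (s := H.D 1 φ) (x := H.D 1 p)
    (fun i => by rw [pow_succ]; exact H.D_one_mul_le _ _)
    (by rw [pow_zero, H.self]; exact H.nonneg _ _) hn
  exact ⟨j, h1, by rwa [abs_of_nonneg (H.nonneg 1 φ)] at h2⟩

lemma gp_pow_mid {φ : G} {C : ℝ} (hC : ∀ a b : ℕ, H.gp (φ ^ a)⁻¹ (φ ^ b) 1 ≤ C) (h : G)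
    {i j : ℕ} (hij : i ≤ j) : H.gp h (h * φ ^ j) (h * φ ^ i) ≤ C := by
  obtain ⟨d, rfl⟩ := Nat.exists_eq_add_of_le hij
  have := hC i d
  rw [H.gp_eq_one]
  convert this using 2 <;> [group; (rw [pow_add]; group)]

lemma gp_pow_mid_one {φ : G} {C : ℝ} (hC : ∀ a b : ℕ, H.gp (φ ^ a)⁻¹ (φ ^ b) 1 ≤ C)
    {i j : ℕ} (hij : i ≤ j) : H.gp 1 (φ ^ j) (φ ^ i) ≤ C := by
  simpa using gp_pow_mid hC 1 hij

variable (H) in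
/-- `h` moves the positive ray of `φ` into a bounded neighbourhood of itself. -/
def FixesEnd (φ h : G) : Prop := ∃ K, ∀ i : ℕ, ∃ j : ℕ, H.D (h * φ ^ i) (φ ^ j) ≤ K

lemma FixesEnd.mul {φ g h : G} (hg : H.FixesEnd φ g) (hh : H.FixesEnd φ h) :
    H.FixesEnd φ (g * h) := by
  obtain ⟨K, hK⟩ := hg
  obtain ⟨L, hL⟩ := hh
  refine ⟨L + K, fun i => ?_⟩
  obtain ⟨k, hk⟩ := hL i
  obtain ⟨j, hj⟩ := hK k
  refine ⟨j, ?_⟩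
  have := H.tri (g * h * φ ^ i) (g * φ ^ k) (φ ^ j)
  rw [mul_assoc, H.left] at this
  rw [mul_assoc]
  linarith

variable (H) in
/-- The stabilizer of the attracting end of `φ`. -/
def endStab (φ : G) : Subgroup G where
  carrier := {h | H.FixesEnd φ h ∧ H.FixesEnd φ h⁻¹}
  mul_mem' := fun ha hb => ⟨ha.1.mul hb.1, by rw [mul_inv_rev]; exact hb.2.mul ha.2⟩
  one_mem' := by
    have : H.FixesEnd φ 1 := ⟨0, fun i => ⟨i, by simp [H.self]⟩⟩
    exact ⟨this, by simpa using this⟩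
  inv_mem' := fun ha => ⟨ha.2, by simpa using ha.1⟩

lemma zpowers_le_endStab (φ : G) : Subgroup.zpowers φ ≤ H.endStab φ := by
  rw [Subgroup.zpowers_le]
  refine ⟨⟨0, fun i => ⟨i + 1, by rw [← pow_succ', H.self]⟩⟩, ⟨H.D 1 φ⁻¹, fun i => ?_⟩⟩
  cases i with
  | zero => exact ⟨0, by simp [H.symm φ⁻¹]⟩
  | succ i => exact ⟨i, by rw [pow_succ', inv_mul_cancel_left, H.self]; exact H.nonneg _ _⟩

lemma fixesEnd_of_unbounded {φ h : G} (hφ : H.LoxWPD φ)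
    (hub : ∀ R, ∃ m n : ℕ, R < H.gp (h * φ ^ m) (φ ^ n) 1) : H.FixesEnd φ h := by
  obtain ⟨C, hC⟩ := hφ.quasi
  have hδ := H.δ_pos
  have hC0 : 0 ≤ C := (H.gp_nonneg _ _ _).trans (hC 0 0)
  refine ⟨H.D 1 φ + 2 * (C + H.D 1 h + H.δ) + 2 * H.δ, fun i => ?_⟩
  have n1 := H.nonneg 1 h
  have n2 := H.nonneg 1 (h * φ ^ i)
  have n3 := H.nonneg 1 φ
  obtain ⟨m, n, hmn⟩ := hub (H.D 1 (h * φ ^ i) + (C + H.D 1 h) + H.δ + H.D 1 h + i * H.D 1 φ)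
  have hin : 0 ≤ i * H.D 1 φ := by positivity
  have hmi : i ≤ m := by
    by_contra hlt
    push Not at hlt
    have t1 := H.gp_le_left (h * φ ^ m) (φ ^ n) 1
    rw [H.symm] at t1
    have t2 := H.D_one_mul_le h (φ ^ m)
    have t3 := H.D_one_pow_le φ m
    have t4 : (m : ℝ) * H.D 1 φ ≤ i * H.D 1 φ :=
      mul_le_mul_of_nonneg_right (by exact_mod_cast hlt.le) n3
    linarith
  have q1 := gp_pow_mid hC h hmi
  have q2 : H.gp 1 (h * φ ^ m) (h * φ ^ i) ≤ C + H.D 1 h := by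
    have := H.gp_lip_left 1 (h * φ ^ m) (h * φ ^ i) h
    linarith
  have q3 : H.gp 1 (φ ^ n) (h * φ ^ i) ≤ C + H.D 1 h + H.δ := by
    refine H.transfer q2 ?_
    rw [H.gp_comm (φ ^ n)]
    linarith
  have q4 : H.D 1 (h * φ ^ i) ≤ H.D 1 (φ ^ n) := by
    have := H.gp_le_right (h * φ ^ m) (φ ^ n) 1
    rw [H.symm] at this
    linarith
  obtain ⟨j, hj, hj'⟩ := exists_pow_near φ _ n q4
  refine ⟨j, ?_⟩
  have := H.near q3 ((gp_pow_mid_one hC hj).trans (by linarith))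
  rw [abs_sub_comm] at hj'
  linarith

lemma exists_bound_of_notMem {φ h : G} (hφ : H.LoxWPD φ) (hh : h ∉ H.endStab φ) :
    ∃ c, ∀ m n : ℕ, H.gp (h * φ ^ m) (φ ^ n) 1 ≤ c := by
  by_contra hno
  push Not at hno
  refine hh ⟨fixesEnd_of_unbounded hφ hno, fixesEnd_of_unbounded hφ fun R => ?_⟩
  obtain ⟨m, n, h1⟩ := hno (R + H.D 1 h)
  refine ⟨n, m, ?_⟩
  have e := H.gp_left h (h⁻¹ * φ ^ n) (φ ^ m) 1
  rw [mul_inv_cancel_left, mul_one] at e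
  have t := H.gp_lip_base (h * φ ^ m) (φ ^ n) 1 h
  rw [H.gp_comm _ _ h] at t
  linarith

/-- Elements of the end stabilizer are, up to powers of `φ`, in a fixed finite set. -/
lemma exists_finite_endStab {φ : G} (hφ : H.LoxWPD φ) : ∃ E : Set G, E.Finite ∧
    ∀ h ∈ H.endStab φ, ∃ i0 : ℕ, ∀ i ≥ i0, ∃ j : ℕ, (φ ^ j)⁻¹ * h * φ ^ i ∈ E := by
  obtain ⟨C, hC⟩ := hφ.quasi
  have hδ := H.δ_pos
  have hC0 : 0 ≤ C := (H.gp_nonneg _ _ _).trans (hC 0 0)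
  have nφ := H.nonneg 1 φ
  obtain ⟨N, hN⟩ := hφ.wpd (H.D 1 φ + 2 * (C + H.δ) + 2 * (C + 2 * H.δ) + 2 * H.δ)
  specialize hN N le_rfl
  refine ⟨_, hN, fun h hh => ?_⟩
  obtain ⟨K, hK⟩ := hh.1
  have nh := H.nonneg 1 h
  have htend : ∀ R, ∃ i0 : ℕ, ∀ i ≥ i0, R < H.D 1 (φ ^ i) := fun R =>
    Filter.eventually_atTop.1 (hφ.tends.eventually_gt_atTop R)
  obtain ⟨i0, hi0⟩ := htend (2 * H.D 1 h + C + H.δ)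
  refine ⟨i0, fun i hi => ?_⟩
  have hlow : ∀ k ≥ i0, 2 * H.D 1 h + C + H.δ < H.D 1 (φ ^ k) := hi0
  -- the ray `h φ^k` is quasi-geodesic seen from `1`
  have key1 : ∀ k ≥ i0, ∀ M ≥ k, H.gp 1 (h * φ ^ M) (h * φ ^ k) ≤ C + H.δ := by
    intro k hk M hM
    rcases H.gp_four_le (y := 1) (gp_pow_mid hC h hM) with h1 | h1
    · exfalso
      have t1 := H.gp_add h 1 (h * φ ^ k)
      have t2 := H.gp_le_left h (h * φ ^ k) 1
      have t3 := H.tri h 1 (h * φ ^ k)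
      rw [H.D_mul_right] at t3
      rw [H.symm h 1] at t2 t3
      have := hlow k hk
      linarith
    · exact h1
  obtain ⟨J0, hJ0⟩ := htend (H.D 1 (h * φ ^ i) + H.D 1 φ)
  obtain ⟨M0, hM0⟩ := htend (H.D 1 (h * φ ^ (i + N)) + 2 * H.D 1 h + K + C + 2 * H.δ +
    H.D 1 (h * φ ^ i) + (J0 + N : ℕ) * H.D 1 φ)
  set M := max M0 (i + N) with hMdef
  have hM1 := hM0 M (le_max_left _ _)
  have hM2 : i + N ≤ M := le_max_right _ _
  obtain ⟨n, hn⟩ := hK M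
  have np := H.nonneg 1 (h * φ ^ i)
  have nq := H.nonneg 1 (h * φ ^ (i + N))
  have nJ : 0 ≤ ((J0 + N : ℕ) : ℝ) * H.D 1 φ := by positivity
  have hDM : H.D 1 (φ ^ M) ≤ H.D 1 (h * φ ^ M) + H.D 1 h := by
    have := H.tri h 1 (h * φ ^ M)
    rw [H.D_mul_right, H.symm h 1] at this
    linarith
  have hDn : H.D 1 (φ ^ M) ≤ H.D 1 (φ ^ n) + K + H.D 1 h := by
    have := H.tri 1 (φ ^ n) (h * φ ^ M)
    rw [H.symm (φ ^ n) (h * φ ^ M)] at this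
    linarith
  have K0 : 0 ≤ K := (H.nonneg _ _).trans hn
  have key2 : ∀ k ≥ i0, k ≤ M → H.D 1 (h * φ ^ k) + C + 2 * H.δ + K + H.D 1 h < H.D 1 (φ ^ M) →
      H.gp 1 (φ ^ n) (h * φ ^ k) ≤ C + 2 * H.δ := by
    intro k hk hkM hbig
    rcases H.gp_four_le (y := φ ^ n) (key1 k hk M hkM) with h1 | h1
    · linarith
    · exfalso
      have t1 := H.gp_lip_left (h * φ ^ M) (h * φ ^ M) (h * φ ^ k) (φ ^ n)
      have t2 : H.gp (h * φ ^ M) (h * φ ^ M) (h * φ ^ k) = H.D (h * φ ^ M) (h * φ ^ k) := by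
        unfold gp; rw [H.self]; ring
      have t3 := H.tri 1 (h * φ ^ k) (h * φ ^ M)
      rw [H.symm (h * φ ^ k)] at t3
      linarith
  have hp := key2 i hi (by omega) (by linarith)
  have hq := key2 (i + N) (by omega) hM2 (by linarith)
  obtain ⟨j, hjn, hj⟩ := exists_pow_near φ (h * φ ^ i) n (by linarith)
  have hjJ : j < J0 := by
    by_contra hge
    push Not at hge
    have := hJ0 j hge
    have := le_abs_self (H.D 1 (φ ^ j) - H.D 1 (h * φ ^ i))
    linarith
  have hjN : j + N ≤ n := by
    have h1 : J0 + N ≤ n := by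
      by_contra hlt
      push Not at hlt
      have t1 := H.D_one_pow_le φ n
      have t2 : (n : ℝ) * H.D 1 φ ≤ (J0 + N : ℕ) * H.D 1 φ :=
        mul_le_mul_of_nonneg_right (by exact_mod_cast hlt.le) nφ
      linarith
    omega
  refine ⟨j, ?_, ?_⟩
  · have := H.near hp ((gp_pow_mid_one hC hjn).trans (by linarith))
    rw [abs_sub_comm, H.symm, H.D_eq_one, ← mul_assoc] at this
    change H.D 1 _ ≤ _
    rw [abs_sub_comm] at hj
    linarith [abs_sub_comm (H.D 1 (φ ^ j)) (H.D 1 (h * φ ^ i))]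
  · have h1 := H.near hq ((gp_pow_mid_one hC hjN).trans (by linarith))
    have e1 : H.D 1 (h * φ ^ (i + N)) = H.D 1 (h * φ ^ i) + H.D 1 (φ ^ N) -
        2 * H.gp 1 (h * φ ^ (i + N)) (h * φ ^ i) := by
      unfold gp
      rw [pow_add, ← mul_assoc, H.symm (h * φ ^ i * φ ^ N), H.D_mul_right]
      ring
    have e2 : H.D 1 (φ ^ (j + N)) = H.D 1 (φ ^ j) + H.D 1 (φ ^ N) -
        2 * H.gp 1 (φ ^ (j + N)) (φ ^ j) := by
      unfold gp
      rw [pow_add, H.symm (φ ^ j * φ ^ N), H.D_mul_right]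
      ring
    have b1 := key1 i hi (i + N) (by omega)
    have b2 := gp_pow_mid_one hC (show j ≤ j + N by omega)
    have b3 := H.gp_nonneg 1 (h * φ ^ (i + N)) (h * φ ^ i)
    have b4 := H.gp_nonneg 1 (φ ^ (j + N)) (φ ^ j)
    have hj1 := abs_le.1 hj
    have h2 : |H.D 1 (h * φ ^ (i + N)) - H.D 1 (φ ^ (j + N))| ≤ H.D 1 φ + 2 * (C + H.δ) := by
      rw [e1, e2, abs_le]
      constructor <;> linarith [hj1.1, hj1.2]
    have e3 : H.D (φ ^ N) ((φ ^ j)⁻¹ * h * φ ^ i * φ ^ N) =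
        H.D (h * φ ^ (i + N)) (φ ^ (j + N)) := by
      rw [H.symm (h * φ ^ (i + N)), ← H.left (φ ^ j), ← pow_add]
      congr 1
      rw [pow_add]; group
    rw [e3]
    linarith

lemma finiteIndex_zpowers_endStab {φ : G} (hφ : H.LoxWPD φ) :
    (Subgroup.zpowers φ).relIndex (H.endStab φ) ≠ 0 := by
  obtain ⟨E, hE, hmem⟩ := exists_finite_endStab hφ
  set Z := (Subgroup.zpowers φ).subgroupOf (H.endStab φ) with hZ
  have : Finite (H.endStab φ ⧸ Z) := by
    by_contra hinf
    rw [not_finite_iff_infinite] at hinf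
    let e := Infinite.natEmbedding (H.endStab φ ⧸ Z)
    let r : ℕ → H.endStab φ := fun k => (Quotient.out (e k))⁻¹
    choose i0 hi0 using fun k => hmem (r k).1 (r k).2
    obtain ⟨i, hi⟩ : ∃ i, ∀ k ∈ Finset.range (E.ncard + 1), i0 k ≤ i :=
      ⟨(Finset.range (E.ncard + 1)).sup i0, fun k hk => Finset.le_sup hk⟩
    choose! j hj using fun k (hk : k ∈ Finset.range (E.ncard + 1)) => hi0 k i (hi k hk)
    obtain ⟨k, hk, l, hl, hkl, heq⟩ := Finset.exists_ne_map_eq_of_card_lt_of_maps_to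
      (s := Finset.range (E.ncard + 1)) (t := hE.toFinset)
      (by rw [Finset.card_range, ← Set.ncard_eq_toFinset_card E hE]; omega)
      (f := fun k => (φ ^ j k)⁻¹ * (r k).1 * φ ^ i)
      (fun k hk => by simpa using hj k hk)
    apply hkl
    apply e.injective
    rw [← Quotient.out_eq (e k), ← Quotient.out_eq (e l)]
    refine (QuotientGroup.eq (s := Z)).2 ?_
    refine Subgroup.mem_subgroupOf.2 ?_
    have h1 : ((r k).1) = φ ^ j k * (φ ^ j l)⁻¹ * (r l).1 := by
      have := congrArg (fun x => φ ^ j k * x * (φ ^ i)⁻¹) heq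
      simpa [mul_assoc] using this
    have h2 : (((Quotient.out (e k))⁻¹ * Quotient.out (e l) : H.endStab φ) : G) =
        (r k).1 * (r l).1⁻¹ := by simp [r]
    rw [h2, h1, mul_inv_cancel_right]
    exact mul_mem (pow_mem (Subgroup.mem_zpowers φ) _)
      (inv_mem (pow_mem (Subgroup.mem_zpowers φ) _))
  have h := (Subgroup.finiteIndex_iff_finite_quotient (H := Z)).2 this
  exact h.index_ne_zero

lemma exists_independent {φ : G} (hφ : H.LoxWPD φ) (hG : NonVirtuallyCyclic G) :
    ∃ (a : Fin 3 → G) (c : ℝ), ∀ i j, i ≠ j → ∀ m n : ℕ, H.gp (a i * φ ^ m) (a j * φ ^ n) 1 ≤ c := by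
  have hinf : Infinite (G ⧸ H.endStab φ) := by
    rw [← not_finite_iff_infinite]
    intro hfin
    have h := (Subgroup.finiteIndex_iff_finite_quotient (H := H.endStab φ)).2 hfin
    refine hG ⟨Subgroup.zpowers φ, ⟨?_⟩, inferInstance⟩
    rw [← Subgroup.relIndex_mul_index (zpowers_le_endStab (H := H) φ)]
    exact mul_ne_zero (finiteIndex_zpowers_endStab hφ) h.index_ne_zero
  let e := Infinite.natEmbedding (G ⧸ H.endStab φ)
  let a : Fin 3 → G := fun k => Quotient.out (e k)
  have hne : ∀ i j, i ≠ j → (a j)⁻¹ * a i ∉ H.endStab φ := by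
    intro i j hij hmem
    have h1 : (a j : G ⧸ H.endStab φ) = a i := QuotientGroup.eq.2 hmem
    have h2 : e j = e i := by
      rw [← QuotientGroup.out_eq' (e j), ← QuotientGroup.out_eq' (e i)]; exact h1
    exact hij (Fin.ext (e.injective h2)).symm
  have hb : ∀ p : Fin 3 × Fin 3, ∃ c, p.1 ≠ p.2 → ∀ m n : ℕ,
      H.gp (a p.1 * φ ^ m) (a p.2 * φ ^ n) 1 ≤ c := by
    rintro ⟨i, j⟩
    by_cases hij : i = j
    · exact ⟨0, fun h => absurd hij h⟩
    · obtain ⟨c, hc⟩ := exists_bound_of_notMem hφ (hne i j hij)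
      refine ⟨c + H.D 1 (a j), fun _ m n => ?_⟩
      have t := H.gp_lip_base (a i * φ ^ m) (a j * φ ^ n) 1 (a j)
      have e := H.gp_left (a j)⁻¹ (a i * φ ^ m) (a j * φ ^ n) (a j)
      rw [inv_mul_cancel_left, inv_mul_cancel, ← mul_assoc] at e
      have := hc m n
      linarith
  choose c hc using hb
  refine ⟨a, ∑ p, |c p|, fun i j hij m n => (hc (i, j) hij m n).trans ?_⟩
  exact (le_abs_self _).trans
    (Finset.single_le_sum (f := fun p => |c p|) (fun p _ => abs_nonneg _) (Finset.mem_univ (i, j)))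

end HypMetric

end

section

namespace HypMetric

variable {G : Type*} [Group G]

/-- Data attached to a large power `f` of a loxodromic WPD element: connecting elements that make
concatenations with `f` quasi-geodesic, a pair of ping-pong elements, and finiteness of the coarse
stabilizer of the pair `(1, f)`. -/
structure Setup (H : HypMetric G) where
  f : G
  c0 : ℝ
  c0_nonneg : 0 ≤ c0
  a : Fin 3 → G
  b : Fin 3 → G
  left : ∀ u i j, i ≠ j → H.gp (u * a i)⁻¹ f 1 ≤ c0 ∨ H.gp (u * a j)⁻¹ f 1 ≤ c0
  right : ∀ v i j, i ≠ j → H.gp f⁻¹ (b i * v) 1 ≤ c0 ∨ H.gp f⁻¹ (b j * v) 1 ≤ c0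
  long : 10 * c0 + 100 * H.δ + 100 ≤ H.D 1 f
  finite_wpd : {k | H.D 1 k ≤ 1 + 6 * (c0 + 10 * H.δ) + 6 * H.δ ∧
    H.D f (k * f) ≤ 1 + 6 * (c0 + 10 * H.δ) + 6 * H.δ}.Finite
  p : Fin 2 → G
  p_quasi : ∀ i j, H.gp (p i)⁻¹ (p j) 1 ≤ c0
  p_indep : ∀ i j, i ≠ j → H.gp (p i) (p j) 1 ≤ c0
  p_long : ∀ i, 4 * c0 + 10 * H.δ + 1 ≤ H.D 1 (p i)

variable {H : HypMetric G}

lemma one_bad {x z y : G} {c : ℝ} (h : H.gp x z 1 ≤ c) :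
    H.gp y x 1 ≤ c + H.δ ∨ H.gp y z 1 ≤ c + H.δ := by
  rcases H.gp_four_le (y := y) h with h1 | h1
  · left; rwa [H.gp_comm]
  · exact Or.inr h1

lemma exists_setup {φ : G} (hφ : H.LoxWPD φ) (hG : NonVirtuallyCyclic G) : Nonempty H.Setup := by
  have hδ := H.δ_pos
  obtain ⟨a, ca, ha⟩ := exists_independent hφ hG
  obtain ⟨b', cb, hb⟩ := exists_independent hφ.inv hG
  have ca0 : 0 ≤ ca := (H.gp_nonneg _ _ _).trans (ha 0 1 (by decide) 0 0)
  have cb0 : 0 ≤ cb := (H.gp_nonneg _ _ _).trans (hb 0 1 (by decide) 0 0)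
  obtain ⟨A, hA⟩ : ∃ A, ∀ i, H.D 1 (a i) ≤ A :=
    ⟨∑ i, H.D 1 (a i), fun i => Finset.single_le_sum (f := fun i => H.D 1 (a i))
      (fun i _ => H.nonneg _ _) (Finset.mem_univ i)⟩
  obtain ⟨B, hB⟩ : ∃ B, ∀ i, H.D 1 (b' i) ≤ B :=
    ⟨∑ i, H.D 1 (b' i), fun i => Finset.single_le_sum (f := fun i => H.D 1 (b' i))
      (fun i _ => H.nonneg _ _) (Finset.mem_univ i)⟩
  have A0 : 0 ≤ A := (H.nonneg _ _).trans (hA 0)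
  have B0 : 0 ≤ B := (H.nonneg _ _).trans (hB 0)
  set c0 := ca + cb + H.δ + 2 * A + 2 * B with hc0
  obtain ⟨N, hN⟩ := hφ.wpd (1 + 6 * (c0 + 10 * H.δ) + 6 * H.δ)
  obtain ⟨L, hL1, hL2⟩ := ((Filter.eventually_ge_atTop N).and
    (hφ.tends.eventually_ge_atTop (10 * c0 + 100 * H.δ + 100))).exists
  have hleft : ∀ y i j, i ≠ j →
      H.gp y (a i * φ ^ L) 1 ≤ ca + H.δ ∨ H.gp y (a j * φ ^ L) 1 ≤ ca + H.δ :=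
    fun y i j hij => one_bad (ha i j hij L L)
  have hright : ∀ y i j, i ≠ j → H.gp y (b' i * (φ ^ L)⁻¹) 1 ≤ cb + H.δ ∨
      H.gp y (b' j * (φ ^ L)⁻¹) 1 ≤ cb + H.δ := fun y i j hij => by
    have := one_bad (y := y) (hb i j hij L L)
    simpa only [inv_pow] using this
  have hl : ∀ u i, H.gp u⁻¹ (a i * φ ^ L) 1 ≤ ca + H.δ → H.gp (u * a i)⁻¹ (φ ^ L) 1 ≤ c0 := by
    intro u i h
    have e := H.gp_left (a i) (u * a i)⁻¹ (φ ^ L) 1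
    rw [mul_inv_rev, mul_inv_cancel_left, mul_one] at e
    rw [mul_inv_rev]
    have t := H.gp_lip_base u⁻¹ (a i * φ ^ L) (a i) 1
    rw [H.symm (a i)] at t
    linarith [hA i]
  have hr : ∀ v i, H.gp v (b' i * (φ ^ L)⁻¹) 1 ≤ cb + H.δ →
      H.gp (φ ^ L)⁻¹ ((b' i)⁻¹ * v) 1 ≤ c0 := by
    intro v i h
    have e := H.gp_left (b' i) (φ ^ L)⁻¹ ((b' i)⁻¹ * v) 1
    rw [mul_inv_cancel_left, mul_one] at e
    have t := H.gp_lip_base v (b' i * (φ ^ L)⁻¹) (b' i) 1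
    rw [H.symm (b' i), H.gp_comm] at t
    linarith [hB i]
  obtain ⟨k, hk0, hk1⟩ : ∃ k, H.gp (a 0 * φ ^ L) (b' k * (φ ^ L)⁻¹) 1 ≤ cb + H.δ ∧
      H.gp (a 1 * φ ^ L) (b' k * (φ ^ L)⁻¹) 1 ≤ cb + H.δ := by
    have h01 := hright (a 0 * φ ^ L) 0 1 (by decide)
    have h02 := hright (a 0 * φ ^ L) 0 2 (by decide)
    have h12 := hright (a 0 * φ ^ L) 1 2 (by decide)
    have g01 := hright (a 1 * φ ^ L) 0 1 (by decide)
    have g02 := hright (a 1 * φ ^ L) 0 2 (by decide)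
    have g12 := hright (a 1 * φ ^ L) 1 2 (by decide)
    by_contra hno
    push Not at hno
    have n0 := hno 0
    have n1 := hno 1
    have n2 := hno 2
    rw [← not_le] at n0 n1 n2
    tauto
  let s : Fin 2 → Fin 3 := Fin.castSucc
  have hs : ∀ i, H.gp (a (s i) * φ ^ L) (b' k * (φ ^ L)⁻¹) 1 ≤ cb + H.δ := by
    exact Fin.forall_fin_two.2 ⟨hk0, hk1⟩
  have hp1 : ∀ i, H.D (a (s i) * φ ^ L * (b' k)⁻¹) (a (s i) * φ ^ L) ≤ B := fun i => by
    rw [H.symm, H.D_mul_right, H.D_one_inv]; exact hB k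
  have hp2 : ∀ i, H.D (a (s i) * φ ^ L * (b' k)⁻¹)⁻¹ (b' k * (φ ^ L)⁻¹) ≤ A := fun i => by
    rw [mul_inv_rev, mul_inv_rev, inv_inv, ← mul_assoc, H.symm, H.D_mul_right, H.D_one_inv]
    exact hA _
  refine ⟨⟨φ ^ L, c0, by positivity, a, fun i => (b' i)⁻¹, ?_, ?_, hL2, hN L hL1,
    fun i => a (s i) * φ ^ L * (b' k)⁻¹, ?_, ?_, ?_⟩⟩
  · exact fun u i j hij => (hleft u⁻¹ i j hij).imp (hl u i) (hl u j)
  · exact fun v i j hij => (hright v i j hij).imp (hr v i) (hr v j)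
  · intro i j
    have t1 := H.gp_lip_left (a (s i) * φ ^ L * (b' k)⁻¹)⁻¹ (a (s j) * φ ^ L * (b' k)⁻¹) 1
      (b' k * (φ ^ L)⁻¹)
    have t2 := H.gp_lip_right (b' k * (φ ^ L)⁻¹) (a (s j) * φ ^ L * (b' k)⁻¹) 1
      (a (s j) * φ ^ L)
    have := hs j
    rw [H.gp_comm] at this
    linarith [hp1 j, hp2 i]
  · intro i j hij
    have hsij : s i ≠ s j := fun h => hij (Fin.castSucc_injective _ h)
    have t1 := H.gp_lip_left (a (s i) * φ ^ L * (b' k)⁻¹) (a (s j) * φ ^ L * (b' k)⁻¹) 1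
      (a (s i) * φ ^ L)
    have t2 := H.gp_lip_right (a (s i) * φ ^ L) (a (s j) * φ ^ L * (b' k)⁻¹) 1
      (a (s j) * φ ^ L)
    linarith [hp1 i, hp1 j, ha _ _ hsij L L]
  · intro i
    have t1 := H.tri 1 (a (s i) * φ ^ L * (b' k)⁻¹) (a (s i) * φ ^ L)
    have t2 := H.tri (a (s i)) 1 (a (s i) * φ ^ L)
    rw [H.D_mul_right, H.symm _ 1] at t2
    linarith [hp1 i, hA (s i)]

variable (T : H.Setup)

/-- Both endpoints of the translate of `[1, f]` by `h` are `c`-close to geodesics from `a` to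
`b`. -/
def Setup.On (c : ℝ) (h a b : G) : Prop := H.gp a b h ≤ c ∧ H.gp a b (h * T.f) ≤ c

namespace Setup

variable {T}

lemma On.mono {c d : ℝ} (hcd : c ≤ d) {h a b : G} (ho : T.On c h a b) : T.On d h a b :=
  ⟨ho.1.trans hcd, ho.2.trans hcd⟩

lemma On.symm {c : ℝ} {h a b : G} (ho : T.On c h a b) : T.On c h b a :=
  ⟨by rw [H.gp_comm]; exact ho.1, by rw [H.gp_comm]; exact ho.2⟩

lemma On.left {c : ℝ} {h a b : G} (ho : T.On c h a b) (k : G) : T.On c (k * h) (k * a) (k * b) :=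
  ⟨by rw [H.gp_left]; exact ho.1, by rw [mul_assoc, H.gp_left]; exact ho.2⟩

lemma D_le_of_gp {c : ℝ} {h a b : G} (ho : H.gp a b h ≤ c) : H.D a h ≤ H.D a b + c := by
  have := H.tri a b h
  unfold gp at ho; linarith

variable (T)

/-- Twice the size of the coarse stabilizer of `(1, f)`. -/
noncomputable def M : ℝ := 2 * (T.finite_wpd.toFinset.card : ℝ)

lemma M_nonneg : 0 ≤ T.M := by unfold M; positivity

variable {T}

/-- The two possible directions in which `[h, h f]` can run along a geodesic from `a` to `b`. -/
lemma On.orient {c : ℝ} {h a b : G} (ho : T.On c h a b) :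
    |H.D a (h * T.f) - (H.D a h + H.D 1 T.f)| ≤ 2 * c + 2 * H.δ ∨
    |H.D a (h * T.f) - (H.D a h - H.D 1 T.f)| ≤ 2 * c + 2 * H.δ := by
  have h1 := H.near ho.1 ho.2
  rw [H.D_mul_right] at h1
  have h2 := H.tri a h (h * T.f)
  have h3 := H.tri a (h * T.f) h
  rw [H.symm (h * T.f) h, H.D_mul_right] at h3
  rw [H.D_mul_right] at h2
  have hc := (H.gp_nonneg _ _ _).trans ho.1
  have hδ := H.δ_pos
  rcases le_total (H.D a h) (H.D a (h * T.f)) with h4 | h4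
  · left
    rw [abs_of_nonpos (by linarith)] at h1
    rw [abs_le]; constructor <;> linarith
  · right
    rw [abs_of_nonneg (by linarith)] at h1
    rw [abs_le]; constructor <;> linarith

lemma ncard_oriented {c x s : ℝ} (hc : c ≤ T.c0 + 10 * H.δ) (a b : G) :
    {h | T.On c h a b ∧ x ≤ H.D a h ∧ H.D a h ≤ x + 1 ∧
      |H.D a (h * T.f) - (H.D a h + s)| ≤ 2 * c + 2 * H.δ}.Finite ∧
    {h | T.On c h a b ∧ x ≤ H.D a h ∧ H.D a h ≤ x + 1 ∧
      |H.D a (h * T.f) - (H.D a h + s)| ≤ 2 * c + 2 * H.δ}.ncard ≤ T.finite_wpd.toFinset.card := by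
  set A := {h | T.On c h a b ∧ x ≤ H.D a h ∧ H.D a h ≤ x + 1 ∧
      |H.D a (h * T.f) - (H.D a h + s)| ≤ 2 * c + 2 * H.δ} with hA
  have hδ := H.δ_pos
  rcases A.eq_empty_or_nonempty with h0 | ⟨h0, m1, m2, m3, m4⟩
  · simp [h0]
  · have hc0 := (H.gp_nonneg _ _ _).trans m1.1
    have hm : ∀ h ∈ A, h0⁻¹ * h ∈ T.finite_wpd.toFinset := by
      rintro h ⟨q1, q2, q3, q4⟩
      rw [abs_le] at m4 q4
      rw [Set.Finite.mem_toFinset]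
      have d1 := H.near m1.1 q1.1
      have d2 := H.near m1.2 q1.2
      have d3 : |H.D a h0 - H.D a h| ≤ 1 := by rw [abs_le]; constructor <;> linarith
      have d4 : |H.D a (h0 * T.f) - H.D a (h * T.f)| ≤ 1 + 2 * (2 * c + 2 * H.δ) := by
        rw [abs_le]; constructor <;> linarith
      refine ⟨?_, ?_⟩
      · rw [← H.D_eq_one]; linarith
      · rw [← H.left h0, ← mul_assoc, mul_inv_cancel_left]
        linarith
    have hfin : A.Finite := by
      refine (T.finite_wpd.preimage (f := fun h => h0⁻¹ * h) ?_).subset fun h hh => ?_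
      · exact fun x _ y _ hxy => by simpa using hxy
      · simpa using hm h hh
    refine ⟨hfin, ?_⟩
    rw [Set.ncard_eq_toFinset_card A hfin]
    refine Finset.card_le_card_of_injOn (fun h => h0⁻¹ * h) (fun h hh => ?_) ?_
    · exact hm h (by simpa using hh)
    · exact fun x _ y _ hxy => by simpa using hxy

end Setup
end HypMetric

end

section

namespace HypMetric
namespace Setup

variable {G : Type*} [Group G] {H : HypMetric G} {T : H.Setup}

lemma finite_and_ncard_le {α : Type*} {A B : Set α} {x : ℝ} (hB : B.Finite ∧ (B.ncard : ℝ) ≤ x)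
    (h : ∀ g ∈ A, g ∈ B) : A.Finite ∧ (A.ncard : ℝ) ≤ x :=
  ⟨hB.1.subset h, (Nat.cast_le.2 (Set.ncard_le_ncard h hB.1)).trans hB.2⟩

lemma finite_and_ncard_le_add {α : Type*} {A B C : Set α} {x y : ℝ}
    (hB : B.Finite ∧ (B.ncard : ℝ) ≤ x) (hC : C.Finite ∧ (C.ncard : ℝ) ≤ y)
    (h : ∀ g ∈ A, g ∈ B ∨ g ∈ C) : A.Finite ∧ (A.ncard : ℝ) ≤ x + y := by
  refine finite_and_ncard_le (B := B ∪ C) ⟨hB.1.union hC.1, ?_⟩ h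
  have := Set.ncard_union_le B C
  have h2 : ((B ∪ C).ncard : ℝ) ≤ B.ncard + C.ncard := by exact_mod_cast this
  linarith [hB.2, hC.2]

lemma window_one {c : ℝ} (hc : c ≤ T.c0 + 10 * H.δ) (a b : G) (x : ℝ) :
    {h | T.On c h a b ∧ x ≤ H.D a h ∧ H.D a h ≤ x + 1}.Finite ∧
    ({h | T.On c h a b ∧ x ≤ H.D a h ∧ H.D a h ≤ x + 1}.ncard : ℝ) ≤ T.M := by
  obtain ⟨f1, c1⟩ := ncard_oriented (x := x) (s := H.D 1 T.f) hc a b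
  obtain ⟨f2, c2⟩ := ncard_oriented (x := x) (s := - H.D 1 T.f) hc a b
  unfold M
  rw [two_mul]
  refine finite_and_ncard_le_add ⟨f1, Nat.cast_le.2 c1⟩ ⟨f2, Nat.cast_le.2 c2⟩ ?_
  rintro h ⟨h1, h2, h3⟩
  exact h1.orient.imp (fun h4 => ⟨h1, h2, h3, h4⟩) fun h4 => ⟨h1, h2, h3, by
    rwa [← sub_eq_add_neg]⟩

lemma window_nat {c : ℝ} (hc : c ≤ T.c0 + 10 * H.δ) (a b : G) (x : ℝ) (n : ℕ) :
    {h | T.On c h a b ∧ x ≤ H.D a h ∧ H.D a h ≤ x + (n + 1 : ℕ)}.Finite ∧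
    ({h | T.On c h a b ∧ x ≤ H.D a h ∧ H.D a h ≤ x + (n + 1 : ℕ)}.ncard : ℝ) ≤
      T.M * (n + 1 : ℕ) := by
  induction n with
  | zero => simpa using window_one hc a b x
  | succ n ih =>
    rw [Nat.cast_succ (n + 1), mul_add, mul_one]
    refine finite_and_ncard_le_add ih (window_one hc a b (x + (n + 1 : ℕ))) ?_
    rintro h ⟨h1, h2, h3⟩
    rw [← add_assoc] at h3
    exact (le_total (H.D a h) (x + (n + 1 : ℕ))).imp (fun h4 => ⟨h1, h2, h4⟩)
      fun h4 => ⟨h1, h4, h3⟩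

lemma window {c : ℝ} (hc : c ≤ T.c0 + 10 * H.δ) (a b : G) {x y : ℝ} (hxy : x ≤ y) :
    {h | T.On c h a b ∧ x ≤ H.D a h ∧ H.D a h ≤ y}.Finite ∧
    ({h | T.On c h a b ∧ x ≤ H.D a h ∧ H.D a h ≤ y}.ncard : ℝ) ≤ T.M * (y - x + 1) := by
  obtain ⟨f1, c1⟩ := window_nat hc a b x ⌊y - x⌋₊
  have h2 := Nat.floor_le (sub_nonneg.2 hxy)
  have h3 : T.M * (⌊y - x⌋₊ + 1 : ℕ) ≤ T.M * (y - x + 1) :=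
    mul_le_mul_of_nonneg_left (by push_cast; linarith) T.M_nonneg
  refine finite_and_ncard_le ⟨f1, c1.trans h3⟩ ?_
  rintro h ⟨h1, h2, h3⟩
  refine ⟨h1, h2, ?_⟩
  have := Nat.lt_floor_add_one (y - x)
  push_cast
  linarith

lemma On_subset_window {c : ℝ} (a b : G) : {h | T.On c h a b} ⊆
    {h | T.On c h a b ∧ 0 ≤ H.D a h ∧ H.D a h ≤ H.D a b + c} :=
  fun _ h1 => ⟨h1, H.nonneg _ _, D_le_of_gp h1.1⟩

lemma On_finite {c : ℝ} (hc : c ≤ T.c0 + 10 * H.δ) (a b : G) : {h | T.On c h a b}.Finite := by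
  by_cases h0 : 0 ≤ H.D a b + c
  · exact (window hc a b h0).1.subset (On_subset_window a b)
  · refine Set.finite_empty.subset fun h h1 => ?_
    have := On_subset_window (T := T) (c := c) a b h1
    exact absurd (this.2.1.trans this.2.2) h0

lemma On_ncard {c : ℝ} (hc0 : 0 ≤ c) (hc : c ≤ T.c0 + 10 * H.δ) (a b : G) :
    ({h | T.On c h a b}.ncard : ℝ) ≤ T.M * (H.D a b + c + 1) := by
  have := window hc a b (add_nonneg (H.nonneg a b) hc0)
  have h1 : ((Set.ncard _ : ℕ) : ℝ) ≤ _ :=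
    Nat.cast_le.2 (Set.ncard_le_ncard (On_subset_window (T := T) (c := c) a b) this.1)
  linarith [this.2]

/-- A finite set which is a union of three pieces. -/
lemma ncard_le_add_three {α : Type*} {A B C D : Set α} (h : A ⊆ B ∪ C ∪ D) (hB : B.Finite)
    (hC : C.Finite) (hD : D.Finite) {x y z : ℝ} (hx : (B.ncard : ℝ) ≤ x) (hy : (C.ncard : ℝ) ≤ y)
    (hz : (D.ncard : ℝ) ≤ z) : (A.ncard : ℝ) ≤ x + y + z := by
  have h1 : (A.ncard : ℝ) ≤ ((B.ncard + C.ncard + D.ncard : ℕ) : ℝ) := Nat.cast_le.2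
    ((Set.ncard_le_ncard h ((hB.union hC).union hD)).trans ((Set.ncard_union_le _ _).trans
      (Nat.add_le_add_right (Set.ncard_union_le _ _) _)))
  push_cast at h1
  linarith

section

variable {S : Finset G} (hS : Subgroup.closure (S : Set G) = ⊤)
include hS

/-- If `h` lies on a geodesic between word-close points then it is word-close to them. -/
lemma exists_endpoint_bound {c : ℝ} (hc : c ≤ T.c0 + 10 * H.δ) (n : ℕ) :
    ∃ D0 : ℕ, ∀ y z h, wordDist S y z ≤ n → T.On c h y z → wordDist S y h ≤ D0 := by
  have hfin : (⋃ z ∈ wordBall S n, {h | T.On c h 1 z}).Finite :=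
    (wordBall_finite hS n).biUnion fun z _ => On_finite hc 1 z
  obtain ⟨D0, hD⟩ := (hfin.image (wordLength S)).bddAbove
  refine ⟨D0, fun y z h h1 h2 => hD ⟨y⁻¹ * h, ?_, rfl⟩⟩
  refine Set.mem_biUnion (x := y⁻¹ * z) h1 ?_
  have := h2.left y⁻¹
  rwa [inv_mul_cancel] at this

omit hS in
lemma sum_step_le (σ : ℕ → ℕ) (P : ℕ) :
    ∑ j ∈ Finset.range P, ((σ (j + 3) : ℝ) - σ j) ≤ σ P + σ (P + 1) + σ (P + 2) := by
  have : ∑ j ∈ Finset.range P, ((σ (j + 3) : ℝ) - σ j) =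
      σ P + σ (P + 1) + σ (P + 2) - (σ 0 + σ 1 + σ 2) := by
    induction P with
    | zero => simp
    | succ P ih => rw [Finset.sum_range_succ, ih]; ring
  rw [this]
  have : (0:ℝ) ≤ σ 0 + σ 1 + σ 2 := by positivity
  linarith

omit hS in
/-- A monotone bounded function has few large jumps, so few translates lie over them. -/
lemma ncard_jumps {c A : ℝ} (hA : 0 < A) (hc : c ≤ T.c0 + 10 * H.δ) (a b : G) (τ : ℝ → ℕ)
    (hτ : Monotone τ) {m : ℕ} (hm : ∀ x, τ x ≤ m) {n : ℕ} (hn : 0 < n) :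
    ({h | T.On c h a b ∧ τ (H.D a h - A) + n < τ (H.D a h + A)}.ncard : ℝ) ≤
      T.M * (A + 1) * (3 * m / n) := by
  set σ : ℕ → ℕ := fun j => τ ((j - 1 : ℝ) * A) with hσ
  have hσm : Monotone σ := fun i j hij => hτ (mul_le_mul_of_nonneg_right
    (by have : (i:ℝ) ≤ j := by exact_mod_cast hij
        linarith) hA.le)
  obtain ⟨P, hP⟩ := exists_nat_gt ((H.D a b + c) / A)
  set J := (Finset.range P).filter fun j => σ j + n < σ (j + 3) with hJ
  have hcell : ∀ j : ℕ, {h | T.On c h a b ∧ j * A ≤ H.D a h ∧ H.D a h ≤ j * A + A}.Finite ∧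
    ({h | T.On c h a b ∧ j * A ≤ H.D a h ∧ H.D a h ≤ j * A + A}.ncard : ℝ) ≤ T.M * (A + 1) := by
    intro j
    have := window hc a b (x := j * A) (y := j * A + A) (by linarith)
    rwa [add_sub_cancel_left] at this
  have hsub : {h | T.On c h a b ∧ τ (H.D a h - A) + n < τ (H.D a h + A)} ⊆
      ⋃ j ∈ J, {h | T.On c h a b ∧ j * A ≤ H.D a h ∧ H.D a h ≤ j * A + A} := by
    rintro h ⟨h1, h2⟩
    have hx := H.nonneg a h
    have f1 := Nat.floor_le (div_nonneg hx hA.le)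
    have f2 := Nat.lt_floor_add_one (H.D a h / A)
    rw [le_div_iff₀ hA] at f1
    rw [div_lt_iff₀ hA] at f2
    refine Set.mem_biUnion (x := ⌊H.D a h / A⌋₊) ?_
      (show h ∈ {h | _} from ⟨h1, f1, by linarith⟩)
    rw [hJ, Finset.mem_coe, Finset.mem_filter, Finset.mem_range]
    constructor
    · have h3 : ((⌊H.D a h / A⌋₊ : ℕ) : ℝ) < P := by
        refine lt_of_le_of_lt ?_ hP
        rw [le_div_iff₀ hA]
        exact f1.trans (D_le_of_gp h1.1)
      exact_mod_cast h3
    · have m1 : σ ⌊H.D a h / A⌋₊ ≤ τ (H.D a h - A) := hτ (by linarith)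
      have m2 : τ (H.D a h + A) ≤ σ (⌊H.D a h / A⌋₊ + 3) := hτ (by push_cast; linarith)
      omega
  have hJcard : (J.card : ℝ) ≤ 3 * m / n := by
    rw [le_div_iff₀ (by exact_mod_cast hn)]
    have e1 : (J.card : ℝ) * n ≤ ∑ j ∈ J, ((σ (j + 3) : ℝ) - σ j) := by
      rw [← nsmul_eq_mul]
      refine Finset.card_nsmul_le_sum _ _ _ fun j hj => ?_
      have : ((σ j + n : ℕ) : ℝ) ≤ σ (j + 3) := by
        exact_mod_cast (Finset.mem_filter.1 hj).2.le
      push_cast at this; linarith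
    have e2 : ∑ j ∈ J, ((σ (j + 3) : ℝ) - σ j) ≤ ∑ j ∈ Finset.range P, ((σ (j + 3) : ℝ) - σ j) :=
      Finset.sum_le_sum_of_subset_of_nonneg (Finset.filter_subset _ _) fun j _ _ => by
        have : (σ j : ℝ) ≤ σ (j + 3) := by exact_mod_cast hσm (by omega)
        linarith
    have e3 := sum_step_le σ P
    have e4 : ∀ j, (σ j : ℝ) ≤ m := fun j => by exact_mod_cast hm _
    linarith [e4 P, e4 (P + 1), e4 (P + 2)]
  have hfin : (⋃ j ∈ J, {h | T.On c h a b ∧ j * A ≤ H.D a h ∧ H.D a h ≤ j * A + A}).Finite :=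
    J.finite_toSet.biUnion fun j _ => (hcell j).1
  have h1 := (Set.ncard_le_ncard hsub hfin).trans (Finset.set_ncard_biUnion_le J _)
  have h2 : (∑ j ∈ J, ({h | T.On c h a b ∧ j * A ≤ H.D a h ∧ H.D a h ≤ j * A + A}.ncard : ℝ)) ≤
      J.card • (T.M * (A + 1)) := Finset.sum_le_card_nsmul _ _ _ fun j _ => (hcell j).2
  have h3 : ({h | T.On c h a b ∧ τ (H.D a h - A) + n < τ (H.D a h + A)}.ncard : ℝ) ≤
      J.card • (T.M * (A + 1)) := le_trans (by exact_mod_cast h1) h2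
  rw [nsmul_eq_mul, mul_comm] at h3
  exact h3.trans (mul_le_mul_of_nonneg_left hJcard
    (mul_nonneg T.M_nonneg (by linarith)))

/-- Paths with bounded steps pass close to all but a small proportion of the translates of
`[1, f]` lying on a geodesic between their endpoints, and do so in order. -/
lemma exists_efficient {c : ℝ} (hc : c ≤ T.c0 + 8 * H.δ) (hc0 : 0 ≤ c) (Q : ℕ) {θ : ℝ}
    (hθ : 0 < θ) : ∃ D0 : ℕ, ∀ E : ℕ, ∃ C : ℝ, ∀ (a b : G) (γ : ℕ → G) (m : ℕ),
      wordDist S a (γ 0) ≤ E → wordDist S (γ m) b ≤ E →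
      (∀ i < m, wordDist S (γ i) (γ (i + 1)) ≤ Q) →
      ∃ τ : ℝ → ℕ, Monotone τ ∧ (∀ x, τ x ≤ m) ∧
        ({h | T.On c h a b ∧ D0 < wordDist S (γ (τ (H.D a h))) h}.ncard : ℝ) ≤ θ * m + C := by
  have hδ := H.δ_pos
  have hM := T.M_nonneg
  have hcM : c ≤ T.c0 + 10 * H.δ := by linarith
  obtain ⟨C1, hC1, hD⟩ := H.exists_D_le hS
  have hf := H.nonneg 1 T.f
  set B := c + 5 * H.δ with hB
  set A := B + C1 * Q + H.D 1 T.f with hA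
  have hJ : 0 ≤ C1 * Q := by positivity
  have hA0 : 0 < A := by linarith
  obtain ⟨n, hn⟩ := exists_nat_gt (3 * (T.M * (A + 1)) / θ)
  have hn0 : 0 < n := by
    have : (0:ℝ) < n := lt_of_le_of_lt (by positivity) hn
    exact_mod_cast this
  obtain ⟨D0, hD0⟩ := exists_endpoint_bound (T := T) hS (c := c + 2 * H.δ) (by linarith) (Q * n)
  refine ⟨D0, fun E => ?_⟩
  set R := C1 * E + B + H.D 1 T.f with hR
  have hR0 : 0 ≤ R := by positivity
  refine ⟨T.M * (R + 1) + T.M * (R + c + 1), fun a b γ m hE1 hE2 hstep => ?_⟩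
  set π : ℕ → ℝ := fun t => H.gp (γ t) b a with hπ
  have hπ0 : π 0 ≤ C1 * E := by
    have t1 := H.gp_le_left (γ 0) b a
    have t2 := hD a (γ 0)
    rw [H.symm] at t1
    have t3 : C1 * wordDist S a (γ 0) ≤ C1 * E :=
      mul_le_mul_of_nonneg_left (by exact_mod_cast hE1) (by linarith)
    linarith
  have hπm : H.D a b - C1 * E ≤ π m := by
    have t1 := H.gp_lip_left b b a (γ m)
    have t2 := hD (γ m) b
    have t3 : C1 * wordDist S (γ m) b ≤ C1 * E :=
      mul_le_mul_of_nonneg_left (by exact_mod_cast hE2) (by linarith)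
    have t4 : H.gp b b a = H.D a b := by
      unfold gp; rw [H.self, H.symm b a]; ring
    rw [H.symm b] at t1
    change _ ≤ H.gp (γ m) b a
    linarith
  have hπs : ∀ t < m, π (t + 1) ≤ π t + C1 * Q := by
    intro t ht
    have t1 := H.gp_lip_left (γ (t + 1)) b a (γ t)
    have t2 := hD (γ t) (γ (t + 1))
    have t3 : C1 * wordDist S (γ t) (γ (t + 1)) ≤ C1 * Q :=
      mul_le_mul_of_nonneg_left (by exact_mod_cast hstep t ht) (by linarith)
    rw [H.symm (γ (t + 1))] at t1
    change H.gp (γ (t + 1)) b a ≤ H.gp (γ t) b a + _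
    linarith
  set τ0 : ℝ → ℕ := fun x => sInf ({t | x ≤ π t} ∪ {m}) with hτ0
  have hmem : ∀ x, x ≤ π (τ0 x) ∨ τ0 x = m := fun x =>
    Nat.sInf_mem (s := {t | x ≤ π t} ∪ {m}) ⟨m, Or.inr rfl⟩
  have hτm : ∀ x, τ0 x ≤ m := fun x => Nat.sInf_le (Or.inr rfl)
  have hlt : ∀ x, ∀ t < τ0 x, π t < x := by
    intro x t ht
    by_contra hge
    exact absurd (Nat.sInf_le (s := {t | x ≤ π t} ∪ {m}) (Or.inl (not_lt.1 hge))) (not_le.2 ht)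
  have hmono : Monotone τ0 := by
    intro x y hxy
    rcases hmem y with h1 | h1
    · exact Nat.sInf_le (Or.inl (hxy.trans h1))
    · rw [h1]; exact hτm x
  have hword : ∀ t d, t + d ≤ m → wordDist S (γ t) (γ (t + d)) ≤ Q * d := by
    intro t d
    induction d with
    | zero => intro _; simp
    | succ d ih =>
      intro h
      have h1 := ih (by omega)
      have h2 := hstep (t + d) (by omega)
      have h3 := wordDist_tri hS (γ t) (γ (t + d)) (γ (t + d + 1))
      rw [Nat.mul_succ]
      rw [← add_assoc]
      omega
  refine ⟨fun x => τ0 (x - A), fun x y hxy => hmono (by linarith), fun x => hτm _, ?_⟩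
  have hw1 := window hcM a b hR0
  have hw2 := window hcM a b (x := H.D a b - R) (y := H.D a b + c) (by linarith)
  have hjump := ncard_jumps hA0 hcM a b τ0 hmono hτm hn0
  have hjfin : {h | T.On c h a b ∧ τ0 (H.D a h - A) + n < τ0 (H.D a h + A)}.Finite :=
    (On_finite hcM a b).subset fun h hh => hh.1
  have hjump' : T.M * (A + 1) * (3 * m / n) ≤ θ * m := by
    rw [div_lt_iff₀ hθ] at hn
    rw [← mul_div_assoc, div_le_iff₀ (by exact_mod_cast hn0)]
    have := mul_le_mul_of_nonneg_right hn.le (Nat.cast_nonneg (α := ℝ) m)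
    linarith
  have hsub : {h | T.On c h a b ∧ D0 < wordDist S (γ (τ0 (H.D a h - A))) h} ⊆
      {h | T.On c h a b ∧ τ0 (H.D a h - A) + n < τ0 (H.D a h + A)} ∪
      {h | T.On c h a b ∧ 0 ≤ H.D a h ∧ H.D a h ≤ R} ∪
      {h | T.On c h a b ∧ H.D a b - R ≤ H.D a h ∧ H.D a h ≤ H.D a b + c} := by
    rintro h ⟨h1, h2⟩
    by_contra hno
    have n1 : ¬ (τ0 (H.D a h - A) + n < τ0 (H.D a h + A)) := fun h3 =>
      hno (Or.inl (Or.inl (show h ∈ {h | _} from ⟨h1, h3⟩)))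
    have n2 : ¬ (H.D a h ≤ R) := fun h3 =>
      hno (Or.inl (Or.inr (show h ∈ {h | _} from ⟨h1, H.nonneg _ _, h3⟩)))
    have n3 : ¬ (H.D a b - R ≤ H.D a h) := fun h3 =>
      hno (Or.inr (show h ∈ {h | _} from ⟨h1, h3, D_le_of_gp h1.1⟩))
    push Not at n1 n2 n3
    set t1 := τ0 (H.D a h - A) with ht1
    set t2 := τ0 (H.D a h + A) with ht2
    have b1 : π t1 ≤ H.D a h - B - H.D 1 T.f := by
      rcases Nat.eq_zero_or_pos t1 with h0 | h0
      · rw [h0]; linarith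
      · have q1 := hlt (H.D a h - A) (t1 - 1) (by omega)
        have q2 := hπs (t1 - 1) (by have := hτm (H.D a h - A); omega)
        rw [Nat.sub_add_cancel h0] at q2
        linarith
    have b2 : H.D a h + B + H.D 1 T.f ≤ π t2 := by
      rcases hmem (H.D a h + A) with h0 | h0
      · change _ ≤ π t2 at h0
        linarith
      · change t2 = m at h0
        rw [h0]; linarith
    have d1 := H.tri a h (h * T.f)
    have d2 := H.tri a (h * T.f) h
    rw [H.symm (h * T.f) h, H.D_mul_right] at d2
    rw [H.D_mul_right] at d1
    have hon : T.On (c + 2 * H.δ) h (γ t1) (γ t2) :=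
      ⟨H.between (B := B) (by linarith) h1.1 (show π t1 + _ ≤ _ by linarith)
          (show _ ≤ π t2 by linarith),
        H.between (B := B) (by linarith) h1.2 (show π t1 + _ ≤ _ by linarith)
          (show _ ≤ π t2 by linarith)⟩
    have hle : t1 ≤ t2 := hmono (by linarith)
    have hwd : wordDist S (γ t1) (γ t2) ≤ Q * n := by
      have := hword t1 (t2 - t1) (by have := hτm (H.D a h + A); omega)
      rw [Nat.add_sub_cancel' hle] at this
      exact this.trans (Nat.mul_le_mul_left _ (by omega))
    exact absurd (hD0 _ _ _ hwd hon) (not_le.2 h2)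
  have := ncard_le_add_three hsub hjfin hw1.1 hw2.1 hjump hw1.2 hw2.2
  have e : T.M * (R - 0 + 1) + T.M * (H.D a b + c - (H.D a b - R) + 1) =
    T.M * (R + 1) + T.M * (R + c + 1) := by ring
  linarith

end

end Setup
end HypMetric

end

section

lemma ncard_le_mul_of_fiber {α β : Type*} {A : Set α} {B : Set β} (f : α → β) (hA : A.Finite)
    (hB : B.Finite) (hf : ∀ x ∈ A, f x ∈ B) {K : ℝ}
    (hK : ∀ y ∈ B, ({x | x ∈ A ∧ f x = y}.ncard : ℝ) ≤ K) : (A.ncard : ℝ) ≤ K * B.ncard := by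
  classical
  have h1 := Finset.card_eq_sum_card_fiberwise (f := f) (s := hA.toFinset) (t := hB.toFinset)
    (fun x hx => by simpa using hf x (by simpa using hx))
  rw [Set.ncard_eq_toFinset_card A hA, Set.ncard_eq_toFinset_card B hB, h1]
  push_cast
  rw [mul_comm, ← nsmul_eq_mul]
  refine Finset.sum_le_card_nsmul _ _ _ fun y hy => ?_
  refine le_trans (le_of_eq ?_) (hK y (by simpa using hy))
  rw [Nat.cast_inj, ← Set.ncard_coe_finset]
  congr 1
  ext x
  simp

namespace HypMetric
namespace Setup

variable {G : Type*} [Group G] {H : HypMetric G} {T : H.Setup}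
variable {S : Finset G} (hS : Subgroup.closure (S : Set G) = ⊤)

variable (T) in
lemma exists_left (u : G) : ∃ i, H.gp (u * T.a i)⁻¹ T.f 1 ≤ T.c0 :=
  (T.left u 0 1 (by decide)).elim (fun h => ⟨0, h⟩) fun h => ⟨1, h⟩

variable (T) in
lemma exists_right (v : G) : ∃ i, H.gp T.f⁻¹ (T.b i * v) 1 ≤ T.c0 :=
  (T.right v 0 1 (by decide)).elim (fun h => ⟨0, h⟩) fun h => ⟨1, h⟩

variable (T) in
/-- The index of the left connector used to insert `f` after `u`. -/
noncomputable def α (u : G) : Fin 3 := (T.exists_left u).choose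

variable (T) in
/-- The index of the right connector used to insert `f` before `v`. -/
noncomputable def β (v : G) : Fin 3 := (T.exists_right v).choose

variable (T) in
/-- The product of two elements, with a copy of `f` inserted in between. -/
noncomputable def ins (u v : G) : G := u * T.a (T.α u) * (T.f * (T.b (T.β v) * v))

variable (T) in
lemma On_ins (u v : G) : T.On (T.c0 + H.δ) (u * T.a (T.α u)) 1 (T.ins u v) := by
  have h1 : H.gp (u * T.a (T.α u))⁻¹ T.f 1 ≤ T.c0 := (T.exists_left u).choose_spec
  have h2 : H.gp T.f⁻¹ (T.b (T.β v) * v) 1 ≤ T.c0 := (T.exists_right v).choose_spec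
  have hδ := H.δ_pos
  have h0 := T.c0_nonneg
  have hl := T.long
  have h3 := H.gp_step h1 (h2.trans (by linarith)) (by linarith)
  rw [H.gp_comm] at h2
  have h4 := H.gp_step (x := (u * T.a (T.α u))⁻¹) h2
    (by rw [inv_inv, H.gp_comm]; linarith) (by rw [H.D_one_inv]; linarith)
  constructor
  · rw [H.gp_eq_one, mul_one, ins, inv_mul_cancel_left]
    exact h3
  · rw [H.gp_eq_one, H.gp_comm, mul_one, ins, mul_inv_rev]
    simpa [mul_assoc] using h4

lemma exists_bound_fin (F : Fin 3 → ℝ) : ∃ A, 0 ≤ A ∧ ∀ i, F i ≤ A :=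
  ⟨|F 0| + |F 1| + |F 2|, by positivity, fun i => by
    have := abs_nonneg (F 0)
    have := abs_nonneg (F 1)
    have := abs_nonneg (F 2)
    have := le_abs_self (F i)
    fin_cases i <;> simp at this ⊢ <;> linarith⟩

variable (T) in
include T hS in
lemma exists_wordLength_ins_le :
    ∃ L : ℕ, ∀ u v, wordLength S (T.ins u v) ≤ wordLength S u + wordLength S v + L := by
  obtain ⟨A, -, hA⟩ := exists_bound_fin fun i => (wordLength S (T.a i) : ℝ)
  obtain ⟨B, -, hB⟩ := exists_bound_fin fun i => (wordLength S (T.b i) : ℝ)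
  refine ⟨⌈A⌉₊ + wordLength S T.f + ⌈B⌉₊, fun u v => ?_⟩
  have h1 : wordLength S (T.a (T.α u)) ≤ ⌈A⌉₊ := by
    exact_mod_cast (hA (T.α u)).trans (Nat.le_ceil A)
  have h2 : wordLength S (T.b (T.β v)) ≤ ⌈B⌉₊ := by
    exact_mod_cast (hB (T.β v)).trans (Nat.le_ceil B)
  have h3 := wordLength_mul_le hS (u * T.a (T.α u)) (T.f * (T.b (T.β v) * v))
  have h4 := wordLength_mul_le hS u (T.a (T.α u))
  have h5 := wordLength_mul_le hS T.f (T.b (T.β v) * v)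
  have h6 := wordLength_mul_le hS (T.b (T.β v)) v
  unfold ins
  omega

variable (T) in
/-- A set of pairs with the same image under insertion is controlled by the number of translates
of `[1, f]` on the way to the first components. -/
lemma exists_ncard_ins_fiber_le : ∃ C : ℝ, 0 ≤ C ∧ ∀ (w : G) (K : ℝ) (P : Set (G × G)), 0 ≤ K →
    P.Finite → (∀ p ∈ P, T.ins p.1 p.2 = w) →
    (∀ p ∈ P, ({h | T.On (T.c0 + 2 * H.δ) h 1 p.1}.ncard : ℝ) ≤ K) →
    (P.ncard : ℝ) ≤ 9 * (K + C) := by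
  obtain ⟨A, hA0, hA⟩ := exists_bound_fin fun i => H.D 1 (T.a i)
  have hδ := H.δ_pos
  have h0 := T.c0_nonneg
  have hf := H.nonneg 1 T.f
  set R := 2 * (T.c0 + H.δ) + H.δ + A + H.D 1 T.f + 1 with hR
  have hR0 : 0 ≤ R := by positivity
  have hM := T.M_nonneg
  refine ⟨T.M * (R + 1), by positivity, fun w K P hK hP hw hKP => ?_⟩
  set U := (fun p : G × G => p.1 * T.a (T.α p.1)) '' P with hU
  have hUfin : U.Finite := hP.image _
  have hUon : ∀ x ∈ U, T.On (T.c0 + H.δ) x 1 w := by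
    rintro _ ⟨p, hp, rfl⟩
    rw [← hw p hp]
    exact T.On_ins p.1 p.2
  have h1 : P.ncard ≤ 9 * U.ncard := by
    have e1 : ((Set.univ : Set (Fin 3 × Fin 3)) ×ˢ U).ncard = 9 * U.ncard := by
      rw [Set.ncard_prod, Set.ncard_univ]; simp
    rw [← e1]
    refine Set.ncard_le_ncard_of_injOn
      (fun p => ((T.α p.1, T.β p.2), p.1 * T.a (T.α p.1))) (fun p hp => ⟨trivial, p, hp, rfl⟩)
      ?_ (Set.finite_univ.prod hUfin)
    rintro ⟨u, v⟩ hp ⟨u', v'⟩ hp' heq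
    simp only [Prod.mk.injEq] at heq ⊢
    obtain ⟨⟨e2, e3⟩, e4⟩ := heq
    have e5 := (hw _ hp).trans (hw _ hp').symm
    simp only [ins] at e5
    rw [← e4, e3] at e5
    rw [e2] at e4
    refine ⟨mul_right_cancel e4, ?_⟩
    simpa using e5
  have h2 : (U.ncard : ℝ) ≤ K + T.M * (R + 1) := by
    rcases U.eq_empty_or_nonempty with hU0 | hU0
    · rw [hU0]; simp; positivity
    obtain ⟨x, hx, hmax⟩ := Set.exists_max_image U (fun x => H.D 1 x) hUfin hU0
    obtain ⟨p, hp, rfl⟩ := id hx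
    simp only at hmax
    set x := p.1 * T.a (T.α p.1) with hxdef
    have hxw := (hUon x hx).1
    refine (finite_and_ncard_le_add ⟨On_finite (T := T) (by linarith) 1 p.1, hKP p hp⟩
      (y := T.M * (R + 1)) ?_ (B := {h | T.On (T.c0 + 2 * H.δ) h 1 p.1})
      (C := {h | T.On (T.c0 + H.δ) h 1 w ∧ H.D 1 x - R ≤ H.D 1 h ∧ H.D 1 h ≤ H.D 1 x}) ?_).2
    · have := window (T := T) (c := T.c0 + H.δ) (by linarith) 1 w
        (show H.D 1 x - R ≤ H.D 1 x by linarith)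
      rwa [show H.D 1 x - (H.D 1 x - R) + 1 = R + 1 by ring] at this
    intro y hy
    have hyw := hUon y hy
    rcases le_or_gt (H.D 1 x - R) (H.D 1 y) with h3 | h3
    · exact Or.inr ⟨hyw, h3, hmax y hy⟩
    · left
      have e1 := H.gp_add w 1 x
      have e2 := H.gp_lip_left x w 1 p.1
      have e3 : H.D x p.1 ≤ A := by
        rw [H.symm, hxdef, H.D_mul_right]; exact hA _
      have e4 := H.tri 1 y (y * T.f)
      rw [H.D_mul_right] at e4
      have e5 : H.D 1 x ≤ H.gp x w 1 + (T.c0 + H.δ) := by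
        rw [H.gp_comm x w 1]
        rw [H.gp_comm 1 w x] at hxw
        rw [H.symm 1 x] at *
        linarith
      have e6 := H.transfer (g := p.1) hyw.1 (by linarith)
      have e7 := H.transfer (g := p.1) hyw.2 (by linarith)
      exact ⟨e6.trans (by linarith), e7.trans (by linarith)⟩
  have h3 : (P.ncard : ℝ) ≤ 9 * U.ncard := by exact_mod_cast h1
  linarith

variable (T) in
include T hS in
/-- Counting pairs through insertion. -/
lemma exists_ncard_pairs_le : ∃ (L : ℕ) (C : ℝ), 0 ≤ C ∧ ∀ (n : ℕ) (K : ℝ), 0 ≤ K →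
    {p : G × G | wordLength S p.1 + wordLength S p.2 ≤ n ∧
      ({h | T.On (T.c0 + 2 * H.δ) h 1 p.1}.ncard : ℝ) ≤ K}.Finite ∧
    ({p : G × G | wordLength S p.1 + wordLength S p.2 ≤ n ∧
      ({h | T.On (T.c0 + 2 * H.δ) h 1 p.1}.ncard : ℝ) ≤ K}.ncard : ℝ) ≤
      9 * (K + C) * growth S (n + L) := by
  obtain ⟨L, hL⟩ := T.exists_wordLength_ins_le hS
  obtain ⟨C, hC0, hC⟩ := T.exists_ncard_ins_fiber_le
  refine ⟨L, C, hC0, fun n K hK => ?_⟩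
  set P := {p : G × G | wordLength S p.1 + wordLength S p.2 ≤ n ∧
      ({h | T.On (T.c0 + 2 * H.δ) h 1 p.1}.ncard : ℝ) ≤ K} with hP
  have hfin : P.Finite := ((wordBall_finite hS n).prod (wordBall_finite hS n)).subset fun p hp =>
    ⟨le_trans (Nat.le_add_right _ _) hp.1, le_trans (Nat.le_add_left _ _) hp.1⟩
  refine ⟨hfin, ncard_le_mul_of_fiber (fun p : G × G => T.ins p.1 p.2) hfin
    (wordBall_finite hS (n + L)) (fun p hp => (hL _ _).trans (Nat.add_le_add_right hp.1 L))
    fun w _ => hC w K _ hK (hfin.subset fun p hp => hp.1) (fun p hp => hp.2) fun p hp => hp.1.2⟩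

variable (T) in
include T hS in
/-- The growth function is supermultiplicative up to a linear factor. -/
lemma exists_growth_mul_le : ∃ (L : ℕ) (C : ℝ), 0 ≤ C ∧ ∀ i j : ℕ,
    (growth S i : ℝ) * growth S j ≤ C * (i + 1) * growth S (i + j + L) := by
  obtain ⟨L, C, hC0, hC⟩ := T.exists_ncard_pairs_le hS
  obtain ⟨C1, hC1, hD⟩ := H.exists_D_le hS
  have hδ := H.δ_pos
  have h0 := T.c0_nonneg
  have hM := T.M_nonneg
  set c := T.c0 + 2 * H.δ with hc
  refine ⟨L, 9 * (T.M * (C1 + c + 1) + C), by positivity, fun i j => ?_⟩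
  have hK : 0 ≤ T.M * (C1 * i + c + 1) := by positivity
  obtain ⟨hfin, hle⟩ := hC (i + j) _ hK
  have h1 := (finite_and_ncard_le (A := wordBall S i ×ˢ wordBall S j) ⟨hfin, hle⟩ (by
    rintro ⟨u, v⟩ ⟨hu, hv⟩
    refine ⟨Nat.add_le_add hu hv, (On_ncard (T := T) (by linarith) (by linarith) 1 u).trans ?_⟩
    have h2 := hD 1 u
    rw [wordDist_one] at h2
    have h3 : (wordLength S u : ℝ) ≤ i := by exact_mod_cast hu
    have h4 : C1 * wordLength S u ≤ C1 * i := by gcongr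
    exact mul_le_mul_of_nonneg_left (by linarith) hM)).2
  rw [Set.ncard_prod, Nat.cast_mul] at h1
  refine h1.trans ?_
  refine mul_le_mul_of_nonneg_right ?_ (Nat.cast_nonneg _)
  have hi : (0:ℝ) ≤ i := Nat.cast_nonneg _
  have e1 : T.M * (C1 * i + c + 1) ≤ T.M * (C1 + c + 1) * (i + 1) := by
    rw [mul_assoc]
    refine mul_le_mul_of_nonneg_left ?_ hM
    nlinarith
  nlinarith

variable (T) in
/-- The value of a word in the two free generators. -/
noncomputable def wordVal (l : List (Fin 2)) : G := (l.map T.p).prod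

lemma gp_wordVal (l : List (Fin 2)) (i : Fin 2) :
    H.gp (T.p i)⁻¹ (T.wordVal l) 1 ≤ T.c0 + H.δ := by
  have hδ := H.δ_pos
  have h0 := T.c0_nonneg
  induction l generalizing i with
  | nil => simp only [wordVal, List.map_nil, List.prod_nil, H.gp_self_right]; linarith
  | cons j l ih =>
    simp only [wordVal, List.map_cons, List.prod_cons] at ih ⊢
    exact H.gp_step (T.p_quasi i j) (ih j) (by linarith [T.p_long j])

lemma wordVal_injective : ∀ (l l' : List (Fin 2)), l.length = l'.length →
    T.wordVal l = T.wordVal l' → l = l' := by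
  intro l
  induction l with
  | nil => intro l' h _; exact (List.length_eq_zero_iff.1 h.symm).symm
  | cons i l ih =>
    intro l' h he
    cases l' with
    | nil => simp at h
    | cons j l' =>
      have hδ := H.δ_pos
      have h0 := T.c0_nonneg
      have h1 := gp_wordVal (T := T) l i
      have h2 := gp_wordVal (T := T) l' j
      have e1 := H.gp_mul_eq (T.p i) (T.wordVal l)
      have e2 := H.gp_mul_eq (T.p j) (T.wordVal l')
      have e3 : T.p i * T.wordVal l = T.p j * T.wordVal l' := by
        simpa [wordVal] using he
      have hij : i = j := by
        by_contra hij
        rw [← e3, H.gp_comm] at e2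
        have l1 := T.p_long i
        have l2 := T.p_long j
        rcases H.gp_four_le (y := T.p i * T.wordVal l) (T.p_indep i j hij) with h3 | h3 <;> linarith
      subst hij
      rw [ih l' (by simpa using h) (mul_left_cancel e3)]

variable (T) in
include T hS in
lemma exists_two_pow_le : ∃ L : ℕ, 0 < L ∧ ∀ k : ℕ, 2 ^ k ≤ growth S (L * k) := by
  set L := wordLength S (T.p 0) + wordLength S (T.p 1) + 1 with hL
  have hlen : ∀ l : List (Fin 2), wordLength S (T.wordVal l) ≤ L * l.length := by
    intro l
    induction l with
    | nil => simp [wordVal]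
    | cons i l ih =>
      have h1 : T.wordVal (i :: l) = T.p i * T.wordVal l := by simp [wordVal]
      have h2 : wordLength S (T.p i) ≤ L := by fin_cases i <;> simp [hL] <;> omega
      have h3 := wordLength_mul_le hS (T.p i) (T.wordVal l)
      rw [h1, List.length_cons, mul_add, mul_one]
      omega
  refine ⟨L, by omega, fun k => ?_⟩
  have e : (Set.univ : Set (Fin k → Fin 2)).ncard = 2 ^ k := by
    rw [Set.ncard_univ]; simp
  rw [← e]
  refine Set.ncard_le_ncard_of_injOn (fun F => T.wordVal (List.ofFn F)) (fun F _ => ?_) ?_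
    (wordBall_finite hS _)
  · have := hlen (List.ofFn F)
    rwa [List.length_ofFn] at this
  · intro F _ F' _ h
    exact List.ofFn_injective (wordVal_injective _ _ (by simp) h)

variable (T) in
include T hS in
/-- The growth function beats every cubic polynomial, even after a linear change of variable. -/
lemma eventually_cube_le_growth {κ : ℝ} (hκ : 0 < κ) {A : ℝ} (hA : 0 ≤ A) :
    ∀ᶠ n : ℕ in Filter.atTop, A * ((n : ℝ) + 1) ^ 3 ≤ growth S ⌊κ * n⌋₊ := by
  obtain ⟨L, hL, hg⟩ := T.exists_two_pow_le hS
  have hL' : (0:ℝ) < L := by exact_mod_cast hL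
  set A' := A * (L / κ + 1) ^ 3 + 1 with hA'
  have hA'0 : 0 < A' := by positivity
  have h1 := tendsto_pow_const_div_const_pow_of_one_lt 3 (r := (2:ℝ)) (by norm_num)
  have h2 := h1.eventually (gt_mem_nhds (show 0 < 1 / (2 * A') by positivity))
  have h3 : Filter.Tendsto (fun n : ℕ => ⌊κ * n / L⌋₊ + 1) Filter.atTop Filter.atTop := by
    refine (Filter.tendsto_add_atTop_nat 1).comp (tendsto_nat_floor_atTop.comp ?_)
    exact (tendsto_natCast_atTop_atTop.const_mul_atTop hκ).atTop_div_const hL'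
  filter_upwards [h3.eventually h2] with n hn
  set k := ⌊κ * n / L⌋₊ with hk
  have hk1 : κ * n / L < k + 1 := Nat.lt_floor_add_one _
  have hk2 : (k:ℝ) ≤ κ * n / L := Nat.floor_le (by positivity)
  have h4 : (n:ℝ) + 1 ≤ (L / κ + 1) * (k + 1) := by
    have : (n:ℝ) = (L / κ) * (κ * n / L) := by field_simp
    have h5 : (n:ℝ) ≤ (L / κ) * (k + 1) := by
      rw [this]; exact mul_le_mul_of_nonneg_left hk1.le (by positivity)
    have : (0:ℝ) ≤ k := Nat.cast_nonneg _
    linarith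
  have h5 : L * k ≤ ⌊κ * n⌋₊ := by
    refine Nat.le_floor ?_
    push_cast
    rw [le_div_iff₀ hL'] at hk2
    linarith
  have h6 : (2:ℝ) ^ k ≤ growth S ⌊κ * n⌋₊ := by
    exact_mod_cast (hg k).trans (growth_mono hS h5)
  refine le_trans ?_ h6
  rw [div_lt_div_iff₀ (by positivity) (by positivity)] at hn
  push_cast at hn
  rw [pow_succ (2:ℝ)] at hn
  have h7 : A * ((n:ℝ) + 1) ^ 3 ≤ A' * ((k:ℝ) + 1) ^ 3 := by
    calc A * ((n:ℝ) + 1) ^ 3 ≤ A * ((L / κ + 1) * (k + 1)) ^ 3 := by gcongr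
      _ = (A * (L / κ + 1) ^ 3) * ((k:ℝ) + 1) ^ 3 := by ring
      _ ≤ _ := by gcongr; linarith
  linarith

end Setup
end HypMetric

end

section

namespace HypMetric
namespace Setup

variable {G : Type*} [Group G] {H : HypMetric G} {T : H.Setup}
variable {S : Finset G} (hS : Subgroup.closure (S : Set G) = ⊤)

variable (T) in
include T hS in
lemma eventually_growth_half_le {ε : ℝ} (hε : 0 < ε) :
    ∀ᶠ n : ℕ in Filter.atTop, (growth S (n / 2) : ℝ) ≤ ε * growth S n := by
  obtain ⟨L, C, hC0, hC⟩ := T.exists_growth_mul_le hS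
  filter_upwards [T.eventually_cube_le_growth hS (κ := 1 / 4) (by norm_num)
    (A := (C + 1) / ε) (by positivity), Filter.eventually_ge_atTop (4 * L + 4)] with n hn hnL
  have h1 := hC (n / 2) (n - n / 2 - L)
  rw [show n / 2 + (n - n / 2 - L) + L = n by omega] at h1
  have h2 : ⌊(1 / 4 : ℝ) * n⌋₊ ≤ n - n / 2 - L := by
    have : ⌊(1 / 4 : ℝ) * n⌋₊ ≤ n / 4 := by
      rw [one_div, inv_mul_eq_div]
      exact_mod_cast (Nat.floor_div_natCast (n:ℝ) 4).le.trans (by simp)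
    omega
  have h3 : (growth S ⌊(1 / 4 : ℝ) * n⌋₊ : ℝ) ≤ growth S (n - n / 2 - L) := by
    exact_mod_cast growth_mono hS h2
  set x := (growth S (n / 2) : ℝ) with hx
  have hx0 : 0 ≤ x := Nat.cast_nonneg _
  have hn0 : (0:ℝ) ≤ n := Nat.cast_nonneg _
  have hg0 : (0:ℝ) ≤ growth S n := Nat.cast_nonneg _
  have h4 : ((n / 2 : ℕ) : ℝ) ≤ n := by exact_mod_cast Nat.div_le_self n 2
  have h5 : x * ((C + 1) / ε * ((n:ℝ) + 1) ^ 3) ≤ C * (n + 1) * growth S n :=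
    (mul_le_mul_of_nonneg_left (hn.trans h3) hx0).trans (h1.trans (by gcongr))
  have h6 : C * ((n:ℝ) + 1) ≤ (C + 1) * ((n:ℝ) + 1) ^ 3 := by
    have : ((n:ℝ) + 1) ≤ ((n:ℝ) + 1) ^ 3 := le_self_pow₀ (by linarith) (by norm_num)
    gcongr
    linarith
  have h7 : x * ((C + 1) / ε * ((n:ℝ) + 1) ^ 3) ≤ (C + 1) * ((n:ℝ) + 1) ^ 3 * growth S n :=
    h5.trans (mul_le_mul_of_nonneg_right h6 hg0)
  have h8 : 0 < (C + 1) * ((n:ℝ) + 1) ^ 3 := by positivity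
  have h9 : x / ε * ((C + 1) * ((n:ℝ) + 1) ^ 3) ≤ growth S n * ((C + 1) * ((n:ℝ) + 1) ^ 3) := by
    calc _ = x * ((C + 1) / ε * ((n:ℝ) + 1) ^ 3) := by ring
      _ ≤ _ := h7
      _ = _ := by ring
  have h10 := le_of_mul_le_mul_right h9 h8
  rw [div_le_iff₀ hε] at h10
  linarith

variable (T) in
include T hS in
/-- Few long elements have only few translates of `[1, f]` along all initial subwords. -/
lemma exists_eventually_light_le {ε : ℝ} (hε : 0 < ε) : ∃ η : ℝ, 0 < η ∧
    ∀ᶠ n : ℕ in Filter.atTop, ({g | wordLength S g ≤ n ∧ n / 2 < wordLength S g ∧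
      ∀ u v, u * v = g → wordLength S u + wordLength S v = wordLength S g →
        ({h | T.On (T.c0 + 2 * H.δ) h 1 u}.ncard : ℝ) ≤ η * n}.ncard : ℝ) ≤ ε * growth S n := by
  obtain ⟨L, C, hC0, hC⟩ := T.exists_ncard_pairs_le hS
  have hL : (0:ℝ) < growth S L := by exact_mod_cast growth_pos hS L
  set η := ε / (36 * growth S L) with hη
  have hη0 : 0 < η := by positivity
  refine ⟨η, hη0, ?_⟩
  obtain ⟨N, hN⟩ := exists_nat_ge (C / η)
  filter_upwards [Filter.eventually_ge_atTop N, Filter.eventually_gt_atTop 0] with n hnN hn0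
  set A := {g | wordLength S g ≤ n ∧ n / 2 < wordLength S g ∧
      ∀ u v, u * v = g → wordLength S u + wordLength S v = wordLength S g →
        ({h | T.On (T.c0 + 2 * H.δ) h 1 u}.ncard : ℝ) ≤ η * n} with hA
  obtain ⟨hfin, hle⟩ := hC n (η * n) (by positivity)
  choose γ hγ0 hγ1 hγ using fun g => exists_geodesic_word hS g
  have hlen : ∀ g i, i ≤ wordLength S g → wordLength S (γ g i) = i ∧
      wordLength S ((γ g i)⁻¹ * g) = wordLength S g - i := by
    intro g i hi
    have h1 := hγ g 0 i (Nat.zero_le _) hi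
    rw [hγ0, wordDist_one] at h1
    have h2 := hγ g i _ hi le_rfl
    rw [hγ1] at h2
    exact ⟨h1, h2⟩
  have h1 : ((A ×ˢ (↑(Finset.range (n / 2 + 1)) : Set ℕ)).ncard : ℝ) ≤
      9 * (η * n + C) * growth S (n + L) := by
    refine le_trans (Nat.cast_le.2 ?_) hle
    refine Set.ncard_le_ncard_of_injOn (fun p => (γ p.1 p.2, (γ p.1 p.2)⁻¹ * p.1)) ?_ ?_ hfin
    · rintro ⟨g, i⟩ ⟨⟨hg1, hg2, hg3⟩, hi⟩
      have hi' : i < n / 2 + 1 := Finset.mem_range.1 hi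
      simp only at hg1 hg2 hg3
      obtain ⟨e1, e2⟩ := hlen g i (by omega)
      have e3 : wordLength S (γ g i) + wordLength S ((γ g i)⁻¹ * g) = wordLength S g := by omega
      exact ⟨e3.le.trans hg1, hg3 _ _ (mul_inv_cancel_left _ _) e3⟩
    · rintro ⟨g, i⟩ ⟨⟨hg1, hg2, hg3⟩, hi⟩ ⟨g', i'⟩ ⟨⟨hg1', hg2', hg3'⟩, hi'⟩ heq
      simp only at hg1 hg2 hg1' hg2'
      have hi2 : i < n / 2 + 1 := Finset.mem_range.1 hi
      have hi2' : i' < n / 2 + 1 := Finset.mem_range.1 hi'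
      obtain ⟨e1, -⟩ := hlen g i (by omega)
      obtain ⟨e1', -⟩ := hlen g' i' (by omega)
      simp only [Prod.mk.injEq] at heq ⊢
      obtain ⟨e3, e4⟩ := heq
      refine ⟨?_, ?_⟩
      · rw [e3] at e4; exact mul_left_cancel e4
      · rw [e3] at e1; omega
  rw [Set.ncard_prod, Set.ncard_coe_finset, Finset.card_range, Nat.cast_mul] at h1
  have h2 : (growth S (n + L) : ℝ) ≤ growth S n * growth S L := by
    exact_mod_cast growth_add_le hS n L
  have h3 : C ≤ η * n := by
    have : C / η ≤ n := hN.trans (by exact_mod_cast hnN)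
    rw [div_le_iff₀ hη0] at this; linarith
  have h4 : (n:ℝ) / 2 ≤ ((n / 2 + 1 : ℕ) : ℝ) := by
    have : n ≤ 2 * (n / 2 + 1) := by omega
    have : (n:ℝ) ≤ 2 * ((n / 2 + 1 : ℕ) : ℝ) := by exact_mod_cast this
    linarith
  have hA0 : (0:ℝ) ≤ A.ncard := Nat.cast_nonneg _
  have hn0' : (0:ℝ) < n := by exact_mod_cast hn0
  have h5 : (A.ncard : ℝ) * (n / 2) ≤ 9 * (η * n + η * n) * (growth S n * growth S L) :=
    (mul_le_mul_of_nonneg_left h4 hA0).trans (h1.trans (by gcongr))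
  have h6 : 9 * (η * n + η * n) * ((growth S n : ℝ) * growth S L) =
      (ε * growth S n) * (n / 2) := by
    rw [hη]; field_simp; ring
  rw [h6] at h5
  exact le_of_mul_le_mul_right h5 (by positivity)

end Setup
end HypMetric

end

section

namespace HypMetric
namespace Setup

variable {G : Type*} [Group G] {H : HypMetric G} {T : H.Setup}
variable {S : Finset G} (hS : Subgroup.closure (S : Set G) = ⊤)

/-- Translates of `[1, f]` on the way from `a` to `u` lie, up to a bounded number, either on the
way from `a` to `g` or on the way from `g` to `u`. -/
lemma On.split {c : ℝ} {h a u : G} (hc : T.On c h a u) (g : G) :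
    T.On (c + H.δ) h a g ∨ T.On (c + H.δ) h g u ∨
      (H.gp g u a - (c + 2 * H.δ + H.D 1 T.f) ≤ H.D a h ∧
        H.D a h ≤ H.gp g u a + (c + 2 * H.δ + H.D 1 T.f)) := by
  have hδ := H.δ_pos
  have hf := H.nonneg 1 T.f
  have h1 := H.tri a h (h * T.f)
  have h2 := H.tri a (h * T.f) h
  rw [H.symm (h * T.f) h, H.D_mul_right] at h2
  rw [H.D_mul_right] at h1
  by_cases h3 : H.gp g u a - (c + 2 * H.δ + H.D 1 T.f) ≤ H.D a h
  · by_cases h4 : H.D a h ≤ H.gp g u a + (c + 2 * H.δ + H.D 1 T.f)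
    · exact Or.inr (Or.inr ⟨h3, h4⟩)
    · exact Or.inr (Or.inl ⟨H.transfer_far hc.1 (by linarith), H.transfer_far hc.2 (by linarith)⟩)
  · exact Or.inl ⟨H.transfer hc.1 (by linarith), H.transfer hc.2 (by linarith)⟩

include hS

lemma exists_geodesic_steps (g : G) : ∃ γ : ℕ → G, γ 0 = 1 ∧ γ (wordLength S g) = g ∧
    (∀ i j, i ≤ j → j ≤ wordLength S g → wordDist S (γ i) (γ j) = j - i) ∧
    ∀ i < wordLength S g, wordDist S (γ i) (γ (i + 1)) ≤ 1 := by
  obtain ⟨γ, h0, h1, h2⟩ := exists_geodesic_word hS g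
  refine ⟨γ, h0, h1, h2, fun i hi => ?_⟩
  rw [h2 i (i + 1) (Nat.le_succ i) hi]
  omega

lemma ncard_wordDist_le (u : G) (n : ℕ) : {h | wordDist S u h ≤ n}.Finite ∧
    ({h | wordDist S u h ≤ n}.ncard : ℝ) ≤ growth S n := by
  have e : {h | wordDist S u h ≤ n} = (fun x => u * x) '' wordBall S n := by
    ext h
    constructor
    · intro hh
      exact ⟨u⁻¹ * h, hh, by simp⟩
    · rintro ⟨x, hx, rfl⟩
      show wordLength S (u⁻¹ * (u * x)) ≤ n
      rw [inv_mul_cancel_left]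
      exact hx
  rw [e]
  exact ⟨(wordBall_finite hS n).image _, Nat.cast_le.2 (Set.ncard_image_le (wordBall_finite hS n))⟩

variable (T) in
include T in
/-- A word-geodesic which passes near many translates of `[1, f]` at an intermediate point
still sees a positive proportion of them at its endpoint. -/
lemma eventually_prefix {η : ℝ} (hη : 0 < η) : ∀ᶠ n : ℕ in Filter.atTop, ∀ u v : G,
    wordLength S u + wordLength S v = wordLength S (u * v) → wordLength S (u * v) ≤ n →
    η * n < {h | T.On (T.c0 + 2 * H.δ) h 1 u}.ncard →
    η / 4 * n ≤ {h | T.On (T.c0 + 3 * H.δ) h 1 (u * v)}.ncard := by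
  have hδ := H.δ_pos
  have hc0 := T.c0_nonneg
  have hf := H.nonneg 1 T.f
  have hM := T.M_nonneg
  obtain ⟨D0, hD0⟩ := exists_efficient (T := T) hS (c := T.c0 + 3 * H.δ) (by linarith)
    (by linarith) 1 (θ := η / 8) (by positivity)
  obtain ⟨C, hC⟩ := hD0 0
  set R := T.c0 + 2 * H.δ + 2 * H.δ + H.D 1 T.f with hR
  set K := T.M * (2 * R + 1) + (2 * C + growth S (3 * D0)) with hK
  obtain ⟨N, hN⟩ := exists_nat_ge (2 * K / η)
  filter_upwards [Filter.eventually_ge_atTop N] with n hn u v huv hgn hbig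
  set g := u * v with hg
  have hcc : T.c0 + 2 * H.δ + H.δ = T.c0 + 3 * H.δ := by ring
  obtain ⟨γ, γ0, γ1, γd, γs⟩ := exists_geodesic_steps hS u
  obtain ⟨γ', γ0', γ1', γd', γs'⟩ := exists_geodesic_steps hS v
  obtain ⟨τ, -, hτm, hτ⟩ := hC 1 u γ (wordLength S u) (by simp [γ0]) (by simp [γ1]) γs
  obtain ⟨τ', -, hτm', hτ'⟩ := hC u g (fun i => u * γ' i) (wordLength S v) (by simp [γ0'])
    (by simp [γ1', hg]) (fun i hi => by rw [wordDist_left]; exact γs' i hi)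
  have hub : (wordLength S u : ℝ) ≤ n := by exact_mod_cast (by omega : wordLength S u ≤ n)
  have hvb : (wordLength S v : ℝ) ≤ n := by exact_mod_cast (by omega : wordLength S v ≤ n)
  have hη8 : 0 < η / 8 := by positivity
  -- the translates on both sides of `u`
  have hF := (finite_and_ncard_le_add (A := {h | T.On (T.c0 + 3 * H.δ) h 1 u ∧
      T.On (T.c0 + 3 * H.δ) h u g})
    (finite_and_ncard_le_add (A := {h | T.On (T.c0 + 3 * H.δ) h 1 u ∧
      D0 < wordDist S (γ (τ (H.D 1 h))) h} ∪ {h | T.On (T.c0 + 3 * H.δ) h u g ∧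
      D0 < wordDist S (u * γ' (τ' (H.D u h))) h})
      ⟨(On_finite (T := T) (c := T.c0 + 3 * H.δ) (by linarith) 1 u).subset fun h hh => hh.1, hτ⟩
      ⟨(On_finite (T := T) (c := T.c0 + 3 * H.δ) (by linarith) u g).subset fun h hh => hh.1, hτ'⟩
      (fun h hh => hh))
    (ncard_wordDist_le hS u (3 * D0)) (by
      rintro h ⟨h1, h2⟩
      by_cases h3 : D0 < wordDist S (γ (τ (H.D 1 h))) h
      · exact Or.inl (Or.inl ⟨h1, h3⟩)
      by_cases h4 : D0 < wordDist S (u * γ' (τ' (H.D u h))) h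
      · exact Or.inl (Or.inr ⟨h2, h4⟩)
      right
      have ht := hτm (H.D 1 h)
      have hs := hτm' (H.D u h)
      set t := τ (H.D 1 h)
      set s := τ' (H.D u h)
      have e1 := γd 0 t (Nat.zero_le _) ht
      have e2 := γd t _ ht le_rfl
      have e3 := γd' s _ hs le_rfl
      rw [γ0] at e1
      rw [γ1] at e2
      rw [γ1', ← wordDist_left u, ← hg] at e3
      have e4 := wordDist_tri hS 1 (γ t) g
      have e5 := wordDist_tri hS (γ t) h g
      have e6 := wordDist_tri hS h (u * γ' s) g
      have e7 := wordDist_symm hS h (u * γ' s)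
      rw [wordDist_one] at e4
      have e8 := wordDist_tri hS u (γ t) h
      have e9 := wordDist_symm hS u (γ t)
      show wordDist S u h ≤ 3 * D0
      omega)).2
  have hall := (finite_and_ncard_le_add (A := {h | T.On (T.c0 + 2 * H.δ) h 1 u})
    (B := {h | T.On (T.c0 + 3 * H.δ) h 1 g} ∪ {h | T.On (T.c0 + 3 * H.δ) h 1 u ∧
      T.On (T.c0 + 3 * H.δ) h u g})
    (finite_and_ncard_le_add
      ⟨On_finite (T := T) (c := T.c0 + 3 * H.δ) (by linarith) 1 g, le_rfl⟩
      ⟨(On_finite (T := T) (c := T.c0 + 3 * H.δ) (by linarith) 1 u).subset fun h hh => hh.1, hF⟩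
      (fun h hh => hh))
    (window (T := T) (c := T.c0 + 2 * H.δ) (by linarith) 1 u
      (show H.gp g u 1 - R ≤ H.gp g u 1 + R by linarith)) (by
      intro h hh
      rcases hh.split g with h1 | h1 | h1
      · rw [hcc] at h1; exact Or.inl (Or.inl h1)
      · rw [hcc] at h1
        exact Or.inl (Or.inr ⟨On.mono (by linarith) hh, h1.symm⟩)
      · exact Or.inr ⟨hh, h1⟩)).2
  have e1 : T.M * (H.gp g u 1 + R - (H.gp g u 1 - R) + 1) = T.M * (2 * R + 1) := by ring
  rw [e1] at hall
  have e2 : η / 8 * wordLength S u ≤ η / 8 * n := by gcongr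
  have e3 : η / 8 * wordLength S v ≤ η / 8 * n := by gcongr
  have e4 : 2 * K ≤ η * n := by
    have : 2 * K / η ≤ n := hN.trans (by exact_mod_cast hn)
    rw [div_le_iff₀ hη] at this; linarith
  linarith

end Setup
end HypMetric

end

section

namespace HypMetric

variable {G : Type*} [Group G] {H : HypMetric G}

lemma natCast_le_D_pow {g : G} {r : ℝ} (h : H.gp g⁻¹ g 1 ≤ r)
    (hl : 2 * r + 4 * H.δ + 1 ≤ H.D 1 g) (k : ℕ) : (k : ℝ) ≤ H.D 1 (g ^ k) := by
  have hδ := H.δ_pos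
  induction k with
  | zero => simpa using H.nonneg _ _
  | succ k ih =>
    have h1 := H.gp_pow_pow_le h (by linarith) k 1
    rw [pow_one] at h1
    have h2 : H.D 1 (g ^ (k + 1)) = H.D (g ^ k)⁻¹ g := by
      rw [← H.left (g ^ k) (g ^ k)⁻¹ g, mul_inv_cancel, pow_succ]
    have h3 : H.D (g ^ k)⁻¹ 1 = H.D 1 (g ^ k) := by
      rw [H.symm]; exact H.D_one_inv _
    have h4 := H.symm g 1
    unfold gp at h1
    push_cast
    linarith

lemma sub_le_D_zpow {g : G} {r : ℝ} (h : H.gp g⁻¹ g 1 ≤ r)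
    (hl : 2 * r + 4 * H.δ + 1 ≤ H.D 1 g) {i k : ℤ} (hik : i ≤ k) :
    ((k - i : ℤ) : ℝ) ≤ H.D (g ^ i) (g ^ k) := by
  obtain ⟨n, hn⟩ := Int.eq_ofNat_of_zero_le (sub_nonneg.2 hik)
  have h1 := natCast_le_D_pow h hl n
  have h2 : g ^ k = g ^ i * g ^ n := by
    rw [← zpow_natCast, ← zpow_add]; congr 1; omega
  rw [h2, H.D_mul_right, hn]
  exact_mod_cast h1

lemma zpow_injective {g : G} {r : ℝ} (h : H.gp g⁻¹ g 1 ≤ r)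
    (hl : 2 * r + 4 * H.δ + 1 ≤ H.D 1 g) : Function.Injective fun k : ℤ => g ^ k := by
  have key : ∀ i k : ℤ, i < k → g ^ i ≠ g ^ k := by
    intro i k hik he
    have h1 := sub_le_D_zpow h hl hik.le
    rw [he, H.self] at h1
    have : (k - i : ℤ) ≤ 0 := by exact_mod_cast h1
    omega
  intro i k he
  rcases lt_trichotomy i k with h1 | h1 | h1
  · exact absurd he (key i k h1)
  · exact h1
  · exact absurd he.symm (key k i h1)

namespace Setup

variable {T : H.Setup}

/-- A translate of `[1, f]` deep inside `[1, g]` lies, along with its translates by powers of `g`,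
on the way between any two powers of `g` that it separates. -/
lemma On.zpow {c : ℝ} {g h : G} (hc : T.On c h 1 g) (hc0 : 0 ≤ c)
    (h1 : H.gp g⁻¹ g 1 + (c + 6 * H.δ + 1 + H.D 1 T.f) ≤ H.D 1 h)
    (h2 : H.D 1 h + H.gp g⁻¹ g 1 + (c + 6 * H.δ + 1 + H.D 1 T.f) ≤ H.D 1 g)
    {i k j : ℤ} (hik : i ≤ k) (hkj : k < j) : T.On (c + 2 * H.δ) (g ^ k * h) (g ^ i) (g ^ j) := by
  have hδ := H.δ_pos
  have hf := H.nonneg 1 T.f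
  set r := H.gp g⁻¹ g 1 with hr
  have hr0 : 0 ≤ r := H.gp_nonneg _ _ _
  obtain ⟨a, ha⟩ := Int.eq_ofNat_of_zero_le (sub_nonneg.2 hik)
  obtain ⟨b, hb⟩ := Int.eq_ofNat_of_zero_le (show 0 ≤ j - k - 1 by omega)
  have e1 : g ^ i = g ^ k * (g ^ a)⁻¹ := by
    rw [← zpow_natCast, ← zpow_neg, ← zpow_add]; congr 1; omega
  have e2 : g ^ j = g ^ k * (g * g ^ b) := by
    rw [← zpow_natCast, ← zpow_one_add, ← zpow_add]; congr 1; omega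
  rw [e1, e2]
  refine On.left ?_ _
  have h3 := H.gp_pow_pow_le (g := g) (r := r) le_rfl (by linarith) a 1
  have h4 := H.gp_pow_pow_le (g := g) (r := r) le_rfl (by linarith) 1 b
  rw [pow_one] at h3 h4
  have h5 := H.gp_mul_eq g (g ^ b)
  rw [H.gp_comm] at h5
  have h6 := H.tri 1 h (h * T.f)
  have h7 := H.tri 1 (h * T.f) h
  rw [H.symm (h * T.f) h, H.D_mul_right] at h7
  rw [H.D_mul_right] at h6
  exact ⟨H.between (B := c + 4 * H.δ + 1) (by linarith) hc.1 (by linarith) (by linarith),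
    H.between (B := c + 4 * H.δ + 1) (by linarith) hc.2 (by linarith) (by linarith)⟩

variable {S : Finset G} (hS : Subgroup.closure (S : Set G) = ⊤)
include hS

/-- A path with controlled length which stays away from the powers of `g` is short. -/
lemma exists_excursion_bound {c : ℝ} {g h : G} (hc : T.On c h 1 g) (hc0 : 0 ≤ c)
    (hc5 : c ≤ T.c0 + 5 * H.δ)
    (h1 : H.gp g⁻¹ g 1 + (c + 6 * H.δ + 1 + H.D 1 T.f) ≤ H.D 1 h)
    (h2 : H.D 1 h + H.gp g⁻¹ g 1 + (c + 6 * H.δ + 1 + H.D 1 T.f) ≤ H.D 1 g)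
    (Q : ℕ) {lam : ℝ} (hlam : 1 ≤ lam) (C : ℝ) : ∃ (D' : ℕ) (M : ℝ), ∀ (γ : ℕ → G) (m : ℕ)
      (i j : ℤ), i ≤ j → wordDist S (g ^ i) (γ 0) ≤ D' → wordDist S (γ m) (g ^ j) ≤ D' →
      (∀ t < m, wordDist S (γ t) (γ (t + 1)) ≤ Q) →
      (∀ t, 0 < t → t < m → ∀ k : ℤ, D' < wordDist S (γ t) (g ^ k)) →
      (m : ℝ) ≤ lam * (wordDist S (γ 0) (γ m) + C) → (m : ℝ) ≤ M := by
  have hδ := H.δ_pos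
  have hf := H.nonneg 1 T.f
  have hr0 : 0 ≤ H.gp g⁻¹ g 1 := H.gp_nonneg _ _ _
  have hl : 2 * H.gp g⁻¹ g 1 + 4 * H.δ + 1 ≤ H.D 1 g := by linarith
  set w := wordLength S g with hw
  set θ := 1 / (2 * lam * (w + 1)) with hθ
  have hθ0 : 0 < θ := by positivity
  obtain ⟨C1, hC1, hD⟩ := H.exists_D_le hS
  obtain ⟨D0, hD0⟩ := exists_efficient (T := T) hS (c := c + 2 * H.δ) (by linarith)
    (by linarith) Q hθ0
  set D' := D0 + wordLength S h with hD'
  obtain ⟨C2, hC2⟩ := hD0 D'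
  set B := ⌈C1 * (2 * D')⌉₊ with hB
  set J := 2 * (θ * (lam * (2 * D' + C)) + C2 + (B + 1) + (B + 1)) with hJ
  refine ⟨D', lam * (w * J + 2 * D' + C), fun γ m i j hij hi hj hstep hfar hm => ?_⟩
  obtain ⟨τ, -, hτm, hτ⟩ := hC2 (g ^ i) (g ^ j) γ m hi hj hstep
  -- powers of `g` that are close in the word metric have close exponents
  have hclose : ∀ k l : ℤ, k ≤ l → wordDist S (g ^ k) (g ^ l) ≤ 2 * D' → l ≤ k + B := by
    intro k l hkl hd
    have e1 := sub_le_D_zpow (H := H) le_rfl hl hkl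
    have e2 : C1 * wordDist S (g ^ k) (g ^ l) ≤ C1 * (2 * D') := by
      have : (wordDist S (g ^ k) (g ^ l) : ℝ) ≤ 2 * D' := by exact_mod_cast hd
      gcongr
    have e3 := Nat.le_ceil (C1 * (2 * D'))
    have e4 : ((l - k : ℤ) : ℝ) ≤ (B : ℕ) := e1.trans ((hD _ _).trans (e2.trans e3))
    have e5 : (l - k : ℤ) ≤ (B : ℤ) := by exact_mod_cast e4
    omega
  have hX : ({x | T.On (c + 2 * H.δ) x (g ^ i) (g ^ j) ∧
      D0 < wordDist S (γ (τ (H.D (g ^ i) x))) x}).Finite :=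
    (On_finite (T := T) (c := c + 2 * H.δ) (by linarith) (g ^ i) (g ^ j)).subset fun x hx => hx.1
  have hinj : Function.Injective fun k : ℤ => g ^ k * h := fun k l hkl =>
    zpow_injective (H := H) le_rfl hl (mul_right_cancel (show g ^ k * h = g ^ l * h from hkl))
  have hE : {k : ℤ | g ^ k * h ∈ {x | T.On (c + 2 * H.δ) x (g ^ i) (g ^ j) ∧
      D0 < wordDist S (γ (τ (H.D (g ^ i) x))) x}}.Finite :=
    hX.preimage hinj.injOn
  have hE2 : ({k : ℤ | g ^ k * h ∈ {x | T.On (c + 2 * H.δ) x (g ^ i) (g ^ j) ∧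
      D0 < wordDist S (γ (τ (H.D (g ^ i) x))) x}}.ncard : ℝ) ≤ θ * m + C2 :=
    (Nat.cast_le.2 (Set.ncard_le_ncard_of_injOn (fun k : ℤ => g ^ k * h) (fun k hk => hk)
      hinj.injOn hX)).trans hτ
  have hicc : ∀ k : ℤ, (Set.Icc k (k + B)).Finite ∧ ((Set.Icc k (k + B)).ncard : ℝ) ≤ B + 1 := by
    intro k
    refine ⟨Set.finite_Icc _ _, le_of_eq ?_⟩
    rw [← Finset.coe_Icc, Set.ncard_coe_finset, Int.card_Icc,
      show k + B + 1 - k = ((B + 1 : ℕ) : ℤ) by push_cast; ring, Int.toNat_natCast]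
    push_cast; rfl
  have hcount := (finite_and_ncard_le_add (A := Set.Ico i j) (finite_and_ncard_le_add
    (A := {k : ℤ | g ^ k * h ∈ {x | T.On (c + 2 * H.δ) x (g ^ i) (g ^ j) ∧
      D0 < wordDist S (γ (τ (H.D (g ^ i) x))) x}} ∪ Set.Icc i (i + B)) ⟨hE, hE2⟩ (hicc i)
      (fun k hk => hk)) (hicc (j - B)) (by
    rintro k ⟨hk1, hk2⟩
    have hon := hc.zpow hc0 h1 h2 hk1 hk2
    by_cases hex : D0 < wordDist S (γ (τ (H.D (g ^ i) (g ^ k * h)))) (g ^ k * h)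
    · exact Or.inl (Or.inl ⟨hon, hex⟩)
    have htm := hτm (H.D (g ^ i) (g ^ k * h))
    set t := τ (H.D (g ^ i) (g ^ k * h))
    have e1 := wordDist_tri hS (γ t) (g ^ k * h) (g ^ k)
    have e2 : wordDist S (g ^ k * h) (g ^ k) = wordLength S h := by
      rw [wordDist_symm hS, wordDist, inv_mul_cancel_left]
    have e3 : wordDist S (γ t) (g ^ k) ≤ D' := by omega
    rcases Nat.eq_zero_or_pos t with h0 | h0
    · rw [h0] at e3
      have e4 := wordDist_tri hS (g ^ i) (γ 0) (g ^ k)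
      exact Or.inl (Or.inr ⟨hk1, hclose i k hk1 (by omega)⟩)
    rcases htm.lt_or_eq with h0' | h0'
    · exact absurd e3 (by have := hfar t h0 h0' k; omega)
    · rw [h0'] at e3
      have e4 := wordDist_tri hS (g ^ k) (γ m) (g ^ j)
      rw [wordDist_symm hS (g ^ k) (γ m)] at e4
      have := hclose k j hk2.le (by omega)
      exact Or.inr ⟨by omega, by omega⟩)).2
  rw [← Finset.coe_Ico, Set.ncard_coe_finset, Int.card_Ico] at hcount
  obtain ⟨n, hn⟩ := Int.eq_ofNat_of_zero_le (sub_nonneg.2 hij)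
  rw [hn] at hcount
  have hcount' : (n:ℝ) ≤ θ * m + C2 + (B + 1) + (B + 1) := by exact_mod_cast hcount
  have hpow : ∀ n : ℕ, wordLength S (g ^ n) ≤ w * n := by
    intro n
    induction n with
    | zero => simp
    | succ n ih =>
      have := wordLength_mul_le hS (g ^ n) g
      rw [pow_succ, Nat.mul_succ]; omega
  have hdist : wordDist S (γ 0) (γ m) ≤ w * n + 2 * D' := by
    have e1 := wordDist_tri hS (γ 0) (g ^ i) (γ m)
    have e2 := wordDist_tri hS (g ^ i) (g ^ j) (γ m)
    have e3 : wordDist S (g ^ i) (g ^ j) = wordLength S (g ^ n) := by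
      rw [wordDist, ← zpow_neg, ← zpow_add, ← zpow_natCast]
      congr 2; omega
    have e4 := hpow n
    have e5 := wordDist_symm hS (γ 0) (g ^ i)
    have e6 := wordDist_symm hS (g ^ j) (γ m)
    omega
  have hdist' : (wordDist S (γ 0) (γ m) : ℝ) ≤ w * n + 2 * D' := by exact_mod_cast hdist
  have hm2 : (m:ℝ) ≤ lam * (w * n + 2 * D' + C) :=
    hm.trans (mul_le_mul_of_nonneg_left (by linarith) (by linarith))
  have hθw : θ * (lam * (w * n)) ≤ n / 2 := by
    have e1 : θ * (lam * (w * n)) = (w / (w + 1)) * (n / 2) := by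
      rw [hθ]; field_simp
    rw [e1]
    refine mul_le_of_le_one_left (by positivity) ?_
    rw [div_le_one (by positivity)]
    linarith
  have hnJ : (n:ℝ) ≤ J := by
    have : θ * m ≤ θ * (lam * (w * n + 2 * D' + C)) := mul_le_mul_of_nonneg_left hm2 hθ0.le
    have e : θ * (lam * (w * n + 2 * D' + C)) =
      θ * (lam * (w * n)) + θ * (lam * (2 * D' + C)) := by ring
    rw [hJ]
    linarith
  refine hm2.trans ?_
  gcongr

/-- The Morse criterion: an element with a translate of `[1, f]` deep inside its axis is Morse. -/
lemma isMorse_of_On {c : ℝ} {g h : G} (hc : T.On c h 1 g) (hc0 : 0 ≤ c)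
    (hc5 : c ≤ T.c0 + 5 * H.δ)
    (h1 : H.gp g⁻¹ g 1 + (c + 6 * H.δ + 1 + H.D 1 T.f) ≤ H.D 1 h)
    (h2 : H.D 1 h + H.gp g⁻¹ g 1 + (c + 6 * H.δ + 1 + H.D 1 T.f) ≤ H.D 1 g) : IsMorse S g := by
  have hδ := H.δ_pos
  have hf := H.nonneg 1 T.f
  have hr0 : 0 ≤ H.gp g⁻¹ g 1 := H.gp_nonneg _ _ _
  have hl : 2 * H.gp g⁻¹ g 1 + 4 * H.δ + 1 ≤ H.D 1 g := by linarith
  constructor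
  · intro R
    obtain ⟨C1, hC1, hD⟩ := H.exists_D_le hS
    obtain ⟨n, hn⟩ := exists_nat_gt (C1 * R)
    refine ⟨n, ?_⟩
    rw [zpow_natCast]
    have e1 := natCast_le_D_pow (H := H) le_rfl hl n
    have e2 := hD 1 (g ^ n)
    rw [wordDist_one] at e2
    have e3 : C1 * R < C1 * wordLength S (g ^ n) := by linarith
    exact_mod_cast lt_of_mul_lt_mul_left e3 (by linarith)
  · intro lam C hlam _
    obtain ⟨D', M, hM⟩ := exists_excursion_bound hS hc hc0 hc5 h1 h2 ⌈lam + C⌉₊ hlam C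
    refine ⟨max 0 (lam * M + C + D'), le_max_left _ _, ?_⟩
    rintro a b q hab hq ⟨ia, hia⟩ ⟨jb, hjb⟩ s ⟨has, hsb⟩
    obtain ⟨s1, ⟨h1a, h1s, i, hi⟩, hs1⟩ := Int.exists_greatest_of_bdd
      (P := fun t => a ≤ t ∧ t ≤ s ∧ ∃ k : ℤ, wordDist S (q t) (g ^ k) ≤ D')
      ⟨s, fun z hz => hz.2.1⟩ ⟨a, le_rfl, has, ia, by simp [hia]⟩
    obtain ⟨s2, ⟨h2b, h2s, j, hj⟩, hs2⟩ := Int.exists_least_of_bdd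
      (P := fun t => t ≤ b ∧ s ≤ t ∧ ∃ k : ℤ, wordDist S (q t) (g ^ k) ≤ D')
      ⟨s, fun z hz => hz.2.1⟩ ⟨b, le_rfl, hsb, jb, by simp [hjb]⟩
    obtain ⟨m, hm⟩ := Int.eq_ofNat_of_zero_le (show 0 ≤ s2 - s1 by omega)
    have hstep : ∀ t : ℤ, s1 ≤ t → t + 1 ≤ s2 → wordDist S (q t) (q (t + 1)) ≤ ⌈lam + C⌉₊ := by
      intro t ht1 ht2
      have := (hq t ⟨by omega, by omega⟩ (t + 1) ⟨by omega, by omega⟩).2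
      rw [show |t - (t + 1)| = 1 by simp] at this
      have h3 : (wordDist S (q t) (q (t + 1)) : ℝ) ≤ lam + C := by simpa using this
      exact_mod_cast h3.trans (Nat.le_ceil _)
    have hfar : ∀ t : ℤ, s1 < t → t < s2 → ∀ k : ℤ, D' < wordDist S (q t) (g ^ k) := by
      intro t ht1 ht2 k
      by_contra hcon
      push Not at hcon
      rcases le_total t s with h3 | h3
      · have := hs1 t ⟨by omega, h3, k, hcon⟩
        omega
      · have := hs2 t ⟨by omega, h3, k, hcon⟩
        omega
    have hmlen : (m : ℝ) ≤ lam * (wordDist S (q s1) (q s2) + C) := by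
      have h3 := (hq s1 ⟨by omega, by omega⟩ s2 ⟨by omega, by omega⟩).1
      rw [show |s1 - s2| = (m : ℤ) by rw [abs_sub_comm, hm]; simp] at h3
      have h4 : (m : ℝ) / lam ≤ wordDist S (q s1) (q s2) + C := by
        have : ((m : ℤ) : ℝ) = m := by simp
        rw [this] at h3; linarith
      rw [div_le_iff₀ (by linarith)] at h4
      linarith
    have hmM : (m : ℝ) ≤ M := by
      rcases le_total i j with hij | hij
      · refine hM (fun t => q (s1 + t)) m i j hij ?_ ?_ (fun t ht => ?_) (fun t ht0 ht => ?_) ?_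
        · simpa [wordDist_symm hS (g ^ i)] using hi
        · rwa [show s1 + (m : ℤ) = s2 by omega]
        · have := hstep (s1 + t) (by omega) (by omega)
          rwa [add_assoc] at this
        · exact hfar _ (by omega) (by omega)
        · rw [show s1 + (m : ℤ) = s2 by omega]
          simpa using hmlen
      · refine hM (fun t => q (s2 - t)) m j i hij ?_ ?_ (fun t ht => ?_) (fun t ht0 ht => ?_) ?_
        · simpa [wordDist_symm hS (g ^ j)] using hj
        · rwa [show s2 - (m : ℤ) = s1 by omega]
        · have := hstep (s2 - (t + 1)) (by omega) (by omega)
          rw [wordDist_symm hS, show s2 - ((t:ℤ) + 1) + 1 = s2 - t by ring] at this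
          exact_mod_cast this
        · exact hfar _ (by omega) (by omega)
        · rw [show s2 - (m : ℤ) = s1 by omega, wordDist_symm hS]
          simpa using hmlen
    refine ⟨i, le_trans ?_ (le_max_right _ _)⟩
    have h3 := (hq s ⟨has, hsb⟩ s1 ⟨h1a, by omega⟩).2
    have h4 : ((|s - s1| : ℤ) : ℝ) ≤ m := by
      have : |s - s1| ≤ (m : ℤ) := by rw [abs_of_nonneg (by omega)]; omega
      exact_mod_cast this
    have h5 : (wordDist S (q s) (g ^ i) : ℝ) ≤ wordDist S (q s) (q s1) + wordDist S (q s1) (g ^ i) := by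
      exact_mod_cast wordDist_tri hS (q s) (q s1) (g ^ i)
    have h6 : (wordDist S (q s1) (g ^ i) : ℝ) ≤ D' := by exact_mod_cast hi
    have h7 : lam * ((|s - s1| : ℤ) : ℝ) ≤ lam * M := by
      refine mul_le_mul_of_nonneg_left (h4.trans hmM) (by linarith)
    linarith

end Setup
end HypMetric

end

section

variable {G : Type*} [Group G] {S : Finset G}

lemma IsMorse.of_inv {g : G} (h : IsMorse S g⁻¹) : IsMorse S g := by
  refine ⟨fun R => ?_, fun lam C hlam hC => ?_⟩
  · obtain ⟨i, hi⟩ := h.1 R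
    exact ⟨-i, by rwa [zpow_neg, ← inv_zpow]⟩
  · obtain ⟨N, hN, h2⟩ := h.2 lam C hlam hC
    refine ⟨N, hN, fun a b q hab hq ⟨i, hi⟩ ⟨j, hj⟩ s hs => ?_⟩
    obtain ⟨k, hk⟩ := h2 a b q hab hq ⟨-i, by rw [hi]; simp⟩ ⟨-j, by rw [hj]; simp⟩ s hs
    exact ⟨-k, by rwa [zpow_neg, ← inv_zpow]⟩

variable (S) in
/-- A word-geodesic decomposition of `g` whose first and last pieces almost cancel, with first
piece of length at least `x`. -/
def AlmostConj (E : ℕ) (x : ℝ) (g : G) : Prop := ∃ v₁ v₂ v₃ : G, v₁ * v₂ * v₃ = g ∧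
  wordLength S v₁ + wordLength S v₂ + wordLength S v₃ = wordLength S g ∧
  wordLength S (v₃ * v₁) ≤ E ∧ x ≤ wordLength S v₁

variable (hS : Subgroup.closure (S : Set G) = ⊤)
include hS

lemma AlmostConj.inv {E : ℕ} {x : ℝ} {g : G} (h : AlmostConj S E x g) :
    AlmostConj S E (x - E) g⁻¹ := by
  obtain ⟨v₁, v₂, v₃, h1, h2, h3, h4⟩ := h
  refine ⟨v₃⁻¹, v₂⁻¹, v₁⁻¹, by rw [← h1]; group, ?_, ?_, ?_⟩
  · simp only [wordLength_inv hS]; omega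
  · rwa [← mul_inv_rev, wordLength_inv hS]
  · rw [wordLength_inv hS]
    have h5 := wordLength_mul_le hS v₃⁻¹ (v₃ * v₁)
    rw [inv_mul_cancel_left, wordLength_inv hS] at h5
    have h6 : (wordLength S v₁ : ℝ) ≤ wordLength S v₃ + E := by
      exact_mod_cast (by omega : wordLength S v₁ ≤ wordLength S v₃ + E)
    linarith

namespace HypMetric
namespace Setup

variable {H : HypMetric G} {T : H.Setup}

variable (T) in
include T in
lemma exists_almostConj_of_lower_half {η : ℝ} (hη : 0 < η) : ∃ (E : ℕ) (κ : ℝ), 0 < κ ∧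
    ∀ᶠ n : ℕ in Filter.atTop, ∀ g : G, wordLength S g ≤ n → ¬ IsMorse S g →
    η * n ≤ {h | T.On (T.c0 + 3 * H.δ) h 1 g ∧ H.D 1 h ≤ H.D 1 g / 2}.ncard →
    AlmostConj S E (κ * n) g := by
  have hδ := H.δ_pos
  have hc0 := T.c0_nonneg
  have hf := H.nonneg 1 T.f
  have hM := T.M_nonneg
  obtain ⟨C1, hC1, hD⟩ := H.exists_D_le hS
  set c := T.c0 + 3 * H.δ with hc
  obtain ⟨D0, hD0⟩ := exists_efficient (T := T) hS (c := c + H.δ) (by linarith)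
    (by linarith) 1 (θ := η / 8) (by positivity)
  obtain ⟨C, hC⟩ := hD0 0
  set R := c + 6 * H.δ + 1 + H.D 1 T.f with hR
  set κ := η / (8 * (T.M + 1)) with hκ
  have hκ0 : 0 < κ := by positivity
  have hMκ : T.M * κ ≤ η / 8 := by
    rw [hκ, mul_div_assoc', div_le_div_iff₀ (by positivity) (by norm_num)]
    nlinarith
  set K := T.M * (0 + 1) + T.M * (2 * R + 1) + 2 * C with hK
  obtain ⟨N, hN⟩ := exists_nat_gt (2 * K / η)
  obtain ⟨N', hN'⟩ := exists_nat_ge (2 * C1 * D0 / κ)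
  refine ⟨2 * D0, κ / (2 * C1), by positivity, ?_⟩
  filter_upwards [Filter.eventually_ge_atTop N, Filter.eventually_ge_atTop N',
    Filter.eventually_gt_atTop 0] with n hn hn' hn0 g hgn hg hbig
  have hn0' : (0:ℝ) < n := by exact_mod_cast hn0
  have hgn' : (wordLength S g : ℝ) ≤ n := by exact_mod_cast hgn
  set r := H.gp g⁻¹ g 1 with hr
  obtain ⟨γ, γ0, γ1, γd, γs⟩ := exists_geodesic_steps hS g
  obtain ⟨τ, hτmono, hτm, hτ⟩ := hC 1 g γ (wordLength S g) (by simp [γ0]) (by simp [γ1]) γs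
  set X := {h | T.On (c + H.δ) h 1 g ∧ D0 < wordDist S (γ (τ (H.D 1 h))) h} with hX
  have hXfin : X.Finite :=
    (On_finite (T := T) (c := c + H.δ) (by linarith) 1 g).subset fun h hh => hh.1
  have hinj : Function.Injective fun h : G => g * h := mul_right_injective g
  have hY : {h | g * h ∈ X}.Finite ∧ ({h | g * h ∈ X}.ncard : ℝ) ≤
      η / 8 * wordLength S g + C := by
    refine ⟨hXfin.preimage hinj.injOn, le_trans ?_ hτ⟩
    exact_mod_cast Set.ncard_le_ncard_of_injOn (fun h : G => g * h) (fun k hk => hk)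
      hinj.injOn hXfin
  obtain ⟨h, hon, hhalf, hκn, hwin, hx1, hx2⟩ : ∃ h, T.On c h 1 g ∧ H.D 1 h ≤ H.D 1 g / 2 ∧
      κ * n < H.D 1 h ∧ ¬ (r - R ≤ H.D 1 h ∧ H.D 1 h ≤ r + R) ∧ h ∉ X ∧ g * h ∉ X := by
    by_contra! hcon
    have hall := (finite_and_ncard_le_add
      (A := {h | T.On c h 1 g ∧ H.D 1 h ≤ H.D 1 g / 2})
      (finite_and_ncard_le_add
        (A := {h | T.On c h 1 g ∧ 0 ≤ H.D 1 h ∧ H.D 1 h ≤ κ * n} ∪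
          {h | T.On c h 1 g ∧ r - R ≤ H.D 1 h ∧ H.D 1 h ≤ r + R})
        (window (T := T) (c := c) (by linarith) 1 g (by positivity))
        (window (T := T) (c := c) (by linarith) 1 g (by linarith)) (fun h hh => hh))
      (finite_and_ncard_le_add (A := X ∪ {h | g * h ∈ X}) ⟨hXfin, hτ⟩ hY (fun h hh => hh))
      (by
        rintro h ⟨h1, h2⟩
        by_cases h3 : κ * n < H.D 1 h
        · by_cases h4 : r - R ≤ H.D 1 h ∧ H.D 1 h ≤ r + R
          · exact Or.inl (Or.inr ⟨h1, h4⟩)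
          · by_cases h5 : h ∈ X
            · exact Or.inr (Or.inl h5)
            · exact Or.inr (Or.inr (hcon h h1 h2 h3 (fun h6 => by
                by_contra h7; exact h4 ⟨h6, not_lt.1 h7⟩) h5))
        · exact Or.inl (Or.inl ⟨h1, H.nonneg _ _, not_lt.1 h3⟩))).2
    have e1 : η / 8 * wordLength S g ≤ η / 8 * n := by gcongr
    have e2 : T.M * κ * n ≤ η / 8 * n := by gcongr
    have e3 : 2 * K < η * n := by
      have : 2 * K / η < n := hN.trans_le (by exact_mod_cast hn)
      rw [div_lt_iff₀ hη] at this; linarith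
    have e4 : T.M * (κ * n - 0 + 1) + T.M * (r + R - (r - R) + 1) =
      T.M * κ * n + (T.M * (0 + 1) + T.M * (2 * R + 1)) := by ring
    have e5 : 0 < η * n := by positivity
    linarith
  have hlow : H.D 1 h < r - R := by
    by_contra hcon
    refine hg (isMorse_of_On hS hon (by linarith) (by linarith) (h := h) ?_ ?_)
    · by_contra hc2
      exact hwin ⟨not_lt.1 hcon, by linarith⟩
    · by_contra hc2
      exact hwin ⟨not_lt.1 hcon, by linarith⟩
  have hon' : T.On (c + H.δ) (g * h) 1 g := by
    refine On.symm ?_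
    have e1 := H.tri 1 h (h * T.f)
    rw [H.D_mul_right] at e1
    have : T.On (c + H.δ) h 1 g⁻¹ :=
      ⟨H.transfer hon.1 (by linarith), H.transfer hon.2 (by linarith)⟩
    simpa using this.left g
  have hD1 : H.D 1 h ≤ H.D 1 (g * h) := by
    have e1 := H.tri 1 h g⁻¹
    have e2 := H.left g h g⁻¹
    rw [mul_inv_cancel, H.symm] at e2
    rw [H.D_one_inv] at e1
    linarith
  have hts := hτmono hD1
  have hsm := hτm (H.D 1 (g * h))
  have h1 : wordDist S (γ (τ (H.D 1 h))) h ≤ D0 := by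
    by_contra hcon; exact hx1 ⟨hon.mono (by linarith), not_le.1 hcon⟩
  have h2 : wordDist S (γ (τ (H.D 1 (g * h)))) (g * h) ≤ D0 := by
    by_contra hcon; exact hx2 ⟨hon', not_le.1 hcon⟩
  set t := τ (H.D 1 h)
  set s := τ (H.D 1 (g * h))
  have d1 := γd 0 t (Nat.zero_le _) (hts.trans hsm)
  have d2 := γd t s hts hsm
  have d3 := γd s _ hsm le_rfl
  rw [γ0, wordDist_one] at d1
  rw [γ1] at d3
  refine ⟨γ t, (γ t)⁻¹ * γ s, (γ s)⁻¹ * g, by group, ?_, ?_, ?_⟩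
  · rw [← wordDist, ← wordDist]; omega
  · rw [mul_assoc, ← wordDist]
    have e1 := wordDist_tri hS (γ s) (g * h) (g * γ t)
    rw [wordDist_left, wordDist_symm hS h] at e1
    omega
  · have e1 := hD 1 h
    rw [wordDist_one] at e1
    have e2 := wordDist_tri hS 1 (γ t) h
    rw [wordDist_one, wordDist_one] at e2
    have e3 : (wordLength S h : ℝ) ≤ wordLength S (γ t) + D0 := by
      exact_mod_cast (by omega : wordLength S h ≤ wordLength S (γ t) + D0)
    have e4 : 2 * C1 * D0 ≤ κ * n := by
      have : 2 * C1 * D0 / κ ≤ n := hN'.trans (by exact_mod_cast hn')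
      rw [div_le_iff₀ hκ0] at this; linarith
    rw [div_mul_eq_mul_div, div_le_iff₀ (by positivity)]
    have e5 : C1 * wordLength S h ≤ C1 * (wordLength S (γ t) + D0) := by gcongr
    linarith

variable (T) in
include T in
lemma exists_almostConj {η : ℝ} (hη : 0 < η) : ∃ (E : ℕ) (κ : ℝ), 0 < κ ∧
    ∀ᶠ n : ℕ in Filter.atTop, ∀ g : G, wordLength S g ≤ n → ¬ IsMorse S g →
    η * n ≤ {h | T.On (T.c0 + 3 * H.δ) h 1 g}.ncard → AlmostConj S E (κ * n) g := by
  have hδ := H.δ_pos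
  have hc0 := T.c0_nonneg
  have hM := T.M_nonneg
  obtain ⟨E, κ, hκ, hev⟩ := T.exists_almostConj_of_lower_half hS (η := η / 4) (by positivity)
  set c := T.c0 + 3 * H.δ with hc
  obtain ⟨N, hN⟩ := exists_nat_gt (2 * (T.M * (2 * c + 1)) / η)
  obtain ⟨N', hN'⟩ := exists_nat_ge (2 * E / κ)
  refine ⟨E, κ / 2, by positivity, ?_⟩
  filter_upwards [hev, Filter.eventually_ge_atTop N, Filter.eventually_ge_atTop N']
    with n hev hn hn' g hgn hg hbig
  have hn0 : (0:ℝ) ≤ n := Nat.cast_nonneg _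
  have hκn : 0 ≤ κ * n := by positivity
  have e3 : 2 * (T.M * (2 * c + 1)) < η * n := by
    have : 2 * (T.M * (2 * c + 1)) / η < n := hN.trans_le (by exact_mod_cast hn)
    rw [div_lt_iff₀ hη] at this; linarith
  have e4 : 2 * E ≤ κ * n := by
    have : 2 * E / κ ≤ n := hN'.trans (by exact_mod_cast hn')
    rw [div_le_iff₀ hκ] at this; linarith
  by_cases h1 : η / 4 * n ≤ {h | T.On c h 1 g ∧ H.D 1 h ≤ H.D 1 g / 2}.ncard
  · obtain ⟨v₁, v₂, v₃, a1, a2, a3, a4⟩ := hev g hgn hg h1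
    exact ⟨v₁, v₂, v₃, a1, a2, a3, by linarith⟩
  by_cases h2 : η / 4 * n ≤ {h | T.On c h 1 g⁻¹ ∧ H.D 1 h ≤ H.D 1 g⁻¹ / 2}.ncard
  · obtain ⟨v₁, v₂, v₃, a1, a2, a3, a4⟩ := (hev g⁻¹ (by rwa [wordLength_inv hS])
      (fun h => hg h.of_inv) h2).inv hS
    exact ⟨v₁, v₂, v₃, by rw [a1, inv_inv], by rw [a2, inv_inv], a3, by linarith⟩
  exfalso
  have hinj : Function.Injective fun h : G => g⁻¹ * h := mul_right_injective g⁻¹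
  set Y := {h | T.On c h 1 g⁻¹ ∧ H.D 1 h ≤ H.D 1 g⁻¹ / 2} with hYd
  have hYfin : Y.Finite :=
    (On_finite (T := T) (c := c) (by linarith) 1 g⁻¹).subset fun h hh => hh.1
  have hY : {h | g⁻¹ * h ∈ Y}.Finite ∧ ({h | g⁻¹ * h ∈ Y}.ncard : ℝ) ≤ η / 4 * n := by
    refine ⟨hYfin.preimage hinj.injOn, le_trans ?_ (not_le.1 h2).le⟩
    exact_mod_cast Set.ncard_le_ncard_of_injOn (fun h : G => g⁻¹ * h) (fun k hk => hk)
      hinj.injOn hYfin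
  have hall := (finite_and_ncard_le_add (A := {h | T.On c h 1 g})
    (finite_and_ncard_le_add
      (A := {h | T.On c h 1 g ∧ H.D 1 h ≤ H.D 1 g / 2} ∪ {h | g⁻¹ * h ∈ Y})
      ⟨(On_finite (T := T) (c := c) (by linarith) 1 g).subset fun h hh => hh.1,
        (not_le.1 h1).le⟩ hY (fun h hh => hh))
    (window (T := T) (c := c) (by linarith) 1 g
      (show H.D 1 g / 2 ≤ H.D 1 g / 2 + 2 * c by linarith)) (by
      intro h hh
      by_cases h3 : H.D 1 h ≤ H.D 1 g / 2
      · exact Or.inl (Or.inl ⟨hh, h3⟩)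
      have hg' : T.On c (g⁻¹ * h) 1 g⁻¹ := by
        simpa using hh.symm.left g⁻¹
      have e5 : H.D 1 (g⁻¹ * h) = H.D g h := (H.D_eq_one g h).symm
      by_cases h4 : H.D g h ≤ H.D 1 g / 2
      · exact Or.inl (Or.inr ⟨hg', by rw [e5, H.D_one_inv]; exact h4⟩)
      · refine Or.inr ⟨hh, (not_le.1 h3).le, ?_⟩
        have e6 := hh.1
        unfold gp at e6
        linarith)).2
  have e5 : T.M * (H.D 1 g / 2 + 2 * c - H.D 1 g / 2 + 1) = T.M * (2 * c + 1) := by ring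
  linarith

variable (T) in
include T in
lemma eventually_almostConj_le (E : ℕ) {κ ε : ℝ} (hκ : 0 < κ) (hε : 0 < ε) :
    ∀ᶠ n : ℕ in Filter.atTop,
    ({g | wordLength S g ≤ n ∧ AlmostConj S E (κ * n) g}.ncard : ℝ) ≤ ε * growth S n := by
  obtain ⟨L, C, hC0, hC⟩ := T.exists_growth_mul_le hS
  set P := C ^ 2 * (L + 2) * growth S (E + 2 * L) * growth S E with hP
  have hP0 : 0 ≤ P := by positivity
  filter_upwards [T.eventually_cube_le_growth hS hκ (A := (P + 1) / ε) (by positivity)] with n hn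
  have hn0 : (0:ℝ) ≤ n := Nat.cast_nonneg _
  set A : ℕ → Set G := fun k => {g | κ * n ≤ k ∧ 2 * k ≤ n + E ∧ ∃ v₁ v₂ x : G,
    wordLength S v₁ ≤ k ∧ wordLength S v₂ ≤ n + E - 2 * k ∧ wordLength S x ≤ E ∧
    v₁ * v₂ * x * v₁⁻¹ = g} with hA
  set b := ε * growth S n / (n + 1) with hb
  have hb0 : 0 ≤ b := by positivity
  have hAk : ∀ k ≤ n, (A k).Finite ∧ ((A k).ncard : ℝ) ≤ b := by
    intro k hk
    by_cases hk1 : κ * n ≤ k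
    swap
    · have : A k = ∅ := by ext g; simp [hA, hk1]
      rw [this]; simpa using hb0
    by_cases hk2 : 2 * k ≤ n + E
    swap
    · have : A k = ∅ := by ext g; simp only [hA, hk2]; simp
      rw [this]; simpa using hb0
    set Z := wordBall S k ×ˢ wordBall S (n + E - 2 * k) ×ˢ wordBall S E with hZ
    have hZfin : Z.Finite :=
      (wordBall_finite hS _).prod ((wordBall_finite hS _).prod (wordBall_finite hS _))
    have hZcard : (Z.ncard : ℝ) = growth S k * (growth S (n + E - 2 * k) * growth S E) := by
      rw [hZ, Set.ncard_prod, Set.ncard_prod]; push_cast; rfl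
    have hsub : A k ⊆ (fun p : G × G × G => p.1 * p.2.1 * p.2.2 * p.1⁻¹) '' Z := by
      rintro g ⟨-, -, v₁, v₂, x, h1, h2, h3, h4⟩
      exact ⟨(v₁, v₂, x), ⟨h1, h2, h3⟩, h4⟩
    refine ⟨(hZfin.image _).subset hsub, ?_⟩
    have h1 : ((A k).ncard : ℝ) ≤ Z.ncard := by
      exact_mod_cast (Set.ncard_le_ncard hsub (hZfin.image _)).trans (Set.ncard_image_le hZfin)
    refine h1.trans ?_
    rw [hZcard, hb, le_div_iff₀ (by positivity)]
    have h2 := hC k k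
    have h3 := hC (k + k + L) (n + E - 2 * k)
    rw [show k + k + L + (n + E - 2 * k) + L = n + (E + 2 * L) by omega] at h3
    have h4 : (growth S (n + (E + 2 * L)) : ℝ) ≤ growth S n * growth S (E + 2 * L) := by
      exact_mod_cast growth_add_le hS n (E + 2 * L)
    have h5 : (growth S ⌊κ * n⌋₊ : ℝ) ≤ growth S k := by
      exact_mod_cast growth_mono hS (Nat.floor_le_of_le hk1)
    have h6 := hn.trans h5
    have hkn : (k : ℝ) ≤ n := by exact_mod_cast hk
    have hL0 : (0:ℝ) ≤ L := Nat.cast_nonneg _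
    have hk0 : (0:ℝ) ≤ k := Nat.cast_nonneg _
    push_cast at h3
    set y := (growth S k : ℝ)
    set z := (growth S (n + E - 2 * k) : ℝ)
    set w := (growth S n : ℝ)
    set q := (growth S (E + 2 * L) : ℝ)
    set e := (growth S E : ℝ)
    have hy0 : 0 ≤ y := Nat.cast_nonneg _
    have hz0 : 0 ≤ z := Nat.cast_nonneg _
    have hw0 : 0 ≤ w := Nat.cast_nonneg _
    have he0 : 0 ≤ e := Nat.cast_nonneg _
    have hq0 : 0 ≤ q := Nat.cast_nonneg _
    have h7 : y * y * z ≤ C ^ 2 * (L + 2) * q * w * (n + 1) ^ 2 := by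
      calc y * y * z ≤ C * (k + 1) * growth S (k + k + L) * z := by gcongr
        _ = C * (k + 1) * (growth S (k + k + L) * z) := by ring
        _ ≤ C * (k + 1) * (C * (k + k + L + 1) * (w * q)) :=
          mul_le_mul_of_nonneg_left (h3.trans (by gcongr)) (by positivity)
        _ ≤ C * (n + 1) * (C * ((L + 2) * (n + 1)) * (w * q)) := by
          gcongr
          nlinarith
        _ = _ := by ring
    have h8 : ((P + 1) / ε * ((n:ℝ) + 1) ^ 3) * (y * z) ≤
        C ^ 2 * (L + 2) * q * w * (n + 1) ^ 2 := by
      refine le_trans ?_ h7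
      rw [mul_assoc y y z]
      gcongr
    have h9 : ((P + 1) * (y * (z * e) * (n + 1))) * (n + 1) ^ 2 ≤ (P * (ε * w)) * (n + 1) ^ 2 := by
      have : ε * e * (((P + 1) / ε * ((n:ℝ) + 1) ^ 3) * (y * z)) ≤
        ε * e * (C ^ 2 * (L + 2) * q * w * (n + 1) ^ 2) := by gcongr
      calc _ = ε * e * (((P + 1) / ε * ((n:ℝ) + 1) ^ 3) * (y * z)) := by field_simp
        _ ≤ _ := this
        _ = _ := by rw [hP]; ring
    have h10 := le_of_mul_le_mul_right h9 (by positivity)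
    have h11 : P * (ε * w) ≤ (P + 1) * (ε * w) := by gcongr; linarith
    exact le_of_mul_le_mul_left (h10.trans h11) (by positivity)
  have hsub : {g | wordLength S g ≤ n ∧ AlmostConj S E (κ * n) g} ⊆
      ⋃ k ∈ Finset.range (n + 1), A k := by
    rintro g ⟨hgn, v₁, v₂, v₃, h1, h2, h3, h4⟩
    have h5 := wordLength_mul_le hS v₃⁻¹ (v₃ * v₁)
    rw [inv_mul_cancel_left, wordLength_inv hS] at h5
    simp only [Set.mem_iUnion, Finset.mem_range]
    refine ⟨wordLength S v₁, by omega, h4, by omega, v₁, v₂, v₃ * v₁, le_rfl, by omega, h3, ?_⟩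
    rw [← h1]; group
  have hfin : (⋃ k ∈ Finset.range (n + 1), A k).Finite :=
    Set.Finite.biUnion (Finset.finite_toSet _) fun k hk =>
      (hAk k (by simpa [Nat.lt_succ_iff] using hk)).1
  have h1 := (Set.ncard_le_ncard hsub hfin).trans (Finset.set_ncard_biUnion_le _ _)
  have h2 : (∑ k ∈ Finset.range (n + 1), ((A k).ncard : ℝ)) ≤
      (Finset.range (n + 1)).card • b :=
    Finset.sum_le_card_nsmul _ _ _ fun k hk =>
      (hAk k (by simpa [Nat.lt_succ_iff] using hk)).2
  have h3 : ({g | wordLength S g ≤ n ∧ AlmostConj S E (κ * n) g}.ncard : ℝ) ≤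
    ∑ k ∈ Finset.range (n + 1), ((A k).ncard : ℝ) := by exact_mod_cast h1
  refine h3.trans (h2.trans (le_of_eq ?_))
  rw [Finset.card_range, nsmul_eq_mul, hb]
  push_cast
  field_simp

end Setup
end HypMetric

end

section

namespace HypMetric
namespace Setup

variable {G : Type*} [Group G] {H : HypMetric G} {T : H.Setup}
variable {S : Finset G} (hS : Subgroup.closure (S : Set G) = ⊤)

variable (T) in
include T hS in
lemma eventually_not_isMorse_le {ε : ℝ} (hε : 0 < ε) : ∀ᶠ n : ℕ in Filter.atTop,
    ({g | wordLength S g ≤ n ∧ ¬ IsMorse S g}.ncard : ℝ) ≤ ε * growth S n := by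
  obtain ⟨η, hη, hlight⟩ := T.exists_eventually_light_le hS (ε := ε / 3) (by positivity)
  obtain ⟨E, κ, hκ, hconj⟩ := T.exists_almostConj hS (η := η / 4) (by positivity)
  filter_upwards [hlight, hconj, T.eventually_prefix hS hη,
    T.eventually_almostConj_le hS E hκ (ε := ε / 3) (by positivity),
    T.eventually_growth_half_le hS (ε := ε / 3) (by positivity)] with n h1 h2 h3 h4 h5
  have hfin : ∀ P : G → Prop, {g | wordLength S g ≤ n ∧ P g}.Finite := fun P =>
    (wordBall_finite hS n).subset fun g hg => hg.1
  have := (finite_and_ncard_le_add (A := {g | wordLength S g ≤ n ∧ ¬ IsMorse S g})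
    (finite_and_ncard_le_add (A := {g | wordLength S g ≤ n ∧ n / 2 < wordLength S g ∧
      ∀ u v, u * v = g → wordLength S u + wordLength S v = wordLength S g →
        ({h | T.On (T.c0 + 2 * H.δ) h 1 u}.ncard : ℝ) ≤ η * n} ∪
        {g | wordLength S g ≤ n ∧ AlmostConj S E (κ * n) g})
      ⟨hfin _, h1⟩ ⟨hfin _, h4⟩ (fun g hg => hg))
    (⟨wordBall_finite hS (n / 2), h5⟩ : (wordBall S (n / 2)).Finite ∧ _) (by
      rintro g ⟨hgn, hg⟩
      by_cases hlen : n / 2 < wordLength S g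
      swap
      · exact Or.inr (not_lt.1 hlen)
      by_cases hl : ∀ u v, u * v = g → wordLength S u + wordLength S v = wordLength S g →
        ({h | T.On (T.c0 + 2 * H.δ) h 1 u}.ncard : ℝ) ≤ η * n
      · exact Or.inl (Or.inl ⟨hgn, hlen, hl⟩)
      push Not at hl
      obtain ⟨u, v, rfl, huv, hbig⟩ := hl
      exact Or.inl (Or.inr ⟨hgn, h2 _ hgn hg (h3 u v huv hgn hbig)⟩))).2
  linarith

end Setup
end HypMetric

end

/-- Theorem 1.1: Morse elements are generic in acylindrically hyperbolic groups. -/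
theorem morse_generic {G : Type*} [Group G] (hG : AcylindricallyHyperbolic G)
    (S : Finset G) (hSgen : Subgroup.closure (S : Set G) = ⊤) :
    Filter.Tendsto (fun n : ℕ =>
      (({g ∈ ball S (n:ℝ) | IsMorse S g}).ncard : ℝ) / ((ball S (n:ℝ)).ncard : ℝ))
      Filter.atTop (nhds 1) := by
  obtain ⟨hnv, ⟨W⟩⟩ := hG
  obtain ⟨H, φ, ⟨τ, hτ, hlim⟩, hwpd⟩ := W.exists_hypMetric
  obtain ⟨T⟩ := HypMetric.exists_setup (HypMetric.loxWPD_of_tendsto hτ hlim hwpd) hnv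
  rw [Metric.tendsto_nhds]
  intro ε hε
  filter_upwards [T.eventually_not_isMorse_le hSgen (ε := ε / 2) (by positivity)] with n hn
  rw [ball_natCast]
  have hfin := wordBall_finite hSgen n
  have hpos : (0:ℝ) < growth S n := by exact_mod_cast growth_pos hSgen n
  have hsum : ({g ∈ wordBall S n | IsMorse S g}.ncard : ℝ) +
      {g | wordLength S g ≤ n ∧ ¬ IsMorse S g}.ncard = growth S n := by
    have h1 := Set.ncard_inter_add_ncard_sdiff_eq_ncard (wordBall S n) {g | IsMorse S g} hfin
    exact_mod_cast h1
  have h2 : ({g ∈ wordBall S n | IsMorse S g}.ncard : ℝ) / (wordBall S n).ncard - 1 =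
      - ({g | wordLength S g ≤ n ∧ ¬ IsMorse S g}.ncard / growth S n) := by
    show ({g ∈ wordBall S n | IsMorse S g}.ncard : ℝ) / growth S n - 1 = _
    rw [← hsum] at hpos ⊢
    field_simp
    ring
  rw [Real.dist_eq, h2, abs_neg, abs_of_nonneg (by positivity)]
  have h3 : ({g | wordLength S g ≤ n ∧ ¬ IsMorse S g}.ncard : ℝ) / growth S n ≤ ε / 2 := by
    rwa [div_le_iff₀ hpos]
  linarith

end AcylCount
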